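/- arXiv:1709.02806 — 9 statements merged into one kernel-verified Lean document; each statement's English description precedes it below -/
import Mathlib

section
/- Let (G, ε) be any signed group, let n be an odd integer with n > 1, let k ≥ 1, and let (u_1, …, u_k) be any tuple of positive integers. Then there does not exist a full signed group orthogonal design SOD(n; u_1, …, u_k) over (G, ε). -/
/-- A signed group: a group `G` together with a distinguished central element `ε`
of order two. -/
structure SignedGroup where
  /-- the underlying group -/
  G : Type
  /-- the group structure -/
  grp : Group G
  /-- the distinguished central element -/
  ε : G
  central : ∀ g : G, ε * g = g * ε
  sq : ε * ε = 1
  ne_one : ε ≠ 1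

attribute [instance] SignedGroup.grp

namespace SignedGroup

/-- The number of columns `j` in row `a` whose entry is the variable `x i`
(with some signed-group coefficient). -/
noncomputable def rowCount (S : SignedGroup) {n k : ℕ} (X : Fin n → Fin n → Option (S.G × Fin k))
    (a : Fin n) (i : Fin k) : ℕ :=
  Nat.card {j : Fin n // ∃ g : S.G, X a j = some (g, i)}

/-- `pairCount S X a b i i' g` is the number of columns `j` for which
`X a j = some (s, i)` and `X b j = some (s', i')` with `s * s'⁻¹ = g`. -/
noncomputable def pairCount (S : SignedGroup) {n k : ℕ} (X : Fin n → Fin n → Option (S.G × Fin k))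
    (a b : Fin n) (i i' : Fin k) (g : S.G) : ℕ :=
  Nat.card {j : Fin n //
    ∃ s s' : S.G, X a j = some (s, i) ∧ X b j = some (s', i') ∧ s * s'⁻¹ = g}

/-- `X` is a signed group orthogonal design `SOD(n; u 0, …, u (k-1))` over `S`. -/
def IsSOD (S : SignedGroup) {n k : ℕ} (u : Fin k → ℕ)
    (X : Fin n → Fin n → Option (S.G × Fin k)) : Prop :=
  (∀ (a : Fin n) (i : Fin k), S.rowCount X a i = u i) ∧
  (∀ a b : Fin n, a ≠ b → ∀ (i i' : Fin k) (g : S.G),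
    S.pairCount X a b i i' g + S.pairCount X a b i' i g =
      S.pairCount X a b i i' (S.ε * g) + S.pairCount X a b i' i (S.ε * g))

/-- An SOD is full if it has no zero entries. -/
def IsFull (S : SignedGroup) {n k : ℕ} (X : Fin n → Fin n → Option (S.G × Fin k)) : Prop :=
  ∀ a b : Fin n, X a b ≠ none

end SignedGroup

/-- A finite type is of even cardinality if it maps to a type with a fixed-point-free involution
that preserves the sizes of the fibres. -/
theorem even_card_of_involutive_card_fiber {ι α : Type*} [Fintype ι] [DecidableEq α]
    (c : ι → α) (τ : α → α) (hτ : Function.Involutive τ) (hne : ∀ t, τ t ≠ t)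
    (hcard : ∀ t, (Finset.univ.filter fun j => c j = τ t).card =
      (Finset.univ.filter fun j => c j = t).card) :
    Even (Fintype.card ι) := by
  rw [← ZMod.natCast_eq_zero_iff_even, ← Finset.card_univ,
    Finset.card_eq_sum_card_image c Finset.univ, Nat.cast_sum]
  refine Finset.sum_involution (fun t _ => τ t) ?_ (fun t _ _ => hne t) ?_ (fun t _ => hτ t)
  · intro t _
    rw [hcard, CharTwo.add_self_eq_zero]
  · intro t ht
    have hpos : 0 < (Finset.univ.filter fun j => c j = τ t).card := by
      obtain ⟨j, -, hj⟩ := Finset.mem_image.mp ht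
      rw [hcard, Finset.card_pos]
      exact ⟨j, by simpa using hj⟩
    obtain ⟨j, hj⟩ := Finset.card_pos.mp hpos
    exact Finset.mem_image.mpr ⟨j, Finset.mem_univ j, (Finset.mem_filter.mp hj).2⟩

namespace SignedGroup

variable (S : SignedGroup) {n k : ℕ}

theorem ε_mul_ne (g : S.G) : S.ε * g ≠ g := fun h => S.ne_one (mul_eq_right.mp h)

theorem ε_mul_ε_mul (g : S.G) : S.ε * (S.ε * g) = g := by
  rw [← mul_assoc, S.sq, one_mul]

open Classical in
/-- `pairCount` for a matrix without zero entries. -/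
theorem pairCount_eq_card {X : Fin n → Fin n → Option (S.G × Fin k)}
    {p : Fin n → Fin n → S.G × Fin k} (hp : ∀ a j, X a j = some (p a j))
    (a b : Fin n) (i i' : Fin k) (g : S.G) :
    S.pairCount X a b i i' g = (Finset.univ.filter fun j =>
      (p a j).1 * (p b j).1⁻¹ = g ∧ (p a j).2 = i ∧ (p b j).2 = i').card := by
  rw [pairCount, Nat.card_eq_fintype_card, Fintype.card_subtype]
  congr 1
  ext j
  simp only [hp, Option.some.injEq, Finset.mem_filter, Finset.mem_univ, true_and, Prod.ext_iff]
  constructor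
  · rintro ⟨s, s', ⟨rfl, rfl⟩, ⟨rfl, rfl⟩, rfl⟩
    exact ⟨rfl, rfl, rfl⟩
  · rintro ⟨rfl, rfl, rfl⟩
    exact ⟨_, _, ⟨rfl, rfl⟩, ⟨rfl, rfl⟩, rfl⟩

open Classical in
/-- The number of columns with a given quotient and a given unordered pair of variables. -/
theorem card_sym2_eq_pairCount {X : Fin n → Fin n → Option (S.G × Fin k)}
    {p : Fin n → Fin n → S.G × Fin k} (hp : ∀ a j, X a j = some (p a j))
    (a b : Fin n) (i i' : Fin k) (g : S.G) :
    (Finset.univ.filter fun j =>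
      ((p a j).1 * (p b j).1⁻¹, s((p a j).2, (p b j).2)) = (g, s(i, i'))).card =
    if i = i' then S.pairCount X a b i i' g
    else S.pairCount X a b i i' g + S.pairCount X a b i' i g := by
  simp only [S.pairCount_eq_card hp, Prod.mk.injEq, Sym2.eq_iff]
  split_ifs with h
  · subst h
    simp only [or_self]
  · rw [← Finset.card_union_of_disjoint]
    · rw [← Finset.filter_or]
      simp only [and_or_left]
    · rw [Finset.disjoint_filter]
      rintro j - ⟨-, h₁, -⟩ ⟨-, h₂, -⟩
      exact h (h₁.symm.trans h₂)

end SignedGroup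

/-- There does not exist any full signed group orthogonal design of odd order `n > 1`
over any signed group. -/
theorem no_full_SOD_of_odd_order (S : SignedGroup) (n : ℕ) (hn : Odd n) (hn1 : 1 < n)
    (k : ℕ) (hk : 1 ≤ k) (u : Fin k → ℕ) (hu : ∀ i : Fin k, 0 < u i) :
    ¬ ∃ X : Fin n → Fin n → Option (S.G × Fin k), S.IsSOD u X ∧ S.IsFull X := by
  classical
  rintro ⟨X, ⟨-, horth⟩, hfull⟩
  choose p hp using fun a j => Option.ne_none_iff_exists'.mp (hfull a j)
  let a : Fin n := ⟨0, by omega⟩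
  let b : Fin n := ⟨1, hn1⟩
  have hab : a ≠ b := by simp [a, b]
  refine Nat.not_even_iff_odd.mpr hn ?_
  rw [← Fintype.card_fin n]
  refine even_card_of_involutive_card_fiber
    (fun j => ((p a j).1 * (p b j).1⁻¹, s((p a j).2, (p b j).2)))
    (fun t => (S.ε * t.1, t.2)) (fun t => ?_) (fun t h => ?_) ?_
  · simp only [S.ε_mul_ε_mul]
  · exact S.ε_mul_ne t.1 (congrArg Prod.fst h)
  · rintro ⟨g, z⟩
    induction z using Sym2.ind with
    | _ i i' =>
      have h := horth a b hab i i' g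
      simp only [S.card_sym2_eq_pairCount hp]
      split_ifs with hi
      · subst hi
        omega
      · exact h.symm
end

section
/- For every integer n > 2 there exist a signed group (G, ε), a full signed group orthogonal design SOD(2^n; u_1, …, u_{2^n}) over (G, ε) with u_i = 1 for every i, and a remrep of (G, ε) of degree 2^(2^(n−1) − 1). -/
/-- A signed permutation matrix: every row and every column has exactly one
nonzero entry, and every entry is `0`, `1` or `-1`. -/
def IsSignedPermMatrix {m : ℕ} (M : Matrix (Fin m) (Fin m) ℝ) : Prop :=
  (∀ a : Fin m, ∃! b : Fin m, M a b ≠ 0) ∧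
  (∀ b : Fin m, ∃! a : Fin m, M a b ≠ 0) ∧
  (∀ a b : Fin m, M a b = 0 ∨ M a b = 1 ∨ M a b = -1)

/-- A remrep (real monomial representation) of degree `m` of a signed group `S`. -/
def IsRemrep (S : SignedGroup) (m : ℕ) (φ : S.G → Matrix (Fin m) (Fin m) ℝ) : Prop :=
  φ 1 = 1 ∧ (∀ g h : S.G, φ (g * h) = φ g * φ h) ∧ φ S.ε = -1 ∧
  ∀ g : S.G, IsSignedPermMatrix (φ g)

open Matrix

/-- The sign character of `ZMod 2`, with real values. -/
def zmodTwoSign (x : ZMod 2) : ℝ := if x = 0 then 1 else -1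

lemma zmodTwoSign_add (x y : ZMod 2) : zmodTwoSign (x + y) = zmodTwoSign x * zmodTwoSign y := by
  have key : ∀ x y : ZMod 2, (if x + y = 0 then (1 : ℤ) else -1) =
      (if x = 0 then 1 else -1) * (if y = 0 then 1 else -1) := by decide
  simpa [zmodTwoSign] using congrArg (Int.cast : ℤ → ℝ) (key x y)

lemma zmodTwoSign_eq_or (x : ZMod 2) : zmodTwoSign x = 1 ∨ zmodTwoSign x = -1 := by
  unfold zmodTwoSign
  split_ifs <;> simp

lemma zmodTwoSign_ne_zero (x : ZMod 2) : zmodTwoSign x ≠ 0 := by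
  rcases zmodTwoSign_eq_or x with h | h <;> simp [h]

/-- The Heisenberg group of `(ZMod 2)^m`: the element `⟨c, a, b⟩` stands for the operator
`δ k ↦ (-1) ^ (c + b ⬝ᵥ k) δ (k + a)` on functions on `(ZMod 2)^m`. -/
@[ext]
structure HeisenbergTwo (m : ℕ) where
  /-- the exponent of the sign -/
  sgn : ZMod 2
  /-- the translation vector -/
  shift : Fin m → ZMod 2
  /-- the modulation vector -/
  freq : Fin m → ZMod 2

namespace HeisenbergTwo

variable {m : ℕ}

instance : Mul (HeisenbergTwo m) :=
  ⟨fun g h => ⟨g.sgn + h.sgn + g.freq ⬝ᵥ h.shift, g.shift + h.shift, g.freq + h.freq⟩⟩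

instance : One (HeisenbergTwo m) := ⟨⟨0, 0, 0⟩⟩

instance : Inv (HeisenbergTwo m) := ⟨fun g => ⟨-g.sgn + g.freq ⬝ᵥ g.shift, -g.shift, -g.freq⟩⟩

lemma mul_def (g h : HeisenbergTwo m) :
    g * h = ⟨g.sgn + h.sgn + g.freq ⬝ᵥ h.shift, g.shift + h.shift, g.freq + h.freq⟩ := rfl

lemma one_def : (1 : HeisenbergTwo m) = ⟨0, 0, 0⟩ := rfl

lemma inv_def (g : HeisenbergTwo m) :
    g⁻¹ = ⟨-g.sgn + g.freq ⬝ᵥ g.shift, -g.shift, -g.freq⟩ := rfl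

instance : Group (HeisenbergTwo m) :=
  Group.ofLeftAxioms
    (fun g h k => by
      simp only [mul_def, dotProduct_add, add_dotProduct, add_assoc, mk.injEq, and_true]
      ring)
    (fun g => by simp [mul_def, one_def])
    (fun g => by
      simp only [mul_def, one_def, inv_def, neg_dotProduct, neg_add_cancel, mk.injEq, and_true]
      ring)

/-- The Heisenberg group as a signed group, with the central sign as distinguished element. -/
def signedGroup (m : ℕ) : SignedGroup where
  G := HeisenbergTwo m
  grp := inferInstance
  ε := ⟨1, 0, 0⟩
  central g := by simp [mul_def, add_comm]
  sq := by
    simp only [mul_def, one_def, dotProduct_zero, add_zero, mk.injEq, and_true]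
    decide
  ne_one := by simp [one_def]

/-- The monomial matrix of the operator attached to an element of the Heisenberg group. -/
def toMatrix (g : HeisenbergTwo m) : Matrix (Fin m → ZMod 2) (Fin m → ZMod 2) ℝ :=
  fun r k => if r = k + g.shift then zmodTwoSign (g.sgn + g.freq ⬝ᵥ k) else 0

lemma toMatrix_one : toMatrix (1 : HeisenbergTwo m) = 1 := by
  ext r k
  simp [toMatrix, one_def, Matrix.one_apply, zmodTwoSign]

lemma toMatrix_mul (g h : HeisenbergTwo m) : toMatrix (g * h) = toMatrix g * toMatrix h := by
  ext r k
  rw [Matrix.mul_apply, Finset.sum_eq_single (k + h.shift)]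
  · have hshift : k + (g.shift + h.shift) = k + h.shift + g.shift := by abel
    simp only [toMatrix, mul_def, hshift, if_true]
    split_ifs
    · rw [← zmodTwoSign_add]
      congr 1
      simp only [dotProduct_add, add_dotProduct]
      ring
    · simp
  · intro l _ hl
    simp [toMatrix, hl]
  · simp

lemma toMatrix_sign : toMatrix (⟨1, 0, 0⟩ : HeisenbergTwo m) = -1 := by
  ext r k
  by_cases h : r = k <;> simp [toMatrix, zmodTwoSign, h]

lemma toMatrix_ne_zero_iff (g : HeisenbergTwo m) (r k : Fin m → ZMod 2) :
    toMatrix g r k ≠ 0 ↔ r = k + g.shift := by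
  simp [toMatrix, zmodTwoSign_ne_zero]

lemma isSignedPermMatrix_submatrix_toMatrix {d : ℕ} (E : Fin d ≃ (Fin m → ZMod 2))
    (g : HeisenbergTwo m) : IsSignedPermMatrix ((toMatrix g).submatrix E E) := by
  simp only [IsSignedPermMatrix, Matrix.submatrix_apply, toMatrix_ne_zero_iff]
  refine ⟨fun r => ⟨E.symm (E r - g.shift), by simp, fun k hk => ?_⟩,
    fun k => ⟨E.symm (E k + g.shift), by simp, fun r hr => ?_⟩, fun r k => ?_⟩
  · simp only at hk
    simp [hk]
  · simp only at hr
    simp [← hr]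
  · unfold toMatrix
    split_ifs
    · exact Or.inr (zmodTwoSign_eq_or _)
    · exact Or.inl rfl

/-- The Heisenberg group of `(ZMod 2)^m` has a remrep of degree `2^m`. -/
lemma exists_isRemrep (m : ℕ) :
    ∃ φ : (signedGroup m).G → Matrix (Fin (2 ^ m)) (Fin (2 ^ m)) ℝ,
      IsRemrep (signedGroup m) (2 ^ m) φ := by
  let E : Fin (2 ^ m) ≃ (Fin m → ZMod 2) :=
    (Fintype.equivFinOfCardEq (by simp [ZMod.card])).symm
  refine ⟨fun g => (toMatrix g).submatrix E E, ?_, fun g h => ?_, ?_,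
    isSignedPermMatrix_submatrix_toMatrix E⟩
  · change (toMatrix (1 : HeisenbergTwo m)).submatrix E E = 1
    simp [toMatrix_one]
  · change (toMatrix (HeisenbergTwo.instMul.mul g h)).submatrix E E = _
    rw [Matrix.submatrix_mul_equiv]
    exact congrArg (fun M => M.submatrix E E) (toMatrix_mul g h)
  · change (toMatrix (⟨1, 0, 0⟩ : HeisenbergTwo m)).submatrix E E = -1
    rw [toMatrix_sign, Matrix.submatrix_neg]
    simp

end HeisenbergTwo

/-- The hyperbolic quadratic form on `(ZMod 2 × ZMod 2)^m`. -/
def hyperbolicForm {m : ℕ} (v : Fin m → ZMod 2 × ZMod 2) : ZMod 2 := ∑ t, (v t).1 * (v t).2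

lemma hyperbolicForm_append {m l : ℕ} (v : Fin m → ZMod 2 × ZMod 2)
    (w : Fin l → ZMod 2 × ZMod 2) :
    hyperbolicForm (Fin.append v w) = hyperbolicForm v + hyperbolicForm w := by
  simp [hyperbolicForm, Fin.sum_univ_add]

lemma hyperbolicForm_sub_comm {m : ℕ} (v w : Fin m → ZMod 2 × ZMod 2) :
    hyperbolicForm (v - w) = hyperbolicForm (w - v) := by
  refine Finset.sum_congr rfl fun t _ => ?_
  simp only [Pi.sub_apply, Prod.fst_sub, Prod.snd_sub]
  ring

lemma append_sub_append {m l : ℕ} (v v' : Fin m → ZMod 2 × ZMod 2)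
    (w w' : Fin l → ZMod 2 × ZMod 2) :
    Fin.append v w - Fin.append v' w' = Fin.append (v - v') (w - w') := by
  ext t : 1
  refine Fin.addCases (fun s => ?_) (fun s => ?_) t <;> simp

/-- A family of vectors on which the hyperbolic form takes the value `1`, as it does on the
difference of any two of them. Its members index anticommuting complex structures. -/
def IsCliffordFamily {p m : ℕ} (u : Fin p → Fin m → ZMod 2 × ZMod 2) : Prop :=
  (∀ i, hyperbolicForm (u i) = 1) ∧ ∀ i j, i ≠ j → hyperbolicForm (u i - u j) = 1

/-- Seven vectors encoding the octonion units. -/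
def octonionFamily : Fin 7 → Fin 3 → ZMod 2 × ZMod 2 :=
  ![![(1, 1), (0, 0), (0, 0)],
    ![(1, 0), (1, 1), (0, 0)],
    ![(0, 1), (1, 1), (1, 0)],
    ![(1, 0), (1, 0), (1, 1)],
    ![(0, 1), (0, 0), (1, 1)],
    ![(1, 0), (0, 1), (1, 1)],
    ![(0, 1), (1, 1), (0, 1)]]

lemma isCliffordFamily_octonionFamily : IsCliffordFamily octonionFamily := by
  unfold IsCliffordFamily hyperbolicForm
  decide

/-- Eight vectors realizing the eightfold periodicity of real Clifford algebras. -/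
def periodicityFamily : Fin 8 → Fin 4 → ZMod 2 × ZMod 2 :=
  Fin.cons ![(1, 1), (0, 0), (0, 0), (0, 0)] fun i => Fin.cons (0, 1) (octonionFamily i)

/-- The vector whose operator is an involution anticommuting with `periodicityFamily`. -/
def periodicityGrading : Fin 4 → ZMod 2 × ZMod 2 := ![(1, 0), (0, 0), (0, 0), (0, 0)]

lemma isCliffordFamily_periodicityFamily : IsCliffordFamily periodicityFamily := by
  unfold IsCliffordFamily hyperbolicForm
  decide

lemma hyperbolicForm_periodicityGrading : hyperbolicForm periodicityGrading = 0 := by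
  unfold hyperbolicForm
  decide

lemma hyperbolicForm_periodicityGrading_sub (i : Fin 8) :
    hyperbolicForm (periodicityGrading - periodicityFamily i) = 0 := by
  unfold hyperbolicForm
  revert i
  decide

lemma IsCliffordFamily.exists_add_eight {p m : ℕ} {u : Fin p → Fin m → ZMod 2 × ZMod 2}
    (hu : IsCliffordFamily u) :
    ∃ u' : Fin (p + 8) → Fin (m + 4) → ZMod 2 × ZMod 2, IsCliffordFamily u' := by
  have hzero : hyperbolicForm (0 : Fin m → ZMod 2 × ZMod 2) = 0 := by simp [hyperbolicForm]
  have hzero' : hyperbolicForm (0 : Fin 4 → ZMod 2 × ZMod 2) = 0 := by simp [hyperbolicForm]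
  have hcross : ∀ i j, hyperbolicForm (Fin.append (u i) periodicityGrading -
      Fin.append 0 (periodicityFamily j)) = 1 := fun i j => by
    rw [append_sub_append, hyperbolicForm_append, sub_zero, hu.1,
      hyperbolicForm_periodicityGrading_sub, add_zero]
  refine ⟨Fin.append (fun i => Fin.append (u i) periodicityGrading)
    (fun j => Fin.append 0 (periodicityFamily j)), fun i => ?_, fun i j hij => ?_⟩
  · refine Fin.addCases (fun i => ?_) (fun i => ?_) i
    · rw [Fin.append_left, hyperbolicForm_append, hu.1, hyperbolicForm_periodicityGrading,
        add_zero]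
    · rw [Fin.append_right, hyperbolicForm_append, hzero,
        isCliffordFamily_periodicityFamily.1, zero_add]
  · induction i using Fin.addCases with
    | left i =>
      induction j using Fin.addCases with
      | left j =>
        rw [Fin.append_left, Fin.append_left, append_sub_append, hyperbolicForm_append,
          hu.2 i j (by rintro rfl; exact hij rfl), sub_self, hzero', add_zero]
      | right j =>
        rw [Fin.append_left, Fin.append_right]
        exact hcross i j
    | right i =>
      induction j using Fin.addCases with
      | left j =>
        rw [Fin.append_left, Fin.append_right, hyperbolicForm_sub_comm]
        exact hcross j i
      | right j =>
        rw [Fin.append_right, Fin.append_right, append_sub_append, hyperbolicForm_append,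
          isCliffordFamily_periodicityFamily.2 i j (by rintro rfl; exact hij rfl), sub_self,
          hzero, zero_add]

lemma exists_isCliffordFamily (k : ℕ) :
    ∃ u : Fin (8 * k + 7) → Fin (4 * k + 3) → ZMod 2 × ZMod 2, IsCliffordFamily u := by
  induction k with
  | zero => exact ⟨octonionFamily, isCliffordFamily_octonionFamily⟩
  | succ k ih =>
    obtain ⟨u, hu⟩ := ih
    rw [show 8 * (k + 1) + 7 = 8 * k + 7 + 8 by ring,
      show 4 * (k + 1) + 3 = 4 * k + 3 + 4 by ring]
    exact hu.exists_add_eight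

/-- The quotients of distinct members are negated by exchanging the two members. -/
def IsHurwitzFamily (S : SignedGroup) {p : ℕ} (e : Fin p → S.G) : Prop :=
  ∀ i j, i ≠ j → e j * (e i)⁻¹ = S.ε * (e i * (e j)⁻¹)

lemma IsCliffordFamily.exists_isHurwitzFamily {p m : ℕ} {u : Fin p → Fin m → ZMod 2 × ZMod 2}
    (hu : IsCliffordFamily u) :
    ∃ e : Fin (p + 1) → (HeisenbergTwo.signedGroup m).G,
      IsHurwitzFamily (HeisenbergTwo.signedGroup m) e := by
  let v : Fin (p + 1) → Fin m → ZMod 2 × ZMod 2 := Fin.cons 0 u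
  have hv : ∀ i j, i ≠ j → hyperbolicForm (v i - v j) = 1 := by
    intro i j hij
    induction i using Fin.cases with
    | zero =>
      induction j using Fin.cases with
      | zero => exact absurd rfl hij
      | succ j => rw [hyperbolicForm_sub_comm]; simpa [v] using hu.1 j
    | succ i =>
      induction j using Fin.cases with
      | zero => simpa [v] using hu.1 i
      | succ j => simpa [v] using hu.2 i j (by rintro rfl; exact hij rfl)
  let e : Fin (p + 1) → HeisenbergTwo m := fun i => ⟨0, fun t => (v i t).1, fun t => (v i t).2⟩
  refine ⟨e, fun i j hij => ?_⟩
  change e j * (e i)⁻¹ = (⟨1, 0, 0⟩ : HeisenbergTwo m) * (e i * (e j)⁻¹)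
  have hneg : ∀ x : ZMod 2, -x = x := by decide
  have hform : (∑ t, (v i t).2 * (v i t).1) + (∑ t, (v j t).2 * (v j t).1) +
      (∑ t, (v i t).2 * (v j t).1) + (∑ t, (v j t).2 * (v i t).1) = 1 := by
    rw [← hv i j hij, ← Finset.sum_add_distrib, ← Finset.sum_add_distrib,
      ← Finset.sum_add_distrib]
    refine Finset.sum_congr rfl fun t _ => ?_
    simp only [Pi.sub_apply, Prod.fst_sub, Prod.snd_sub, CharTwo.sub_eq_add]
    ring
  have hsolve : ∀ x y z w : ZMod 2, x + y + z + w = 1 → x + w = 1 + (y + z) := by decide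
  ext t
  · simpa [e, HeisenbergTwo.mul_def, HeisenbergTwo.inv_def, dotProduct, hneg] using
      hsolve _ _ _ _ hform
  · simp [e, HeisenbergTwo.mul_def, HeisenbergTwo.inv_def, hneg, add_comm]
  · simp [e, HeisenbergTwo.mul_def, HeisenbergTwo.inv_def, hneg, add_comm]

lemma Nat.card_subtype_eq_one_of_unique {α : Type*} {P : α → Prop} (h : ∃! x, P x) :
    Nat.card {x // P x} = 1 := by
  obtain ⟨x, hx, hunique⟩ := h
  exact Nat.card_eq_one_iff_unique.mpr
    ⟨⟨fun a b => Subtype.ext ((hunique _ a.2).trans (hunique _ b.2).symm)⟩, ⟨x, hx⟩⟩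

/-- If the rows of the Latin square `f` are involutions satisfying `f b ∘ f a ∘ f b = f a`, then
multiplying the variable `x i` by the `i`-th member of a Hurwitz family yields a full signed
group orthogonal design. -/
lemma IsHurwitzFamily.isSOD {S : SignedGroup} {p : ℕ} {e : Fin p → S.G}
    (he : IsHurwitzFamily S e) {f : Fin p → Fin p → Fin p} (hinv : ∀ a j, f a (f a j) = j)
    (hconj : ∀ a b j, f b (f a (f b j)) = f a j) (hne : ∀ a b j, a ≠ b → f a j ≠ f b j) :
    S.IsSOD (fun _ => 1) (fun a j => some (e (f a j), f a j)) := by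
  have hswap : ∀ a b, a ≠ b → ∀ i i' g,
      S.pairCount (fun a j => some (e (f a j), f a j)) a b i i' g =
        S.pairCount (fun a j => some (e (f a j), f a j)) a b i' i (S.ε * g) := by
    intro a b hab i i' g
    let σ : Fin p ≃ Fin p :=
      ⟨fun j => f a (f b j), fun j => f b (f a j), fun j => by simp [hinv], fun j => by simp [hinv]⟩
    refine Nat.card_congr (σ.subtypeEquiv fun j => ?_)
    have hσa : f a (σ j) = f b j := hinv _ _
    have hσb : f b (σ j) = f a j := hconj _ _ _
    have hquot := he _ _ (hne a b j hab)
    simp only [hσa, hσb, Option.some.injEq, Prod.mk.injEq]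
    constructor
    · rintro ⟨s, s', ⟨rfl, rfl⟩, ⟨rfl, rfl⟩, rfl⟩
      exact ⟨_, _, ⟨rfl, rfl⟩, ⟨rfl, rfl⟩, hquot⟩
    · rintro ⟨s, s', ⟨rfl, rfl⟩, ⟨rfl, rfl⟩, h⟩
      exact ⟨_, _, ⟨rfl, rfl⟩, ⟨rfl, rfl⟩, mul_left_cancel (hquot.symm.trans h)⟩
  refine ⟨fun a i => Nat.card_subtype_eq_one_of_unique ⟨f a i, ?_, ?_⟩, fun a b hab i i' g => ?_⟩
  · exact ⟨e i, by simp [hinv]⟩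
  · rintro j ⟨g, hg⟩
    simp only [Option.some.injEq, Prod.mk.injEq] at hg
    rw [← hg.2, hinv]
  · rw [hswap a b hab i i' g, hswap a b hab i' i g, add_comm]

/-- Addition of `(ZMod 2)^n`, transported to `Fin (2^n)`. -/
lemma exists_latinSquare_two_pow (n : ℕ) :
    ∃ f : Fin (2 ^ n) → Fin (2 ^ n) → Fin (2 ^ n), (∀ a j, f a (f a j) = j) ∧
      (∀ a b j, f b (f a (f b j)) = f a j) ∧ ∀ a b j, a ≠ b → f a j ≠ f b j := by
  let E : (Fin n → ZMod 2) ≃ Fin (2 ^ n) := Fintype.equivFinOfCardEq (by simp [ZMod.card])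
  have hself : ∀ x : Fin n → ZMod 2, x + x = 0 := fun x => funext fun t =>
    CharTwo.add_self_eq_zero (x t)
  refine ⟨fun a j => E (E.symm a + E.symm j), fun a j => ?_, fun a b j => ?_,
    fun a b j hab => by simpa using hab⟩
  · simp [← add_assoc, hself]
  · simp [add_left_comm (E.symm a), ← add_assoc (E.symm b), hself]

/-- For every `n > 2` there exist a signed group `S`, a full
`SOD(2^n; 1, 1, …, 1)` (with `2^n` variables) over `S`, and a remrep of `S` of
degree `2^(2^(n-1) - 1)`. -/
theorem exists_full_SOD_two_pow (n : ℕ) (hn : 2 < n) :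
    ∃ (S : SignedGroup)
      (X : Fin (2 ^ n) → Fin (2 ^ n) → Option (S.G × Fin (2 ^ n)))
      (φ : S.G → Matrix (Fin (2 ^ (2 ^ (n - 1) - 1))) (Fin (2 ^ (2 ^ (n - 1) - 1))) ℝ),
      S.IsSOD (fun _ => 1) X ∧ S.IsFull X ∧ IsRemrep S (2 ^ (2 ^ (n - 1) - 1)) φ := by
  obtain ⟨r, rfl⟩ : ∃ r, n = r + 3 := ⟨n - 3, by omega⟩
  obtain ⟨k, hk⟩ : ∃ k, 2 ^ r = k + 1 := ⟨2 ^ r - 1, by have := Nat.one_le_two_pow (n := r); omega⟩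
  have hdegree : 2 ^ (r + 3 - 1) - 1 = 4 * k + 3 := by
    rw [show r + 3 - 1 = r + 2 by omega, pow_add, hk]
    omega
  have horder : 2 ^ (r + 3) = 8 * k + 7 + 1 := by
    rw [pow_add, hk]
    omega
  obtain ⟨f, hinv, hconj, hne⟩ := exists_latinSquare_two_pow (r + 3)
  obtain ⟨u, hu⟩ := exists_isCliffordFamily k
  obtain ⟨e, he⟩ := hu.exists_isHurwitzFamily
  obtain ⟨φ, hφ⟩ := HeisenbergTwo.exists_isRemrep (4 * k + 3)
  rw [hdegree]
  generalize 2 ^ (r + 3) = N at *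
  subst horder
  exact ⟨_, _, φ, he.isSOD hinv hconj hne, fun a b => Option.some_ne_none _, hφ⟩
end

section
/- For every integer n > 2, let q = 2^(n−1) + n − 1. Then there exists an orthogonal design OD(2^q; u_1, …, u_{2^n}) with u_i = 2^(2^(n−1) − 1) (i.e., u_i = 2^(q−n)) for every i = 1, …, 2^n. -/
open Matrix
/-- An orthogonal design `OD(n; u 0, …, u (k-1))`, encoded by its coefficient
matrices `A i` (of the variable `x i`). -/
def IsOD {n k : ℕ} (u : Fin k → ℕ) (A : Fin k → Matrix (Fin n) (Fin n) ℝ) : Prop :=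
  (∀ (i : Fin k) (a b : Fin n), A i a b = 0 ∨ A i a b = 1 ∨ A i a b = -1) ∧
  (∀ i j : Fin k, i ≠ j → ∀ a b : Fin n, A i a b * A j a b = 0) ∧
  (∀ i : Fin k, A i * (A i)ᵀ = (u i : ℝ) • 1) ∧
  (∀ i j : Fin k, i ≠ j → A i * (A j)ᵀ + A j * (A i)ᵀ = 0)

open scoped Kronecker

/-- All entries of the matrix are `1` or `-1`. -/
def IsSignMatrix {α β : Type*} (M : Matrix α β ℤ) : Prop :=
  ∀ a b, M a b = 1 ∨ M a b = -1

theorem IsSignMatrix.kronecker {α β γ δ : Type*} {M : Matrix α β ℤ} {N : Matrix γ δ ℤ}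
    (hM : IsSignMatrix M) (hN : IsSignMatrix N) : IsSignMatrix (M ⊗ₖ N) := by
  rintro ⟨a, c⟩ ⟨b, d⟩
  rcases hM a b with h | h <;> rcases hN c d with k | k <;> simp [kroneckerMap_apply, h, k]

/-- A Hadamard matrix `H` with a family of pairwise anticommuting, skew-symmetric, orthogonal
matrices `A i` for which every `A i * H` is again a `±1` matrix. -/
structure IsSkewFamily {ι α : Type*} [Fintype α] [DecidableEq α] (H : Matrix α α ℤ)
    (A : ι → Matrix α α ℤ) : Prop where
  sign_hadamard : IsSignMatrix H
  hadamard : H * Hᵀ = (Fintype.card α : ℤ) • 1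
  sign : ∀ i, IsSignMatrix (A i * H)
  skew : ∀ i, (A i)ᵀ = -A i
  sq : ∀ i, A i * A i = -1
  anticomm : ∀ i j, i ≠ j → A i * A j = -(A j * A i)

/-- The symmetric `2 × 2` reflection exchanging the coordinates. -/
def swapMatrix : Matrix (Fin 2) (Fin 2) ℤ := !![0, 1; 1, 0]

/-- The diagonal `2 × 2` reflection. -/
def signMatrix : Matrix (Fin 2) (Fin 2) ℤ := !![1, 0; 0, -1]

/-- The `2 × 2` rotation by a right angle. -/
def rotMatrix : Matrix (Fin 2) (Fin 2) ℤ := !![0, 1; -1, 0]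

/-- The `2 × 2` Hadamard matrix. -/
def hadamardTwo : Matrix (Fin 2) (Fin 2) ℤ := !![1, 1; 1, -1]

theorem hadamardTwo_mul_transpose : hadamardTwo * hadamardTwoᵀ = (2 : ℤ) • 1 := by decide

theorem isSignMatrix_hadamardTwo : IsSignMatrix hadamardTwo := by
  intro a b
  fin_cases a <;> fin_cases b <;> decide

theorem hadamard_kronecker {α β : Type*} [Fintype α] [DecidableEq α] [Fintype β] [DecidableEq β]
    {H : Matrix α α ℤ} {K : Matrix β β ℤ} (hH : H * Hᵀ = (Fintype.card α : ℤ) • 1)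
    (hK : K * Kᵀ = (Fintype.card β : ℤ) • 1) :
    (H ⊗ₖ K) * (H ⊗ₖ K)ᵀ = (Fintype.card (α × β) : ℤ) • 1 := by
  rw [← kroneckerMap_transpose, ← mul_kronecker_mul, hH, hK, smul_kronecker, kronecker_smul,
    one_kronecker_one, smul_smul, Fintype.card_prod, Nat.cast_mul]

/-- Two families combine, after doubling the order, into one family with an extra member. -/
def doubleFamily {ι κ α : Type*} [DecidableEq α] (A : ι → Matrix α α ℤ)
    (B : κ → Matrix α α ℤ) : Option (ι ⊕ κ) → Matrix (Fin 2 × α) (Fin 2 × α) ℤ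
  | none => rotMatrix ⊗ₖ 1
  | some (Sum.inl i) => swapMatrix ⊗ₖ A i
  | some (Sum.inr j) => signMatrix ⊗ₖ B j

theorem kronecker_neg {α β γ δ : Type*} (M : Matrix α β ℤ) (N : Matrix γ δ ℤ) :
    M ⊗ₖ (-N) = -(M ⊗ₖ N) := by
  ext; simp [kroneckerMap_apply]

theorem neg_kronecker {α β γ δ : Type*} (M : Matrix α β ℤ) (N : Matrix γ δ ℤ) :
    (-M) ⊗ₖ N = -(M ⊗ₖ N) := by
  ext; simp [kroneckerMap_apply]

theorem IsSkewFamily.double {ι κ α : Type*} [Fintype α] [DecidableEq α] {H : Matrix α α ℤ}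
    {A : ι → Matrix α α ℤ} {B : κ → Matrix α α ℤ} (hA : IsSkewFamily H A)
    (hB : IsSkewFamily H B) (hAB : ∀ i j, A i * B j = B j * A i) :
    IsSkewFamily (hadamardTwo ⊗ₖ H) (doubleFamily A B) := by
  have swap_sq : swapMatrix * swapMatrix = 1 := by decide
  have sign_sq : signMatrix * signMatrix = 1 := by decide
  have rot_sq : rotMatrix * rotMatrix = -1 := by decide
  have swap_sign : swapMatrix * signMatrix = -(signMatrix * swapMatrix) := by decide
  have swap_rot : swapMatrix * rotMatrix = -(rotMatrix * swapMatrix) := by decide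
  have sign_rot : signMatrix * rotMatrix = -(rotMatrix * signMatrix) := by decide
  have swap_tr : swapMatrixᵀ = swapMatrix := by decide
  have sign_tr : signMatrixᵀ = signMatrix := by decide
  have rot_tr : rotMatrixᵀ = -rotMatrix := by decide
  have swap_had : IsSignMatrix (swapMatrix * hadamardTwo) := by unfold IsSignMatrix; decide
  have sign_had : IsSignMatrix (signMatrix * hadamardTwo) := by unfold IsSignMatrix; decide
  have rot_had : IsSignMatrix (rotMatrix * hadamardTwo) := by unfold IsSignMatrix; decide
  refine ⟨isSignMatrix_hadamardTwo.kronecker hA.sign_hadamard,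
    hadamard_kronecker (by simpa using hadamardTwo_mul_transpose) hA.hadamard, ?_, ?_, ?_, ?_⟩
  · rintro (_ | i | j) <;> simp only [doubleFamily, ← mul_kronecker_mul, one_mul]
    exacts [rot_had.kronecker hA.sign_hadamard, swap_had.kronecker (hA.sign i),
      sign_had.kronecker (hB.sign j)]
  · rintro (_ | i | j) <;>
      simp only [doubleFamily, ← kroneckerMap_transpose, swap_tr, sign_tr, rot_tr, hA.skew,
        hB.skew, transpose_one, kronecker_neg, neg_kronecker]
  · rintro (_ | i | j) <;>
      simp only [doubleFamily, ← mul_kronecker_mul, swap_sq, sign_sq, rot_sq, hA.sq, hB.sq,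
        one_mul, kronecker_neg, neg_kronecker, one_kronecker_one]
  · rintro (_ | i | i) (_ | j | j) hij <;>
      simp only [doubleFamily, ← mul_kronecker_mul, one_mul, mul_one, swap_sign, swap_rot,
        sign_rot, neg_kronecker, neg_neg, hAB]
    · exact absurd rfl hij
    · rw [hA.anticomm i j (by rintro rfl; exact hij rfl), kronecker_neg]
    · rw [hB.anticomm i j (by rintro rfl; exact hij rfl), kronecker_neg]

theorem IsSkewFamily.kronecker_one {ι α β : Type*} [Fintype α] [DecidableEq α] [Fintype β]
    [DecidableEq β] {H : Matrix α α ℤ} {K : Matrix β β ℤ} {A : ι → Matrix α α ℤ}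
    (hA : IsSkewFamily H A) (sign_K : IsSignMatrix K)
    (hK : K * Kᵀ = (Fintype.card β : ℤ) • 1) :
    IsSkewFamily (H ⊗ₖ K) (fun i => A i ⊗ₖ (1 : Matrix β β ℤ)) where
  sign_hadamard := hA.sign_hadamard.kronecker sign_K
  hadamard := hadamard_kronecker hA.hadamard hK
  sign i := by
    rw [← mul_kronecker_mul, one_mul]
    exact (hA.sign i).kronecker sign_K
  skew i := by rw [← kroneckerMap_transpose, hA.skew, transpose_one, neg_kronecker]
  sq i := by rw [← mul_kronecker_mul, hA.sq, one_mul, neg_kronecker, one_kronecker_one]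
  anticomm i j hij := by
    rw [← mul_kronecker_mul, ← mul_kronecker_mul, hA.anticomm i j hij, neg_kronecker]

theorem IsSkewFamily.one_kronecker {ι α β : Type*} [Fintype α] [DecidableEq α] [Fintype β]
    [DecidableEq β] {H : Matrix α α ℤ} {K : Matrix β β ℤ} {A : ι → Matrix α α ℤ}
    (hA : IsSkewFamily H A) (sign_K : IsSignMatrix K)
    (hK : K * Kᵀ = (Fintype.card β : ℤ) • 1) :
    IsSkewFamily (K ⊗ₖ H) (fun i => (1 : Matrix β β ℤ) ⊗ₖ A i) where
  sign_hadamard := sign_K.kronecker hA.sign_hadamard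
  hadamard := hadamard_kronecker hK hA.hadamard
  sign i := by
    rw [← mul_kronecker_mul, one_mul]
    exact sign_K.kronecker (hA.sign i)
  skew i := by rw [← kroneckerMap_transpose, hA.skew, transpose_one, kronecker_neg]
  sq i := by rw [← mul_kronecker_mul, hA.sq, one_mul, kronecker_neg, one_kronecker_one]
  anticomm i j hij := by
    rw [← mul_kronecker_mul, ← mul_kronecker_mul, hA.anticomm i j hij, kronecker_neg]

/-- Left multiplication by the imaginary quaternion units. -/
def leftQuaternion : Fin 3 → Matrix (Fin 2 × Fin 2) (Fin 2 × Fin 2) ℤ :=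
  ![rotMatrix ⊗ₖ 1, swapMatrix ⊗ₖ rotMatrix, signMatrix ⊗ₖ rotMatrix]

/-- Right multiplication by the imaginary quaternion units. -/
def rightQuaternion : Fin 3 → Matrix (Fin 2 × Fin 2) (Fin 2 × Fin 2) ℤ :=
  ![1 ⊗ₖ rotMatrix, rotMatrix ⊗ₖ swapMatrix, rotMatrix ⊗ₖ signMatrix]

theorem isSkewFamily_leftQuaternion :
    IsSkewFamily (hadamardTwo ⊗ₖ hadamardTwo) leftQuaternion where
  sign_hadamard := isSignMatrix_hadamardTwo.kronecker isSignMatrix_hadamardTwo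
  hadamard := hadamard_kronecker hadamardTwo_mul_transpose hadamardTwo_mul_transpose
  sign := by unfold IsSignMatrix; decide +kernel
  skew := by decide +kernel
  sq := by decide +kernel
  anticomm := by decide +kernel

theorem isSkewFamily_rightQuaternion :
    IsSkewFamily (hadamardTwo ⊗ₖ hadamardTwo) rightQuaternion where
  sign_hadamard := isSignMatrix_hadamardTwo.kronecker isSignMatrix_hadamardTwo
  hadamard := hadamard_kronecker hadamardTwo_mul_transpose hadamardTwo_mul_transpose
  sign := by unfold IsSignMatrix; decide +kernel
  skew := by decide +kernel
  sq := by decide +kernel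
  anticomm := by decide +kernel

theorem leftQuaternion_mul_rightQuaternion (i j : Fin 3) :
    leftQuaternion i * rightQuaternion j = rightQuaternion j * leftQuaternion i := by
  revert i j
  decide +kernel

/-- The Hurwitz–Radon bound `ρ(2 ^ (2 ^ (n - 1) - 1)) = 2 ^ n` is attained, with `n = m + 3`. -/
theorem exists_isSkewFamily (m : ℕ) :
    ∃ (ι α : Type) (_ : Fintype ι) (_ : Fintype α) (_ : DecidableEq α) (H : Matrix α α ℤ)
      (A : ι → Matrix α α ℤ), Fintype.card ι + 1 = 2 ^ (m + 3) ∧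
        Fintype.card α = 2 ^ (2 ^ (m + 2) - 1) ∧ IsSkewFamily H A := by
  induction m with
  | zero =>
    exact ⟨_, _, inferInstance, inferInstance, inferInstance, _, _, by simp, by simp,
      isSkewFamily_leftQuaternion.double isSkewFamily_rightQuaternion
        leftQuaternion_mul_rightQuaternion⟩
  | succ m ih =>
    obtain ⟨ι, α, _, _, _, H, A, hι, hα, hA⟩ := ih
    refine ⟨_, _, inferInstance, inferInstance, inferInstance, _, _, ?_, ?_,
      (hA.kronecker_one hA.sign_hadamard hA.hadamard).double
        (hA.one_kronecker hA.sign_hadamard hA.hadamard) fun i j => ?_⟩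
    · simp only [Fintype.card_option, Fintype.card_sum]
      rw [show m + 1 + 3 = m + 3 + 1 from rfl, pow_succ 2 (m + 3), ← hι]
      ring
    · simp only [Fintype.card_prod, Fintype.card_fin, hα]
      rw [← pow_add, ← pow_succ']
      congr 1
      have : 1 ≤ 2 ^ (m + 2) := Nat.one_le_two_pow
      rw [show m + 1 + 2 = m + 2 + 1 from rfl, pow_succ 2 (m + 2)]
      omega
    · simp only [← mul_kronecker_mul, one_mul, mul_one]

/-- The permutation matrix of translation by `g`. -/
def translationMatrix {G : Type*} [DecidableEq G] [Add G] (g : G) : Matrix G G ℤ :=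
  Matrix.of fun a b => if b = a + g then 1 else 0

theorem translationMatrix_mul_transpose_apply {G : Type*} [DecidableEq G] [Fintype G] [AddGroup G]
    (g h a b : G) : (translationMatrix g * (translationMatrix h)ᵀ) a b =
      if a + g = b + h then 1 else 0 := by
  simp [translationMatrix, mul_apply, eq_comm]

theorem translationMatrix_mul_transpose_self {G : Type*} [DecidableEq G] [Fintype G] [AddGroup G]
    (g : G) : translationMatrix g * (translationMatrix g)ᵀ = 1 := by
  ext a b
  simp [translationMatrix_mul_transpose_apply, one_apply]

theorem translationMatrix_mul_transpose_comm {n : ℕ} (g h : Fin n → ZMod 2) :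
    translationMatrix g * (translationMatrix h)ᵀ =
      translationMatrix h * (translationMatrix g)ᵀ := by
  have key : ∀ a b x y : ZMod 2, a + x = b + y ↔ a + y = b + x := by decide
  ext a b
  simp only [translationMatrix_mul_transpose_apply, funext_iff, Pi.add_apply]
  simp only [fun i => key (a i) (b i) (g i) (h i)]

/-- A skew family together with the identity matrix. -/
def withOne {ι α : Type*} [DecidableEq α] (A : ι → Matrix α α ℤ) : Option ι → Matrix α α ℤ
  | none => 1
  | some i => A i

section withOne

variable {ι α : Type*} [Fintype α] [DecidableEq α] {H : Matrix α α ℤ} {A : ι → Matrix α α ℤ}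

theorem IsSkewFamily.isSignMatrix_withOne_mul (hA : IsSkewFamily H A) (i : Option ι) :
    IsSignMatrix (withOne A i * H) := by
  cases i with
  | none => simpa [withOne] using hA.sign_hadamard
  | some i => exact hA.sign i

theorem IsSkewFamily.withOne_mul_transpose_self (hA : IsSkewFamily H A) (i : Option ι) :
    withOne A i * (withOne A i)ᵀ = 1 := by
  cases i <;> simp [withOne, hA.skew, hA.sq]

theorem IsSkewFamily.withOne_mul_transpose_add (hA : IsSkewFamily H A) {i j : Option ι}
    (hij : i ≠ j) : withOne A i * (withOne A j)ᵀ + withOne A j * (withOne A i)ᵀ = 0 := by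
  rcases i with _ | i <;> rcases j with _ | j
  · exact absurd rfl hij
  · simp [withOne, hA.skew]
  · simp [withOne, hA.skew]
  · simp [withOne, hA.skew, hA.anticomm i j (by rintro rfl; exact hij rfl)]

/-- The products of the matrices `withOne A i * H`. -/
theorem IsSkewFamily.withOne_mul_hadamard_mul_transpose (hA : IsSkewFamily H A)
    (i j : Option ι) : (withOne A i * H) * (withOne A j * H)ᵀ =
      (Fintype.card α : ℤ) • (withOne A i * (withOne A j)ᵀ) := by
  rw [transpose_mul, Matrix.mul_assoc, ← Matrix.mul_assoc H, hA.hadamard, Matrix.smul_mul,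
    Matrix.one_mul, Matrix.mul_smul]

end withOne

/-- An integral orthogonal design indexed by arbitrary finite types gives one indexed by `Fin`. -/
theorem isOD_of_int {β : Type*} [Fintype β] [DecidableEq β] {N k : ℕ} {u : Fin k → ℕ}
    (f : Fin N ≃ β) (B : Fin k → Matrix β β ℤ)
    (entries : ∀ i a b, B i a b = 0 ∨ B i a b = 1 ∨ B i a b = -1)
    (disjoint : ∀ i j, i ≠ j → ∀ a b, B i a b * B j a b = 0)
    (weight : ∀ i, B i * (B i)ᵀ = (u i : ℤ) • 1)
    (anti : ∀ i j, i ≠ j → B i * (B j)ᵀ + B j * (B i)ᵀ = 0) :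
    IsOD u fun i => ((B i).submatrix f f).map (Int.castRingHom ℝ) := by
  have mul_tr : ∀ i j, ((B i).submatrix f f).map (Int.castRingHom ℝ) *
      (((B j).submatrix f f).map (Int.castRingHom ℝ))ᵀ =
        ((B i * (B j)ᵀ).submatrix f f).map (Int.castRingHom ℝ) := by
    intro i j
    rw [← transpose_map, transpose_submatrix, ← Matrix.map_mul, submatrix_mul_equiv]
  refine ⟨fun i a b => ?_, fun i j hij a b => ?_, fun i => ?_, fun i j hij => ?_⟩
  · rcases entries i (f a) (f b) with h | h | h <;> simp [h]
  · simpa using disjoint i j hij (f a) (f b)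
  · rw [mul_tr, weight]
    ext a b
    by_cases hab : a = b <;>
      simp only [map_apply, submatrix_apply, Matrix.smul_apply, one_apply, hab,
        f.injective.eq_iff] <;> simp
  · rw [mul_tr, mul_tr]
    ext a b
    simpa only [Matrix.add_apply, Matrix.zero_apply, map_apply, submatrix_apply,
      map_add, map_zero] using
      congrArg (Int.castRingHom ℝ) (congrFun (congrFun (anti i j hij) (f a)) (f b))

/-- For every `n > 2`, with `q = 2^(n-1) + n - 1`, there is an
`OD(2^q; u, …, u)` with `2^n` variables, where `u = 2^(2^(n-1) - 1) = 2^(q-n)`. -/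
theorem exists_OD_two_pow (n : ℕ) (hn : 2 < n) (q : ℕ) (hq : q = 2 ^ (n - 1) + n - 1) :
    ∃ A : Fin (2 ^ n) → Matrix (Fin (2 ^ q)) (Fin (2 ^ q)) ℝ,
      IsOD (fun _ => 2 ^ (2 ^ (n - 1) - 1)) A := by
  obtain ⟨m, rfl⟩ : ∃ m, n = m + 3 := ⟨n - 3, by omega⟩
  obtain ⟨ι, α, _, _, _, H, A, hι, hα, hA⟩ := exists_isSkewFamily m
  rw [show m + 3 - 1 = m + 2 from rfl] at hq ⊢
  rw [← hα]
  let e : Fin (2 ^ (m + 3)) ≃ Option ι := Fintype.equivOfCardEq (by simp [hι])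
  let g : Fin (2 ^ (m + 3)) ≃ (Fin (m + 3) → ZMod 2) := Fintype.equivOfCardEq (by simp)
  let f : Fin (2 ^ q) ≃ (Fin (m + 3) → ZMod 2) × α := Fintype.equivOfCardEq <| by
    have : 1 ≤ 2 ^ (m + 2) := Nat.one_le_two_pow
    simp only [Fintype.card_fin, Fintype.card_prod, Fintype.card_pi, ZMod.card,
      Finset.prod_const, Finset.card_univ, hα, ← pow_add]
    congr 1
    omega
  let B : Fin (2 ^ (m + 3)) → Matrix _ _ ℤ :=
    fun i => translationMatrix (g i) ⊗ₖ (withOne A (e i) * H)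
  have mul_tr : ∀ i j, B i * (B j)ᵀ = (translationMatrix (g i) * (translationMatrix (g j))ᵀ) ⊗ₖ
      ((Fintype.card α : ℤ) • (withOne A (e i) * (withOne A (e j))ᵀ)) := by
    intro i j
    rw [← hA.withOne_mul_hadamard_mul_transpose, mul_kronecker_mul, kroneckerMap_transpose]
  refine ⟨_, isOD_of_int f B ?_ ?_ ?_ ?_⟩
  · rintro i ⟨a, c⟩ ⟨b, d⟩
    simp only [B, kroneckerMap_apply, translationMatrix, of_apply]
    split_ifs
    · exact Or.inr (by simpa using hA.isSignMatrix_withOne_mul (e i) c d)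
    · simp
  · rintro i j hij ⟨a, c⟩ ⟨b, d⟩
    simp only [B, kroneckerMap_apply, translationMatrix, of_apply]
    by_cases hi : b = a + g i
    · have hj : b ≠ a + g j := fun hj => hij (g.injective (add_left_cancel (hi.symm.trans hj)))
      simp [hj]
    · simp [hi]
  · intro i
    rw [mul_tr, translationMatrix_mul_transpose_self, hA.withOne_mul_transpose_self,
      kronecker_smul, one_kronecker_one]
  · intro i j hij
    rw [mul_tr, mul_tr, translationMatrix_mul_transpose_comm (g j), ← kronecker_add, ← smul_add,
      hA.withOne_mul_transpose_add (e.injective.ne hij), smul_zero, kronecker_zero]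
end

section
/- Let n > 2 be an integer and set t = 2^(n−3) − 1 (interpreting t = 0 when n = 3). Suppose r is a Golay number and k_1, …, k_t are complex Golay numbers. Let m = 2(k_1 + ⋯ + k_t) + r + 1 and q = 2^(n−1) + n − 1. Then there exists a complex orthogonal design COD(2^q · m; 2^q, 2^q · r, 2^(q+1) · k_1, …, 2^(q+1) · k_t). -/
/-- A Golay pair of length `r`: two `±1`-sequences whose non-periodic
autocorrelations sum to zero for every shift `j` with `1 ≤ j ≤ r - 1`. -/
def IsGolayPair {r : ℕ} (A B : Fin r → ℝ) : Prop :=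
  (∀ i : Fin r, A i = 1 ∨ A i = -1) ∧
  (∀ i : Fin r, B i = 1 ∨ B i = -1) ∧
  ∀ j : ℕ, 0 < j → j < r →
    (∑ i : Fin r, if h : (i : ℕ) + j < r then
        A ⟨(i : ℕ) + j, h⟩ * A i + B ⟨(i : ℕ) + j, h⟩ * B i else 0) = 0

/-- A Golay number: a positive integer `r` for which a Golay pair of length `r`
exists. -/
def IsGolayNumber (r : ℕ) : Prop :=
  0 < r ∧ ∃ A B : Fin r → ℝ, IsGolayPair A B

/-- A complex Golay pair of length `k`: two `{1, -1, i, -i}`-sequences whose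
non-periodic autocorrelations sum to zero for every shift `j` with
`1 ≤ j ≤ k - 1`. -/
def IsComplexGolayPair {k : ℕ} (C D : Fin k → ℂ) : Prop :=
  (∀ i : Fin k, C i = 1 ∨ C i = -1 ∨ C i = Complex.I ∨ C i = -Complex.I) ∧
  (∀ i : Fin k, D i = 1 ∨ D i = -1 ∨ D i = Complex.I ∨ D i = -Complex.I) ∧
  ∀ j : ℕ, 0 < j → j < k →
    (∑ i : Fin k, if h : (i : ℕ) + j < k then
        C ⟨(i : ℕ) + j, h⟩ * (starRingEnd ℂ) (C i) +
          D ⟨(i : ℕ) + j, h⟩ * (starRingEnd ℂ) (D i) else 0) = 0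

/-- A complex Golay number: a positive integer `k` for which a complex Golay
pair of length `k` exists. -/
def IsComplexGolayNumber (k : ℕ) : Prop :=
  0 < k ∧ ∃ C D : Fin k → ℂ, IsComplexGolayPair C D

open Matrix
/-- A complex orthogonal design `COD(n; u 0, …, u (k-1))`, encoded by its
coefficient matrices `C i` (of the variable `x i`). -/
def IsCOD {n k : ℕ} (u : Fin k → ℕ) (C : Fin k → Matrix (Fin n) (Fin n) ℂ) : Prop :=
  (∀ (i : Fin k) (a b : Fin n),
    C i a b = 0 ∨ C i a b = 1 ∨ C i a b = -1 ∨ C i a b = Complex.I ∨ C i a b = -Complex.I) ∧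
  (∀ i j : Fin k, i ≠ j → ∀ a b : Fin n, C i a b * C j a b = 0) ∧
  (∀ i : Fin k, C i * (C i)ᴴ = (u i : ℂ) • 1) ∧
  (∀ i j : Fin k, i ≠ j → C i * (C j)ᴴ + C j * (C i)ᴴ = 0)


/-! ### Walsh functions and sign strings on `J → Bool` -/

section Clifford

variable {J : Type*}

section FlipAt

variable [LinearOrder J]

/-- Negate the bit at `μ`. -/
def flipAt (μ : J) (b : J → Bool) : J → Bool := Function.update b μ (!b μ)

@[simp] lemma flipAt_self (μ : J) (b : J → Bool) : flipAt μ b μ = !b μ := by simp [flipAt]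

lemma flipAt_of_ne {μ ν : J} (h : ν ≠ μ) (b : J → Bool) : flipAt μ b ν = b ν := by
  simp [flipAt, h]

@[simp] lemma flipAt_flipAt (μ : J) (b : J → Bool) : flipAt μ (flipAt μ b) = b := by
  simp [flipAt]

lemma flipAt_comm (μ ν : J) (b : J → Bool) :
    flipAt μ (flipAt ν b) = flipAt ν (flipAt μ b) := by
  rcases eq_or_ne μ ν with rfl | h
  · rfl
  · simp [flipAt, h, h.symm, Function.update_comm h]

lemma flipAt_eq_iff (μ : J) (b d : J → Bool) : flipAt μ b = d ↔ b = flipAt μ d :=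
  ⟨fun h => by simp [← h], fun h => by simp [h]⟩

end FlipAt

variable [Fintype J]

/-- The Sylvester–Hadamard matrix on `J → Bool`. -/
def walsh (b c : J → Bool) : ℂ := ∏ ν, if b ν && c ν then -1 else 1

lemma star_walsh (b c : J → Bool) : star (walsh b c) = walsh b c := by
  simp [walsh, apply_ite]

lemma walsh_pow_four (b c : J → Bool) : walsh b c ^ 4 = 1 := by
  rw [walsh, ← Finset.prod_pow]
  refine Finset.prod_eq_one fun ν _ => ?_
  split_ifs <;> norm_num

lemma sum_walsh_mul_star_walsh [DecidableEq J] (b d : J → Bool) :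
    ∑ c, walsh b c * star (walsh d c) = if b = d then 2 ^ Fintype.card J else 0 := by
  have h : ∀ ν : J, ∑ β : Bool, ((if b ν && β then -1 else 1) * (if d ν && β then -1 else 1) : ℂ)
      = if b ν = d ν then 2 else 0 := by
    intro ν
    cases b ν <;> cases d ν <;> norm_num
  simp only [star_walsh]
  simp only [walsh, ← Finset.prod_mul_distrib]
  rw [← Fintype.piFinset_univ, ← Finset.prod_univ_sum (fun _ => Finset.univ)
    (fun ν (β : Bool) => ((if b ν && β then -1 else 1) * (if d ν && β then -1 else 1) : ℂ))]
  simp only [h]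
  split_ifs with hbd
  · subst hbd
    simp
  · obtain ⟨ν, hν⟩ := Function.ne_iff.mp hbd
    exact Finset.prod_eq_zero (Finset.mem_univ ν) (by simp [hν])

variable [LinearOrder J]

/-- The Jordan–Wigner sign: the parity of the bits strictly before `μ`. -/
def stringSign (μ : J) (b : J → Bool) : ℂ := ∏ ν with ν < μ, if b ν then -1 else 1

lemma star_stringSign (μ : J) (b : J → Bool) : star (stringSign μ b) = stringSign μ b := by
  simp [stringSign, apply_ite]

lemma stringSign_mul_self (μ : J) (b : J → Bool) : stringSign μ b * stringSign μ b = 1 := by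
  rw [stringSign, ← Finset.prod_mul_distrib]
  refine Finset.prod_eq_one fun ν _ => ?_
  split_ifs <;> norm_num

lemma stringSign_flipAt_of_le {μ ν : J} (h : μ ≤ ν) (b : J → Bool) :
    stringSign μ (flipAt ν b) = stringSign μ b := by
  refine Finset.prod_congr rfl fun x hx => ?_
  rw [flipAt_of_ne ((Finset.mem_filter.mp hx).2.trans_le h).ne]

lemma stringSign_flipAt_of_lt {μ ν : J} (h : ν < μ) (b : J → Bool) :
    stringSign μ (flipAt ν b) = -stringSign μ b := by
  have hν : ν ∈ Finset.univ.filter (· < μ) := by simpa using h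
  rw [stringSign, stringSign, ← Finset.mul_prod_erase _ _ hν, ← Finset.mul_prod_erase _ _ hν,
    ← neg_mul]
  congr 1
  · cases hb : b ν <;> simp [hb]
  · refine Finset.prod_congr rfl fun x hx => ?_
    rw [flipAt_of_ne (Finset.ne_of_mem_erase hx)]

lemma stringSign_anticomm {μ ν : J} (h : μ ≠ ν) (b : J → Bool) :
    stringSign μ b * stringSign ν (flipAt ν (flipAt μ b)) +
      stringSign ν b * stringSign μ (flipAt ν (flipAt μ b)) = 0 := by
  rw [stringSign_flipAt_of_le le_rfl, flipAt_comm, stringSign_flipAt_of_le le_rfl]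
  rcases lt_or_gt_of_ne h with h | h
  · rw [stringSign_flipAt_of_lt h, stringSign_flipAt_of_le h.le]; ring
  · rw [stringSign_flipAt_of_lt h, stringSign_flipAt_of_le h.le]; ring

variable {ι : Type*}

/-- `F` or `Fᴴ`, according to a bit. -/
def starBit (F : Matrix ι ι ℂ) (β : Bool) : Matrix ι ι ℂ := if β then Fᴴ else F

lemma conjTranspose_starBit_not (F : Matrix ι ι ℂ) (β : Bool) :
    (starBit F (!β))ᴴ = starBit F β := by
  cases β <;> simp [starBit]

variable [Fintype ι]

/-- The operator which flips the bit `μ`, with Jordan–Wigner sign and coefficient `F` or `Fᴴ`,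
followed by the Walsh matrix. -/
def cliffordWalsh (F : Matrix ι ι ℂ) (μ : J) : Matrix (ι × (J → Bool)) (ι × (J → Bool)) ℂ :=
  Matrix.of fun p s => stringSign μ p.2 * starBit F (p.2 μ) p.1 s.1 * walsh (flipAt μ p.2) s.2

lemma cliffordWalsh_mul_conjTranspose_apply (F G : Matrix ι ι ℂ) (μ ν : J)
    (x z : ι) (b d : J → Bool) :
    (cliffordWalsh F μ * (cliffordWalsh G ν)ᴴ) (x, b) (z, d) =
      stringSign μ b * stringSign ν d * (starBit F (b μ) * (starBit G (d ν))ᴴ) x z *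
        (if flipAt μ b = flipAt ν d then 2 ^ Fintype.card J else 0) := by
  rw [← sum_walsh_mul_star_walsh, Matrix.mul_apply, Matrix.mul_apply, Fintype.sum_prod_type,
    mul_assoc, Finset.sum_mul_sum, Finset.mul_sum]
  refine Finset.sum_congr rfl fun y _ => ?_
  rw [Finset.mul_sum]
  refine Finset.sum_congr rfl fun c _ => ?_
  simp only [Matrix.of_apply, Matrix.conjTranspose_apply, cliffordWalsh, star_mul', star_stringSign, star_walsh]
  ring

lemma cliffordWalsh_antiamicable {F G : Matrix ι ι ℂ} {μ ν : J} (h : μ ≠ ν)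
    (hFG : Commute F G) (hFG' : Commute F Gᴴ) :
    cliffordWalsh F μ * (cliffordWalsh G ν)ᴴ + cliffordWalsh G ν * (cliffordWalsh F μ)ᴴ = 0 := by
  ext ⟨x, b⟩ ⟨z, d⟩
  rw [Matrix.add_apply, cliffordWalsh_mul_conjTranspose_apply,
    cliffordWalsh_mul_conjTranspose_apply, Matrix.zero_apply]
  have hiff : flipAt ν b = flipAt μ d ↔ flipAt μ b = flipAt ν d := by
    rw [flipAt_eq_iff, flipAt_eq_iff, flipAt_comm]
  simp only [hiff]
  split_ifs with hbd
  · obtain rfl : d = flipAt ν (flipAt μ b) := by simp [hbd]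
    have e1 : flipAt ν (flipAt μ b) ν = !b ν := by rw [flipAt_self, flipAt_of_ne h.symm]
    have e2 : flipAt ν (flipAt μ b) μ = !b μ := by rw [flipAt_of_ne h, flipAt_self]
    have hc : starBit F (b μ) * starBit G (b ν) = starBit G (b ν) * starBit F (b μ) := by
      have h1 := congrArg Matrix.conjTranspose hFG.eq
      have h2 := congrArg Matrix.conjTranspose hFG'.eq
      simp only [Matrix.conjTranspose_mul, Matrix.conjTranspose_conjTranspose] at h1 h2
      cases b μ <;> cases b ν <;> simp [starBit, hFG.eq, hFG'.eq, h1, h2]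
    rw [e1, e2, conjTranspose_starBit_not, conjTranspose_starBit_not, hc, ← add_mul, ← add_mul,
      stringSign_anticomm h]
    simp
  · simp

lemma cliffordWalsh_mul_conjTranspose_self {F : Matrix ι ι ℂ} (hF : Commute F Fᴴ) (μ : J)
    (x z : ι) (b d : J → Bool) :
    (cliffordWalsh F μ * (cliffordWalsh F μ)ᴴ) (x, b) (z, d) =
      if b = d then 2 ^ Fintype.card J * (F * Fᴴ) x z else 0 := by
  rw [cliffordWalsh_mul_conjTranspose_apply]
  have hiff : flipAt μ b = flipAt μ d ↔ b = d := by rw [flipAt_eq_iff, flipAt_flipAt]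
  simp only [hiff]
  split_ifs with hbd
  · subst hbd
    have : starBit F (b μ) * (starBit F (b μ))ᴴ = F * Fᴴ := by
      cases b μ <;> simp [starBit, hF.eq]
    rw [this, stringSign_mul_self]
    ring
  · simp

end Clifford

/-! ### Assembling two families of blocks -/

section BitCirculant

variable {P : Type*} [Fintype P]

/-- The `2 × 2` block circulant matrix with blocks `K false` and `K true`. -/
def bitCirculant (K : Bool → Matrix P P ℂ) : Matrix (Bool × P) (Bool × P) ℂ :=
  Matrix.of fun p s => K (xor p.1 s.1) p.2 s.2

lemma bitCirculant_mul_conjTranspose_apply (K L : Bool → Matrix P P ℂ) (α β : Bool) (x z : P) :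
    (bitCirculant K * (bitCirculant L)ᴴ) (α, x) (β, z) =
      ∑ γ : Bool, (K (xor α γ) * (L (xor β γ))ᴴ) x z := by
  simp only [Matrix.mul_apply, Fintype.sum_prod_type, bitCirculant, Matrix.of_apply,
    Matrix.conjTranspose_apply]

lemma bitCirculant_antiamicable {K L : Bool → Matrix P P ℂ}
    (h : ∀ α β, K α * (L β)ᴴ + L β * (K α)ᴴ = 0) :
    bitCirculant K * (bitCirculant L)ᴴ + bitCirculant L * (bitCirculant K)ᴴ = 0 := by
  ext ⟨α, x⟩ ⟨β, z⟩
  have h' : ∀ α β, (K α * (L β)ᴴ) x z = -(L β * (K α)ᴴ) x z := fun α β =>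
    eq_neg_of_add_eq_zero_left (congrFun (congrFun (h α β) x) z)
  rw [Matrix.add_apply, bitCirculant_mul_conjTranspose_apply,
    bitCirculant_mul_conjTranspose_apply]
  cases α <;> cases β <;> simp [h'] <;> ring

lemma bitCirculant_mul_conjTranspose_self [DecidableEq P] {K : Bool → Matrix P P ℂ} {c : ℂ}
    (h : K false * (K true)ᴴ + K true * (K false)ᴴ = 0)
    (hc : K false * (K false)ᴴ + K true * (K true)ᴴ = c • 1) :
    bitCirculant K * (bitCirculant K)ᴴ = c • 1 := by
  ext ⟨α, x⟩ ⟨β, z⟩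
  have h' : (K false * (K true)ᴴ) x z = -(K true * (K false)ᴴ) x z :=
    eq_neg_of_add_eq_zero_left (congrFun (congrFun h x) z)
  have hc' : (K false * (K false)ᴴ) x z = (c • (1 : Matrix P P ℂ)) x z - (K true * (K true)ᴴ) x z :=
    eq_sub_of_add_eq (congrFun (congrFun hc x) z)
  rw [bitCirculant_mul_conjTranspose_apply]
  cases α <;> cases β <;> simp [h', hc', Matrix.one_apply]

end BitCirculant

lemma eq_of_pow_four_eq_one {z : ℂ} (h : z ^ 4 = 1) :
    z = 1 ∨ z = -1 ∨ z = Complex.I ∨ z = -Complex.I := by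
  have : (z - 1) * ((z + 1) * ((z - Complex.I) * (z + Complex.I))) = 0 := by
    linear_combination h + (1 - z ^ 2) * Complex.I_sq
  rcases mul_eq_zero.mp this with h | h
  · exact Or.inl (sub_eq_zero.mp h)
  rcases mul_eq_zero.mp h with h | h
  · exact Or.inr (Or.inl (eq_neg_of_add_eq_zero_left h))
  rcases mul_eq_zero.mp h with h | h
  · exact Or.inr (Or.inr (Or.inl (sub_eq_zero.mp h)))
  · exact Or.inr (Or.inr (Or.inr (eq_neg_of_add_eq_zero_left h)))

lemma pow_four_eq_one_of {z : ℂ} (h : z = 1 ∨ z = -1 ∨ z = Complex.I ∨ z = -Complex.I) :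
    z ^ 4 = 1 := by
  rcases h with rfl | rfl | rfl | rfl <;> simp [Even.neg_pow (by decide : Even 4)]

/-- Complex orthogonal designs on an arbitrary finite index type. -/
lemma exists_isCOD_of_equiv {P : Type*} [Fintype P] [DecidableEq P] {N s : ℕ}
    (hN : Fintype.card P = N) (u : Fin s → ℕ) (M : Fin s → Matrix P P ℂ)
    (hM : ∀ i a b, M i a b = 0 ∨ M i a b ^ 4 = 1)
    (hdisj : ∀ i j, i ≠ j → ∀ a b, M i a b * M j a b = 0)
    (hself : ∀ i, M i * (M i)ᴴ = (u i : ℂ) • 1)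
    (hanti : ∀ i j, i ≠ j → M i * (M j)ᴴ + M j * (M i)ᴴ = 0) :
    ∃ C : Fin s → Matrix (Fin N) (Fin N) ℂ, IsCOD u C := by
  let e : Fin N ≃ P := (Fintype.equivFinOfCardEq hN).symm
  refine ⟨fun i => (M i).submatrix e e, fun i a b => ?_, fun i j hij a b => hdisj i j hij _ _,
    fun i => ?_, fun i j hij => ?_⟩
  · exact (hM i (e a) (e b)).imp_right eq_of_pow_four_eq_one
  · rw [Matrix.conjTranspose_submatrix, Matrix.submatrix_mul_equiv, hself, Matrix.submatrix_smul]
    simp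
  · rw [Matrix.conjTranspose_submatrix, Matrix.conjTranspose_submatrix,
      Matrix.submatrix_mul_equiv, Matrix.submatrix_mul_equiv]
    ext a b
    exact congrFun (congrFun (hanti i j hij) (e a)) (e b)

/-- Commuting pairs of matrices with entries in `{0, 1, -1, i, -i}`, disjoint up to conjugate
transposition, and with `F Fᴴ + G Gᴴ` scalar, give a complex orthogonal design. -/
lemma exists_isCOD_of_commuting_pairs {ι : Type*} [Fintype ι] [DecidableEq ι] {N s : ℕ}
    (hN : 2 * s ≤ N) (w : Fin s → ℕ) (F : Fin s → Bool → Matrix ι ι ℂ)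
    (hF : ∀ i α a b, F i α a b = 0 ∨ F i α a b ^ 4 = 1)
    (supp : Fin s → Set (ι × ι)) (hsupp : Pairwise fun i j => Disjoint (supp i) (supp j))
    (hFsupp : ∀ i α a b, F i α a b ≠ 0 → (a, b) ∈ supp i ∧ (b, a) ∈ supp i)
    (hcomm : ∀ i α j β, Commute (F i α) (F j β))
    (hcomm' : ∀ i α j β, Commute (F i α) (F j β)ᴴ)
    (hw : ∀ i, F i false * (F i false)ᴴ + F i true * (F i true)ᴴ = ((2 * w i : ℕ) : ℂ) • 1) :
    ∃ C : Fin s → Matrix (Fin (2 ^ (N + 1) * Fintype.card ι)) (Fin (2 ^ (N + 1) * Fintype.card ι)) ℂ,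
      IsCOD (fun i => 2 ^ (N + 1) * w i) C := by
  obtain ⟨e⟩ : Nonempty (Fin s × Bool ↪ Fin N) :=
    Function.Embedding.nonempty_of_card_le (by simpa [mul_comm] using hN)
  have he : ∀ i α j β, (i, α) ≠ (j, β) → e (i, α) ≠ e (j, β) := fun _ _ _ _ h => e.injective.ne h
  have hbit : ∀ i α β a b, starBit (F i α) β a b = 0 ∨ starBit (F i α) β a b ^ 4 = 1 := by
    intro i α β a b
    cases β
    · exact hF i α a b
    · simp only [starBit, if_true, Matrix.conjTranspose_apply, ← star_pow]
      exact (hF i α b a).imp (fun h => by rw [h, star_zero]) (fun h => by rw [h, star_one])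
  have hbitsupp : ∀ i α β a b, starBit (F i α) β a b ≠ 0 → (a, b) ∈ supp i := by
    intro i α β a b h
    cases β
    · exact (hFsupp i α a b h).1
    · exact (hFsupp i α b a (by simpa [starBit] using h)).2
  have hanti : ∀ i α j β, (i, α) ≠ (j, β) →
      cliffordWalsh (F i α) (e (i, α)) * (cliffordWalsh (F j β) (e (j, β)))ᴴ +
        cliffordWalsh (F j β) (e (j, β)) * (cliffordWalsh (F i α) (e (i, α)))ᴴ = 0 :=
    fun i α j β h =>
      cliffordWalsh_antiamicable (he _ _ _ _ h) (hcomm i α j β) (hcomm' i α j β)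
  refine exists_isCOD_of_equiv (P := Bool × ι × (Fin N → Bool)) ?_ _
    (fun i => bitCirculant fun α => cliffordWalsh (F i α) (e (i, α))) ?_ ?_ ?_ ?_
  · simp [pow_succ]; ring
  · rintro i ⟨α, x, b⟩ ⟨β, y, c⟩
    simp only [bitCirculant, cliffordWalsh, Matrix.of_apply]
    have hs : ∀ μ : Fin N, stringSign μ b ^ 4 = 1 := fun μ => by
      linear_combination (stringSign μ b ^ 2 + 1) * stringSign_mul_self μ b
    rcases hbit i (xor α β) (b (e (i, xor α β))) x y with h | h
    · simp [h]
    · right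
      rw [mul_pow, mul_pow, hs, h, walsh_pow_four]
      norm_num
  · rintro i j hij ⟨α, x, b⟩ ⟨β, y, c⟩
    simp only [bitCirculant, cliffordWalsh, Matrix.of_apply]
    by_contra h
    have h1 : starBit (F i (xor α β)) (b (e (i, xor α β))) x y ≠ 0 := fun h0 => h (by simp [h0])
    have h2 : starBit (F j (xor α β)) (b (e (j, xor α β))) x y ≠ 0 := fun h0 => h (by simp [h0])
    exact Set.disjoint_left.mp (hsupp hij) (hbitsupp _ _ _ _ _ h1) (hbitsupp _ _ _ _ _ h2)
  · intro i
    refine bitCirculant_mul_conjTranspose_self (hanti i false i true (by simp)) ?_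
    ext ⟨x, b⟩ ⟨z, d⟩
    rw [Matrix.add_apply, cliffordWalsh_mul_conjTranspose_self (hcomm' _ _ _ _),
      cliffordWalsh_mul_conjTranspose_self (hcomm' _ _ _ _)]
    have hxz := congrFun (congrFun (hw i) x) z
    rw [Matrix.add_apply] at hxz
    split_ifs with hbd
    · rw [← mul_add, hxz]
      subst hbd
      simp [Matrix.one_apply, pow_succ, mul_assoc]
    · simp [hbd]
  · intro i j hij
    exact bitCirculant_antiamicable fun α β => hanti i α j β (by simp [hij])

/-! ### Golay sequences as circulant matrices -/

section Autocorrelation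

variable {k : ℕ} {C D : Fin k → ℂ}

lemma sum_fiber_pos (w : Fin k → Fin k → ℂ) {δ : ℕ} :
    ∑ p : Fin k × Fin k with ((p.1 : ℤ) - p.2 = δ), w p.1 p.2 =
      ∑ j : Fin k, if h : (j : ℕ) + δ < k then w ⟨j + δ, h⟩ j else 0 := by
  rw [Finset.sum_filter, Fintype.sum_prod_type_right]
  refine Finset.sum_congr rfl fun j _ => ?_
  split_ifs with h
  · rw [Finset.sum_eq_single ⟨j + δ, h⟩]
    · simp
    · intro i _ hi
      refine if_neg fun h' => hi (Fin.ext ?_)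
      dsimp only at h' ⊢
      omega
    · simp
  · refine Finset.sum_eq_zero fun i _ => if_neg ?_
    have := i.isLt
    dsimp only
    omega

lemma IsComplexGolayPair.sum_fiber_eq_zero (h : IsComplexGolayPair C D) {δ : ℤ} (hδ : δ ≠ 0) :
    ∑ p : Fin k × Fin k with ((p.1 : ℤ) - p.2 = δ),
      (C p.1 * star (C p.2) + D p.1 * star (D p.2)) = 0 := by
  have hpos : ∀ e : ℕ, 0 < e → ∑ p : Fin k × Fin k with ((p.1 : ℤ) - p.2 = e),
      (C p.1 * star (C p.2) + D p.1 * star (D p.2)) = 0 := by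
    intro e he
    rw [sum_fiber_pos (fun i j => C i * star (C j) + D i * star (D j))]
    by_cases hek : e < k
    · exact h.2.2 e he hek
    · exact Finset.sum_eq_zero fun j _ => dif_neg (by omega)
  obtain ⟨e, rfl | rfl⟩ := δ.eq_nat_or_neg
  · exact hpos e (by omega)
  · rw [← star_eq_zero, ← hpos e (by omega), star_sum]
    refine Finset.sum_nbij' Prod.swap Prod.swap ?_ ?_ (by simp) (by simp) ?_
    · intro p hp; simp at hp ⊢; omega
    · intro p hp; simp at hp ⊢; omega
    · intro p _; simp; ring

lemma IsComplexGolayPair.sum_mul (h : IsComplexGolayPair C D) (g : ℤ → ℂ) :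
    ∑ i, ∑ j, (C i * star (C j) + D i * star (D j)) * g ((i : ℤ) - j) = 2 * k * g 0 := by
  have hunit : ∀ z : ℂ, (z = 1 ∨ z = -1 ∨ z = Complex.I ∨ z = -Complex.I) → z * star z = 1 := by
    rintro z (rfl | rfl | rfl | rfl) <;> simp
  rw [← Fintype.sum_prod_type'
    (f := fun i j => (C i * star (C j) + D i * star (D j)) * g ((i : ℤ) - j)),
    ← Finset.sum_fiberwise_of_maps_to (t := Finset.Icc (-k : ℤ) k)
    (g := fun p : Fin k × Fin k => (p.1 : ℤ) - p.2) (by intro p _; simp; omega)]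
  have hfib : ∀ δ : ℤ, ∑ p : Fin k × Fin k with ((p.1 : ℤ) - p.2 = δ),
      (C p.1 * star (C p.2) + D p.1 * star (D p.2)) * g ((p.1 : ℤ) - p.2) =
      (∑ p : Fin k × Fin k with ((p.1 : ℤ) - p.2 = δ),
        (C p.1 * star (C p.2) + D p.1 * star (D p.2))) * g δ := by
    intro δ
    rw [Finset.sum_mul]
    refine Finset.sum_congr rfl fun p hp => ?_
    rw [(Finset.mem_filter.mp hp).2]
  rw [Finset.sum_eq_single 0]
  · rw [hfib]
    have := sum_fiber_pos (fun i j => C i * star (C j) + D i * star (D j)) (δ := 0)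
    rw [Nat.cast_zero] at this
    rw [this]
    simp only [add_zero, Fin.is_lt, dite_true, Fin.eta, fun i => hunit _ (h.1 i),
      fun i => hunit _ (h.2.1 i)]
    simp only [Finset.sum_const, Finset.card_univ, Fintype.card_fin, nsmul_eq_mul]
    ring
  · intro δ _ hδ
    rw [hfib, h.sum_fiber_eq_zero hδ, zero_mul]
  · simp

end Autocorrelation

lemma IsGolayPair.ofReal {r : ℕ} {A B : Fin r → ℝ} (h : IsGolayPair A B) :
    IsComplexGolayPair (fun i => (A i : ℂ)) (fun i => (B i : ℂ)) := by
  refine ⟨fun i => ?_, fun i => ?_, fun j hj hjr => ?_⟩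
  · rcases h.1 i with h | h <;> simp [h]
  · rcases h.2.1 i with h | h <;> simp [h]
  · have := congrArg (fun x : ℝ => (x : ℂ)) (h.2.2 j hj hjr)
    simpa [apply_dite] using this

section SeqCirculant

variable {A σ : Type*} [AddCommGroup A] [DecidableEq A] [Fintype σ]

/-- The circulant matrix with value `f s` at position `pos s`. -/
def seqCirculant (pos : σ → A) (f : σ → ℂ) : Matrix A A ℂ :=
  Matrix.circulant fun x => ∑ s, if x = pos s then f s else 0

lemma conjTranspose_seqCirculant (pos : σ → A) (f : σ → ℂ) :
    (seqCirculant pos f)ᴴ = seqCirculant (fun s => -pos s) (fun s => star (f s)) := by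
  ext x y
  simp only [seqCirculant, Matrix.conjTranspose_apply, Matrix.circulant_apply, star_sum,
    apply_ite star, star_zero]
  refine Finset.sum_congr rfl fun s _ => ?_
  have : y - x = pos s ↔ x - y = -pos s := by rw [← neg_sub y x, neg_inj]
  simp only [this]

lemma seqCirculant_sumElim {τ : Type*} [Fintype τ] (p : σ → A) (p' : τ → A)
    (f : σ → ℂ) (f' : τ → ℂ) :
    seqCirculant (Sum.elim p p') (Sum.elim f f') = seqCirculant p f + seqCirculant p' f' := by
  ext x y
  simp only [seqCirculant, Matrix.add_apply, Matrix.circulant_apply, Fintype.sum_sum_type,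
    Sum.elim_inl, Sum.elim_inr]
  rfl

lemma seqCirculant_neg (pos : σ → A) (f : σ → ℂ) :
    seqCirculant pos (fun s => -f s) = -seqCirculant pos f := by
  ext x y
  simp [seqCirculant, ← Finset.sum_neg_distrib, apply_ite]

lemma seqCirculant_apply_eq {pos : σ → A} (hpos : Function.Injective pos) (f : σ → ℂ) (x y : A) :
    seqCirculant pos f x y = 0 ∨ ∃ s, x - y = pos s ∧ seqCirculant pos f x y = f s := by
  by_cases h : ∃ s, x - y = pos s
  · obtain ⟨s, hs⟩ := h
    refine Or.inr ⟨s, hs, ?_⟩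
    rw [seqCirculant, Matrix.circulant_apply, Finset.sum_eq_single s _ (by simp), if_pos hs]
    exact fun u _ hu => if_neg fun h => hu (hpos (h.symm.trans hs))
  · push Not at h
    exact Or.inl (by simp [seqCirculant, h])

variable [Fintype A]

lemma commute_seqCirculant {τ : Type*} [Fintype τ] (p : σ → A) (p' : τ → A)
    (f : σ → ℂ) (f' : τ → ℂ) : Commute (seqCirculant p f) (seqCirculant p' f') :=
  Matrix.circulant_mul_comm _ _

lemma seqCirculant_mul_conjTranspose_apply (pos : σ → A) (f : σ → ℂ) (x y : A) :
    (seqCirculant pos f * (seqCirculant pos f)ᴴ) x y =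
      ∑ s, ∑ u, f s * star (f u) * if x - y = pos s - pos u then 1 else 0 := by
  simp only [Matrix.mul_apply, Matrix.conjTranspose_apply, seqCirculant, Matrix.circulant_apply,
    star_sum, Finset.sum_mul_sum]
  rw [Finset.sum_comm]
  refine Finset.sum_congr rfl fun s _ => ?_
  rw [Finset.sum_comm]
  refine Finset.sum_congr rfl fun u _ => ?_
  rw [Finset.sum_eq_single (x - pos s)]
  · have : y - (x - pos s) = pos u ↔ x - y = pos s - pos u := by
      constructor <;> intro h
      · rw [← h]; abel
      · rw [← sub_eq_zero] at h ⊢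
        rw [← neg_eq_zero, ← h]; abel
    by_cases h : x - y = pos s - pos u <;> simp [this, h]
  · intro z _ hz
    rw [if_neg, zero_mul]
    intro h
    exact hz (by rw [← h]; abel)
  · simp

lemma IsComplexGolayPair.seqCirculant_mul {k : ℕ} {C D : Fin k → ℂ} (h : IsComplexGolayPair C D)
    {pos : Fin k → A} (φ : ℤ →+ A) (hpos : ∀ i j : Fin k, pos i - pos j = φ ((i : ℤ) - j)) :
    seqCirculant pos C * (seqCirculant pos C)ᴴ + seqCirculant pos D * (seqCirculant pos D)ᴴ =
      ((2 * k : ℕ) : ℂ) • 1 := by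
  ext x y
  rw [Matrix.add_apply, seqCirculant_mul_conjTranspose_apply,
    seqCirculant_mul_conjTranspose_apply]
  have := h.sum_mul fun δ => if x - y = φ δ then 1 else 0
  simp only [add_mul, Finset.sum_add_distrib, ← hpos] at this
  rw [this]
  simp [Matrix.one_apply, sub_eq_zero]

end SeqCirculant

/-- A pair of circulant matrices with entries in `{0, 1, -1, i, -i}`, supported on differences
in `S`, for which `F Fᴴ + G Gᴴ = 2 w`. -/
def IsCirculantPair {A : Type*} [AddCommGroup A] [Fintype A] [DecidableEq A]
    (S : Set A) (w : ℕ) (F : Bool → Matrix A A ℂ) : Prop :=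
  (∀ α, ∃ v, F α = Matrix.circulant v) ∧
  (∀ α x y, F α x y = 0 ∨ (x - y ∈ S ∧ F α x y ^ 4 = 1)) ∧
  F false * (F false)ᴴ + F true * (F true)ᴴ = ((2 * w : ℕ) : ℂ) • 1

section CirculantPair

variable {A : Type*} [AddCommGroup A] [Fintype A] [DecidableEq A] {S : Set A}
  {k : ℕ} {C D : Fin k → ℂ} {pos : Fin k → A} (φ : ℤ →+ A)

lemma IsComplexGolayPair.exists_isCirculantPair (h : IsComplexGolayPair C D)
    (hpos : ∀ i j : Fin k, pos i - pos j = φ ((i : ℤ) - j)) (hinj : Function.Injective pos)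
    (hS : ∀ i, pos i ∈ S) : ∃ F, IsCirculantPair S k F := by
  refine ⟨fun α => if α then seqCirculant pos D else seqCirculant pos C, fun α => ?_,
    fun α x y => ?_, by simpa using h.seqCirculant_mul φ hpos⟩
  · cases α
    · exact ⟨_, by simp [seqCirculant]; rfl⟩
    · exact ⟨_, by simp [seqCirculant]; rfl⟩
  · cases α
    · rcases seqCirculant_apply_eq hinj C x y with h0 | ⟨s, hs, h1⟩
      · exact Or.inl h0
      · exact Or.inr ⟨hs ▸ hS s, by simpa [h1] using pow_four_eq_one_of (h.1 s)⟩
    · rcases seqCirculant_apply_eq hinj D x y with h0 | ⟨s, hs, h1⟩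
      · exact Or.inl h0
      · exact Or.inr ⟨hs ▸ hS s, by simpa [h1] using pow_four_eq_one_of (h.2.1 s)⟩

/-- The pair `C + Dᴴ`, `C - Dᴴ`, for `C` and `D` placed on positions disjoint from their
negatives. -/
lemma IsComplexGolayPair.exists_isCirculantPair_symm (h : IsComplexGolayPair C D)
    (hpos : ∀ i j : Fin k, pos i - pos j = φ ((i : ℤ) - j))
    (hinj : Function.Injective (Sum.elim pos fun i => -pos i))
    (hS : ∀ i, pos i ∈ S) (hS' : ∀ i, -pos i ∈ S) : ∃ F, IsCirculantPair S (2 * k) F := by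
  have hmem : ∀ s, Sum.elim pos (fun i => -pos i) s ∈ S := by rintro (i | i) <;> simp [hS, hS']
  have hD : ∀ i, star (D i) ^ 4 = 1 := fun i => by
    rw [← star_pow, pow_four_eq_one_of (h.2.1 i), star_one]
  refine ⟨fun α => seqCirculant (Sum.elim pos fun i => -pos i)
    (Sum.elim C fun i => if α then -star (D i) else star (D i)), fun α => ⟨_, rfl⟩,
    fun α x y => ?_, ?_⟩
  · rcases seqCirculant_apply_eq hinj _ x y with h0 | ⟨s, hs, h1⟩
    · exact Or.inl h0
    · refine Or.inr ⟨hs ▸ hmem s, ?_⟩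
      refine (congrArg (· ^ 4) h1).trans ?_
      rcases s with i | i
      · exact pow_four_eq_one_of (h.1 i)
      · cases α
        · exact hD i
        · exact (Even.neg_pow (by decide) _).trans (hD i)
  · have hcomm : (seqCirculant pos D)ᴴ * seqCirculant pos D =
        seqCirculant pos D * (seqCirculant pos D)ᴴ := by
      rw [conjTranspose_seqCirculant]
      exact commute_seqCirculant _ _ _ _
    have hCD := h.seqCirculant_mul φ hpos
    simp only [seqCirculant_sumElim, if_true, Bool.false_eq_true, if_false, seqCirculant_neg,
      ← conjTranspose_seqCirculant, Matrix.conjTranspose_add, Matrix.conjTranspose_neg,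
      Matrix.conjTranspose_conjTranspose]
    calc _ = (2 : ℂ) • (seqCirculant pos C * (seqCirculant pos C)ᴴ +
          (seqCirculant pos D)ᴴ * seqCirculant pos D) := by
          rw [two_smul]; noncomm_ring
      _ = _ := by
          rw [hcomm, hCD, smul_smul]
          push_cast
          rfl

/-- Circulant pairs with symmetric, pairwise disjoint supports give a complex orthogonal design. -/
lemma exists_isCOD_of_isCirculantPair {N s : ℕ} (hN : 2 * s ≤ N) (w : Fin s → ℕ) (T : Fin s → Set A)
    (hT : Pairwise fun i j => Disjoint (T i) (T j)) (hneg : ∀ i, ∀ x ∈ T i, -x ∈ T i)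
    (hF : ∀ i, ∃ F, IsCirculantPair (T i) (w i) F) :
    ∃ C : Fin s → Matrix (Fin (2 ^ (N + 1) * Fintype.card A)) (Fin (2 ^ (N + 1) * Fintype.card A)) ℂ,
      IsCOD (fun i => 2 ^ (N + 1) * w i) C := by
  choose F hcirc hent hw using hF
  refine exists_isCOD_of_commuting_pairs hN w F (fun i α a b => (hent i α a b).imp_right And.right)
    (fun i => {p | p.1 - p.2 ∈ T i}) ?_ ?_ ?_ ?_ hw
  · exact fun i j hij => Set.disjoint_left.mpr fun p hi hj =>
      Set.disjoint_left.mp (hT hij) hi hj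
  · intro i α a b h
    have hab := ((hent i α a b).resolve_left h).1
    exact ⟨hab, by simpa using hneg i _ hab⟩
  · intro i α j β
    obtain ⟨v, hv⟩ := hcirc i α
    obtain ⟨v', hv'⟩ := hcirc j β
    rw [hv, hv']
    exact Matrix.circulant_mul_comm _ _
  · intro i α j β
    obtain ⟨v, hv⟩ := hcirc i α
    obtain ⟨v', hv'⟩ := hcirc j β
    rw [hv, hv', Matrix.conjTranspose_circulant]
    exact Matrix.circulant_mul_comm _ _

end CirculantPair

lemma ZMod.intCast_inj_of_abs_sub_lt {m : ℕ} {a b : ℤ} (h : |a - b| < m)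
    (hab : (a : ZMod m) = b) : a = b := by
  rw [ZMod.intCast_eq_intCast_iff_dvd_sub] at hab
  have := Int.eq_zero_of_abs_lt_dvd hab (by rwa [abs_sub_comm])
  omega

/-- The first of the `k j` consecutive integers reserved for the index `j`. -/
def blockOffset {t : ℕ} (k : Fin t → ℕ) (j : Fin t) : ℕ := 1 + ∑ i ∈ Finset.Iio j, k i

lemma blockOffset_add {t : ℕ} (k : Fin t → ℕ) (j : Fin t) :
    blockOffset k j + k j = 1 + ∑ i ∈ Finset.Iic j, k i := by
  rw [blockOffset, ← Finset.Iio_insert, Finset.sum_insert (by simp)]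
  ring

lemma blockOffset_add_le {t : ℕ} (k : Fin t → ℕ) (j : Fin t) :
    blockOffset k j + k j ≤ 1 + ∑ i, k i := by
  rw [blockOffset_add]
  gcongr
  exact Finset.subset_univ _

lemma blockOffset_add_le_of_lt {t : ℕ} (k : Fin t → ℕ) {j j' : Fin t} (h : j < j') :
    blockOffset k j + k j ≤ blockOffset k j' := by
  rw [blockOffset_add, blockOffset]
  gcongr
  exact fun i hi => Finset.mem_Iio.mpr ((Finset.mem_Iic.mp hi).trans_lt h)

/-- The partition of the integers in `[-∑ k, ∑ k + r]` into `{0}`, the middle interval of length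
`r`, and a symmetric pair of intervals of length `k j` for every `j`. -/
def blockSet {t : ℕ} (k : Fin t → ℕ) (r : ℕ) : Fin (t + 2) → Set ℤ :=
  Fin.cons {0} (Fin.cons (Set.Icc (∑ j, k j + 1 : ℕ) (∑ j, k j + r : ℕ))
    fun j => {p | (blockOffset k j : ℤ) ≤ |p| ∧ |p| < blockOffset k j + k j})

lemma blockSet_subset {t : ℕ} (k : Fin t → ℕ) (r : ℕ) (i : Fin (t + 2)) :
    blockSet k r i ⊆ Set.Icc (-(∑ j, k j : ℕ) : ℤ) (∑ j, k j + r : ℕ) := by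
  intro p hp
  rw [Set.mem_Icc]
  induction i using Fin.cases with
  | zero =>
    obtain rfl : p = 0 := hp
    constructor <;> omega
  | succ i =>
    induction i using Fin.cases with
    | zero =>
      have hp' : ((∑ j, k j + 1 : ℕ) : ℤ) ≤ p ∧ p ≤ (∑ j, k j + r : ℕ) := hp
      omega
    | succ j =>
      have hp' : (blockOffset k j : ℤ) ≤ |p| ∧ |p| < blockOffset k j + k j := hp
      have := blockOffset_add_le k j
      have := le_abs_self p
      have := neg_abs_le p
      omega

lemma pairwise_disjoint_blockSet {t : ℕ} (k : Fin t → ℕ) (r : ℕ) :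
    Pairwise fun i j => Disjoint (blockSet k r i) (blockSet k r j) := by
  have h0 : ∀ j : Fin t, 1 ≤ blockOffset k j := fun j => Nat.le_add_right _ _
  have hlt : ∀ i j, i < j → Disjoint (blockSet k r i) (blockSet k r j) := by
    intro i j hij
    refine Set.disjoint_left.mpr fun p hi hj => ?_
    induction j using Fin.cases with
    | zero => exact absurd hij (Fin.not_lt_zero i)
    | succ j =>
      induction i using Fin.cases with
      | zero =>
        obtain rfl : p = 0 := hi
        induction j using Fin.cases with
        | zero =>
          have hj' : ((∑ j, k j + 1 : ℕ) : ℤ) ≤ 0 ∧ (0 : ℤ) ≤ (∑ j, k j + r : ℕ) := hj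
          omega
        | succ j =>
          have hj' : (blockOffset k j : ℤ) ≤ |0| ∧ |(0 : ℤ)| < blockOffset k j + k j := hj
          rw [abs_zero] at hj'
          have := h0 j
          omega
      | succ i =>
        induction j using Fin.cases with
        | zero => exact absurd (Fin.succ_lt_succ_iff.mp hij) (Fin.not_lt_zero i)
        | succ j =>
          have hj' : (blockOffset k j : ℤ) ≤ |p| ∧ |p| < blockOffset k j + k j := hj
          induction i using Fin.cases with
          | zero =>
            have hi' : ((∑ j, k j + 1 : ℕ) : ℤ) ≤ p ∧ p ≤ (∑ j, k j + r : ℕ) := hi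
            have := blockOffset_add_le k j
            have := le_abs_self p
            omega
          | succ i =>
            have hi' : (blockOffset k i : ℤ) ≤ |p| ∧ |p| < blockOffset k i + k i := hi
            have := blockOffset_add_le_of_lt k
              (Fin.succ_lt_succ_iff.mp (Fin.succ_lt_succ_iff.mp hij))
            omega
  intro i j hij
  rcases lt_or_gt_of_ne hij with h | h
  · exact hlt i j h
  · exact (hlt j i h).symm

/-- The residues modulo `2 ∑ k + r + 1` of the parts of `blockSet k r`. -/
def blockResidues {t : ℕ} (k : Fin t → ℕ) (r : ℕ) (i : Fin (t + 2)) :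
    Set (ZMod (2 * (∑ j, k j) + r + 1)) :=
  (fun p : ℤ => (p : ZMod (2 * (∑ j, k j) + r + 1))) '' blockSet k r i

lemma pairwise_disjoint_blockResidues {t : ℕ} (k : Fin t → ℕ) (r : ℕ) :
    Pairwise fun i j => Disjoint (blockResidues k r i) (blockResidues k r j) := by
  intro i j hij
  refine Set.disjoint_left.mpr ?_
  rintro _ ⟨p, hp, rfl⟩ ⟨p', hp', h⟩
  have h1 := blockSet_subset k r i hp
  have h2 := blockSet_subset k r j hp'
  rw [Set.mem_Icc] at h1 h2
  have hpp : p' = p := ZMod.intCast_inj_of_abs_sub_lt (by rw [abs_lt]; constructor <;> omega) h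
  exact Set.disjoint_left.mp (pairwise_disjoint_blockSet k r hij) hp (hpp ▸ hp')

lemma neg_mem_blockResidues {t : ℕ} (k : Fin t → ℕ) (r : ℕ) (i : Fin (t + 2)) :
    ∀ x ∈ blockResidues k r i, -x ∈ blockResidues k r i := by
  rintro _ ⟨p, hp, rfl⟩
  induction i using Fin.cases with
  | zero =>
    obtain rfl : p = 0 := hp
    exact ⟨0, rfl, by simp⟩
  | succ i =>
    induction i using Fin.cases with
    | zero =>
      have hp' : ((∑ j, k j + 1 : ℕ) : ℤ) ≤ p ∧ p ≤ (∑ j, k j + r : ℕ) := hp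
      refine ⟨((2 * (∑ j, k j) + r + 1 : ℕ) : ℤ) - p, ?_, ?_⟩
      · change ((∑ j, k j + 1 : ℕ) : ℤ) ≤ _ ∧ _ ≤ ((∑ j, k j + r : ℕ) : ℤ)
        omega
      · dsimp only
        rw [Int.cast_sub, Int.cast_natCast, ZMod.natCast_self, zero_sub]
    | succ j =>
      refine ⟨-p, ?_, by simp⟩
      change (blockOffset k j : ℤ) ≤ |-p| ∧ |-p| < blockOffset k j + k j
      rw [abs_neg]
      exact hp

lemma exists_isCirculantPair_blockResidues {t : ℕ} {k : Fin t → ℕ} {r : ℕ}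
    (hr : IsGolayNumber r) (hk : ∀ j, IsComplexGolayNumber (k j)) (i : Fin (t + 2)) :
    ∃ F, IsCirculantPair (blockResidues k r i)
      ((Fin.cons 1 (Fin.cons r fun j => 2 * k j) : Fin (t + 2) → ℕ) i) F := by
  induction i using Fin.cases with
  | zero =>
    change ∃ F, IsCirculantPair _ 1 F
    have h : IsComplexGolayPair (fun _ : Fin 1 => (1 : ℂ)) (fun _ => 1) :=
      ⟨fun _ => Or.inl rfl, fun _ => Or.inl rfl, fun j _ _ => by omega⟩
    exact h.exists_isCirculantPair (pos := fun _ => 0) 0 (by simp)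
      (Function.injective_of_subsingleton _) fun _ => ⟨0, rfl, by simp⟩
  | succ i =>
    induction i using Fin.cases with
    | zero =>
      change ∃ F, IsCirculantPair _ r F
      obtain ⟨-, A, B, h⟩ := hr
      refine h.ofReal.exists_isCirculantPair
        (pos := fun i => ((((∑ j, k j) + 1 + i : ℕ) : ℤ) : ZMod (2 * (∑ j, k j) + r + 1)))
        (Int.castAddHom _) (fun i j => by simp) (fun i j hij => ?_) fun i => ⟨_, ?_, rfl⟩
      · have := ZMod.intCast_inj_of_abs_sub_lt (by rw [abs_lt]; constructor <;> omega) hij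
        exact Fin.ext (by omega)
      · change ((∑ j, k j + 1 : ℕ) : ℤ) ≤ _ ∧ _ ≤ ((∑ j, k j + r : ℕ) : ℤ)
        omega
    | succ j =>
      change ∃ F, IsCirculantPair _ (2 * k j) F
      obtain ⟨-, C, D, h⟩ := hk j
      have hle := blockOffset_add_le k j
      have h1 : 1 ≤ blockOffset k j := Nat.le_add_right _ _
      have hmem : ∀ i : Fin (k j),
          (((blockOffset k j + i : ℕ) : ℤ) : ZMod (2 * (∑ j, k j) + r + 1)) ∈
            blockResidues k r j.succ.succ := by
        refine fun i => ⟨_, ?_, rfl⟩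
        change (blockOffset k j : ℤ) ≤ |_| ∧ |_| < (blockOffset k j : ℤ) + k j
        rw [abs_of_nonneg (by omega)]
        omega
      refine h.exists_isCirculantPair_symm
        (pos := fun i => (((blockOffset k j + i : ℕ) : ℤ) : ZMod (2 * (∑ j, k j) + r + 1)))
        (Int.castAddHom _) (fun i j => by simp) ?_ hmem
        fun i => neg_mem_blockResidues _ _ _ _ (hmem i)
      rintro (a | a) (b | b) hab <;>
        simp only [Sum.elim_inl, Sum.elim_inr, ← Int.cast_neg] at hab <;>
        have := ZMod.intCast_inj_of_abs_sub_lt (by rw [abs_lt]; constructor <;> omega) hab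
      · exact congrArg _ (Fin.ext (by omega))
      · omega
      · omega
      · exact congrArg _ (Fin.ext (by omega))

/-- Theorem: for `n > 2`, `t = 2^(n-3) - 1`, a Golay number `r` and complex
Golay numbers `k 0, …, k (t-1)`, setting `m = 2·(k 0 + ⋯ + k (t-1)) + r + 1` and
`q = 2^(n-1) + n - 1`, there exists a
`COD(2^q · m; 2^q, 2^q·r, 2^(q+1)·k 0, …, 2^(q+1)·k (t-1))`. -/
theorem exists_COD_of_golay (n : ℕ) (hn : 2 < n) (t : ℕ) (ht : t = 2 ^ (n - 3) - 1)
    (r : ℕ) (hr : IsGolayNumber r) (k : Fin t → ℕ)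
    (hk : ∀ j : Fin t, IsComplexGolayNumber (k j))
    (m : ℕ) (hm : m = 2 * (∑ j : Fin t, k j) + r + 1)
    (q : ℕ) (hq : q = 2 ^ (n - 1) + n - 1) :
    ∃ C : Fin (t + 2) → Matrix (Fin (2 ^ q * m)) (Fin (2 ^ q * m)) ℂ,
      IsCOD (Fin.cons (2 ^ q) (Fin.cons (2 ^ q * r) (fun j : Fin t => 2 ^ (q + 1) * k j))) C := by
  subst hm
  obtain ⟨e, rfl⟩ : ∃ e, n = e + 3 := ⟨n - 3, by omega⟩
  have he : 2 ^ (e + 3 - 1) = 4 * 2 ^ e := by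
    rw [show e + 3 - 1 = e + 2 by omega]; ring
  have he' : 1 ≤ 2 ^ e := Nat.one_le_two_pow
  rw [Nat.add_sub_cancel] at ht
  obtain ⟨N, rfl⟩ : ∃ N, q = N + 1 := ⟨q - 1, by omega⟩
  have h := exists_isCOD_of_isCirculantPair (N := N) (by omega) _ _
    (pairwise_disjoint_blockResidues k r) (neg_mem_blockResidues k r)
    (exists_isCirculantPair_blockResidues hr hk)
  rw [ZMod.card] at h
  convert h using 3
  funext i
  induction i using Fin.cases with
  | zero => simp
  | succ i =>
    induction i using Fin.cases with
    | zero => simp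
    | succ j => simp only [Fin.cons_succ, pow_succ, mul_assoc]
end

section
/- If there exists a complex orthogonal design COD(n; u_1, …, u_k), then there exists an orthogonal design OD(2n; 2u_1, …, 2u_k). -/
open Matrix
open Matrix
/-- The real block matrix `[[Re M, -Im M], [Im M, Re M]]` representing a complex matrix `M`. -/
def realification {m : Type*} (M : Matrix m m ℂ) : Matrix (m ⊕ m) (m ⊕ m) ℝ :=
  fromBlocks (M.map Complex.re) (-M.map Complex.im) (M.map Complex.im) (M.map Complex.re)

/-- The realification of `M` multiplied on the right by the block matrix `[[1, 1], [1, -1]]`. -/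
def realDouble {m : Type*} (M : Matrix m m ℂ) : Matrix (m ⊕ m) (m ⊕ m) ℝ :=
  fromBlocks (M.map Complex.re - M.map Complex.im) (M.map Complex.re + M.map Complex.im)
    (M.map Complex.re + M.map Complex.im) (M.map Complex.im - M.map Complex.re)

lemma realification_add {m : Type*} (M N : Matrix m m ℂ) :
    realification (M + N) = realification M + realification N := by
  ext (a | a) (b | b) <;> simp [realification, add_comm]

lemma realification_zero {m : Type*} : realification (0 : Matrix m m ℂ) = 0 := by
  ext (a | a) (b | b) <;> simp [realification]

lemma realification_natCast_smul_one {m : Type*} [DecidableEq m] (c : ℕ) :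
    realification ((c : ℂ) • (1 : Matrix m m ℂ)) = (c : ℝ) • 1 := by
  ext (a | a) (b | b) <;> by_cases h : a = b <;> simp [realification, one_apply, h]

lemma realDouble_mul_transpose {m : Type*} [Fintype m] (M N : Matrix m m ℂ) :
    realDouble M * (realDouble N)ᵀ = (2 : ℝ) • realification (M * Nᴴ) := by
  ext (a | a) (b | b) <;>
    simp only [realDouble, realification, mul_apply, transpose_apply, Fintype.sum_sum_type,
      fromBlocks_apply₁₁, fromBlocks_apply₁₂, fromBlocks_apply₂₁, fromBlocks_apply₂₂,
      Matrix.smul_apply, map_apply, Matrix.neg_apply, Matrix.sub_apply, Matrix.add_apply,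
      conjTranspose_apply,
      Complex.re_sum, Complex.im_sum, smul_eq_mul, ← Finset.sum_add_distrib,
      ← Finset.sum_neg_distrib, Finset.mul_sum] <;>
    refine Finset.sum_congr rfl fun c _ => ?_ <;>
    simp only [Complex.mul_re, Complex.mul_im, Complex.star_def, Complex.conj_re,
      Complex.conj_im] <;>
    ring

lemma realDouble_apply_eq {m : Type*} {M : Matrix m m ℂ}
    (h : ∀ a b, M a b = 0 ∨ M a b = 1 ∨ M a b = -1 ∨ M a b = Complex.I ∨ M a b = -Complex.I)
    (a b : m ⊕ m) : realDouble M a b = 0 ∨ realDouble M a b = 1 ∨ realDouble M a b = -1 := by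
  rcases a with a | a <;> rcases b with b | b <;>
    rcases h a b with h | h | h | h | h <;> simp [realDouble, h]

lemma realDouble_apply_mul_apply {m : Type*} {M N : Matrix m m ℂ}
    (h : ∀ a b, M a b * N a b = 0) (a b : m ⊕ m) : realDouble M a b * realDouble N a b = 0 := by
  rcases a with a | a <;> rcases b with b | b <;>
    rcases mul_eq_zero.mp (h a b) with h | h <;> simp [realDouble, h]

/-- If there exists a `COD(n; u_1, …, u_k)`, then there exists an
`OD(2n; 2u_1, …, 2u_k)`. -/
theorem exists_OD_of_COD {n k : ℕ} (u : Fin k → ℕ)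
    (h : ∃ C : Fin k → Matrix (Fin n) (Fin n) ℂ, IsCOD u C) :
    ∃ A : Fin k → Matrix (Fin (2 * n)) (Fin (2 * n)) ℝ, IsOD (fun i => 2 * u i) A := by
  obtain ⟨C, hentry, hdisj, hself, hanti⟩ := h
  let e : Fin n ⊕ Fin n ≃ Fin (2 * n) := finSumFinEquiv.trans (finCongr (two_mul n).symm)
  have hmul (i j : Fin k) : (realDouble (C i)).submatrix e.symm e.symm *
      ((realDouble (C j)).submatrix e.symm e.symm)ᵀ =
        ((2 : ℝ) • realification (C i * (C j)ᴴ)).submatrix e.symm e.symm := by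
    rw [transpose_submatrix, submatrix_mul_equiv, realDouble_mul_transpose]
  refine ⟨fun i => (realDouble (C i)).submatrix e.symm e.symm,
    fun i a b => realDouble_apply_eq (hentry i) _ _,
    fun i j hij a b => realDouble_apply_mul_apply (hdisj i j hij) _ _, fun i => ?_,
    fun i j hij => ?_⟩
  · rw [hmul, hself, realification_natCast_smul_one, smul_smul, submatrix_smul,
      Pi.smul_apply, Pi.smul_apply, submatrix_one_equiv]
    push_cast
    rfl
  · rw [hmul, hmul, ← Pi.add_apply, ← Pi.add_apply, ← submatrix_add, ← smul_add,
      ← realification_add, hanti i j hij, realification_zero, smul_zero]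
    rfl
end

section
/- Let ℍ be the real quaternions with imaginary units j and k. For all real numbers x1, x2, x3, the 4×4 quaternion matrix X with rows ((j*k)·x1, j·x2, k·x3, x3), (j·x2, (j*k)·x1, x3, k·x3), (k·x3, x3, (j*k)·x1, j·x2), (x3, k·x3, j·x2, (j*k)·x1) satisfies X * Xᴴ = ((x1² + x2² + 2·x3²) : ℍ) • 1, where Xᴴ is the conjugate transpose formed using quaternion conjugation; that is, X is a signed group orthogonal design SOD(4; 1, 1, 2) over the quaternion signed group. -/
open Matrix Quaternion

/-- The quaternion imaginary unit `j`. -/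
def quatJ : Quaternion ℝ := ⟨0, 0, 1, 0⟩

/-- The quaternion imaginary unit `k`. -/
def quatK : Quaternion ℝ := ⟨0, 0, 0, 1⟩

@[simp] theorem quatJ_re : quatJ.re = 0 := rfl

@[simp] theorem quatJ_imI : quatJ.imI = 0 := rfl

@[simp] theorem quatJ_imJ : quatJ.imJ = 1 := rfl

@[simp] theorem quatJ_imK : quatJ.imK = 0 := rfl

@[simp] theorem quatK_re : quatK.re = 0 := rfl

@[simp] theorem quatK_imI : quatK.imI = 0 := rfl

@[simp] theorem quatK_imJ : quatK.imJ = 0 := rfl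

@[simp] theorem quatK_imK : quatK.imK = 1 := rfl

set_option maxHeartbeats 1000000 in
/-- The `4 × 4` quaternion matrix with rows
`(jk·x₁, j·x₂, k·x₃, x₃)`, `(j·x₂, jk·x₁, x₃, k·x₃)`,
`(k·x₃, x₃, jk·x₁, j·x₂)`, `(x₃, k·x₃, j·x₂, jk·x₁)` satisfies
`X * Xᴴ = (x₁² + x₂² + 2·x₃²) • 1`; that is, it is an `SOD(4; 1, 1, 2)` over
the quaternion signed group. -/
theorem quaternion_SOD_4_1_1_2 (x1 x2 x3 : ℝ)
    (X : Matrix (Fin 4) (Fin 4) (Quaternion ℝ))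
    (hX : X =
      !![(quatJ * quatK) * (x1 : Quaternion ℝ), quatJ * (x2 : Quaternion ℝ),
          quatK * (x3 : Quaternion ℝ), (x3 : Quaternion ℝ);
        quatJ * (x2 : Quaternion ℝ), (quatJ * quatK) * (x1 : Quaternion ℝ),
          (x3 : Quaternion ℝ), quatK * (x3 : Quaternion ℝ);
        quatK * (x3 : Quaternion ℝ), (x3 : Quaternion ℝ),
          (quatJ * quatK) * (x1 : Quaternion ℝ), quatJ * (x2 : Quaternion ℝ);
        (x3 : Quaternion ℝ), quatK * (x3 : Quaternion ℝ),
          quatJ * (x2 : Quaternion ℝ), (quatJ * quatK) * (x1 : Quaternion ℝ)]) :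
    X * Xᴴ = ((x1 ^ 2 + x2 ^ 2 + 2 * x3 ^ 2 : ℝ) : Quaternion ℝ) • 1 := by
  subst hX
  ext a b : 1
  rw [Matrix.mul_apply, Fin.sum_univ_four, Matrix.smul_apply]
  simp only [Matrix.conjTranspose_apply]
  fin_cases a <;> fin_cases b <;> ext <;>
    simp [-Quaternion.coe_add, -Quaternion.coe_mul, -Quaternion.coe_pow] <;> ring
end

section
/- There exists a complex orthogonal design COD(2^11 · 31; 2^11, 2^11 · 8, 2^11 · 22), i.e., a COD of order 63488 and type (2048, 16384, 45056). -/
open Matrix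
namespace CODConstruction

open Kronecker GaussianInt

section IteratedKronecker

variable {k : ℕ}

/-- The Kronecker product of `k` matrices of order two. -/
def piKronecker (B : Fin k → Matrix (Fin 2) (Fin 2) ℂ) :
    Matrix (Fin k → Fin 2) (Fin k → Fin 2) ℂ :=
  of fun x y => ∏ i, B i (x i) (y i)

theorem piKronecker_mul (B D : Fin k → Matrix (Fin 2) (Fin 2) ℂ) :
    piKronecker B * piKronecker D = piKronecker fun i => B i * D i := by
  ext x y
  simp only [piKronecker, mul_apply, of_apply, ← Finset.prod_mul_distrib]
  rw [Finset.prod_univ_sum, Fintype.piFinset_univ]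

theorem piKronecker_conjTranspose (B : Fin k → Matrix (Fin 2) (Fin 2) ℂ) :
    (piKronecker B)ᴴ = piKronecker fun i => (B i)ᴴ := by
  ext x y
  simp [piKronecker, conjTranspose_apply]

theorem piKronecker_smul_one (c : ℂ) :
    piKronecker (fun _ : Fin k => c • (1 : Matrix (Fin 2) (Fin 2) ℂ)) = c ^ k • 1 := by
  ext x y
  by_cases h : x = y
  · subst h
    simp [piKronecker]
  · obtain ⟨i, hi⟩ := Function.ne_iff.mp h
    simp only [piKronecker, of_apply, Matrix.smul_apply, one_apply_ne h, smul_zero]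
    exact Finset.prod_eq_zero (Finset.mem_univ i) (by simp [one_apply_ne hi])

theorem piKronecker_one :
    piKronecker (fun _ : Fin k => (1 : Matrix (Fin 2) (Fin 2) ℂ)) = 1 := by
  simpa using piKronecker_smul_one (k := k) 1

theorem piKronecker_eq_zero {B : Fin k → Matrix (Fin 2) (Fin 2) ℂ} (m : Fin k) (h : B m = 0) :
    piKronecker B = 0 := by
  ext x y
  exact Finset.prod_eq_zero (Finset.mem_univ m) (by simp [h])

theorem piKronecker_eq_neg {B D : Fin k → Matrix (Fin 2) (Fin 2) ℂ} (m : Fin k)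
    (hm : B m = -D m) (h : ∀ i, i ≠ m → B i = D i) : piKronecker B = -piKronecker D := by
  ext x y
  simp only [piKronecker, of_apply, Matrix.neg_apply]
  rw [← Finset.mul_prod_erase _ _ (Finset.mem_univ m),
    ← Finset.mul_prod_erase _ (fun i => D i (x i) (y i)) (Finset.mem_univ m), hm, Matrix.neg_apply,
    neg_mul, Finset.prod_congr rfl fun i hi => by rw [h i (Finset.ne_of_mem_erase hi)]]

theorem piKronecker_add {B D E : Fin k → Matrix (Fin 2) (Fin 2) ℂ} (m : Fin k)
    (hm : B m + D m = E m) (h : ∀ i, i ≠ m → B i = E i) (h' : ∀ i, i ≠ m → D i = E i) :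
    piKronecker B + piKronecker D = piKronecker E := by
  ext x y
  simp only [piKronecker, of_apply, Matrix.add_apply]
  rw [← Finset.mul_prod_erase _ _ (Finset.mem_univ m),
    ← Finset.mul_prod_erase _ (fun i => D i (x i) (y i)) (Finset.mem_univ m),
    ← Finset.mul_prod_erase _ (fun i => E i (x i) (y i)) (Finset.mem_univ m), ← hm,
    Matrix.add_apply,
    Finset.prod_congr rfl fun i hi => by rw [h i (Finset.ne_of_mem_erase hi)],
    Finset.prod_congr (f := fun i => D i (x i) (y i)) rfl
      fun i hi => by rw [h' i (Finset.ne_of_mem_erase hi)], add_mul]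

theorem piKronecker_apply_pow_four {B : Fin k → Matrix (Fin 2) (Fin 2) ℂ}
    (h : ∀ i a b, B i a b ^ 4 = 1) (x y : Fin k → Fin 2) : piKronecker B x y ^ 4 = 1 := by
  simp [piKronecker, ← Finset.prod_pow, h]

end IteratedKronecker

section AnnihilationMatrices

/-- The Hadamard matrix of order two. -/
def hadamardTwo : Matrix (Fin 2) (Fin 2) ℂ := !![1, 1; 1, -1]

/-- The Pauli matrix `Y`. -/
def pauliY : Matrix (Fin 2) (Fin 2) ℂ := !![0, -Complex.I; Complex.I, 0]

/-- A square-zero matrix `s` with `s sᴴ + sᴴ s = 2` which anticommutes with `pauliY` and for which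
`s * hadamardTwo` has no zero entry. -/
noncomputable def lowering : Matrix (Fin 2) (Fin 2) ℂ :=
  !![(1 + Complex.I) / 2, (Complex.I - 1) / 2; (Complex.I - 1) / 2, -(1 + Complex.I) / 2]

theorem lowering_conjTranspose : loweringᴴ =
    !![(1 - Complex.I) / 2, (-Complex.I - 1) / 2; (-Complex.I - 1) / 2, -(1 - Complex.I) / 2] := by
  ext a b
  fin_cases a <;> fin_cases b <;>
    simp [lowering, conjTranspose_apply] <;> ring

theorem pauliY_conjTranspose : pauliYᴴ = pauliY := by
  ext a b
  fin_cases a <;> fin_cases b <;> simp [pauliY, conjTranspose_apply]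

theorem pauliY_mul_self : pauliY * pauliY = 1 := by
  ext a b
  fin_cases a <;> fin_cases b <;> simp [pauliY]

theorem lowering_mul_self : lowering * lowering = 0 := by
  ext a b
  fin_cases a <;> fin_cases b <;> simp [lowering] <;> ring_nf <;> simp [Complex.I_sq]

theorem lowering_anticommutator :
    lowering * loweringᴴ + loweringᴴ * lowering = (2 : ℂ) • 1 := by
  rw [lowering_conjTranspose]
  ext a b
  fin_cases a <;> fin_cases b <;> simp [lowering] <;> ring_nf <;> simp [Complex.I_sq] <;> ring

theorem lowering_mul_pauliY : lowering * pauliY = -(pauliY * lowering) := by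
  ext a b
  fin_cases a <;> fin_cases b <;> simp [lowering, pauliY] <;> ring

theorem lowering_conjTranspose_mul_pauliY : loweringᴴ * pauliY = -(pauliY * loweringᴴ) := by
  rw [lowering_conjTranspose]
  ext a b
  fin_cases a <;> fin_cases b <;> simp [pauliY] <;> ring

theorem hadamardTwo_mul_conjTranspose : hadamardTwo * hadamardTwoᴴ = (2 : ℂ) • 1 := by
  ext a b
  fin_cases a <;> fin_cases b <;> simp [hadamardTwo, mul_apply, conjTranspose_apply] <;> norm_num

theorem hadamardTwo_apply_pow_four (a b : Fin 2) : hadamardTwo a b ^ 4 = 1 := by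
  fin_cases a <;> fin_cases b <;> simp [hadamardTwo, Even.neg_pow (show Even 4 by decide)]

theorem pauliY_mul_hadamardTwo_apply_pow_four (a b : Fin 2) :
    (pauliY * hadamardTwo) a b ^ 4 = 1 := by
  fin_cases a <;> fin_cases b <;>
    simp [hadamardTwo, pauliY, mul_apply, Even.neg_pow (show Even 4 by decide), Complex.I_pow_four]

theorem lowering_mul_hadamardTwo :
    lowering * hadamardTwo = !![Complex.I, 1; -1, Complex.I] := by
  ext a b
  fin_cases a <;> fin_cases b <;> simp [lowering, hadamardTwo] <;> ring

theorem lowering_conjTranspose_mul_hadamardTwo :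
    loweringᴴ * hadamardTwo = !![-Complex.I, 1; -1, -Complex.I] := by
  rw [lowering_conjTranspose]
  ext a b
  fin_cases a <;> fin_cases b <;> simp [hadamardTwo] <;> ring

theorem lowering_mul_hadamardTwo_apply_pow_four (a b : Fin 2) :
    (lowering * hadamardTwo) a b ^ 4 = 1 := by
  rw [lowering_mul_hadamardTwo]
  fin_cases a <;> fin_cases b <;> simp [Even.neg_pow (show Even 4 by decide), Complex.I_pow_four]

theorem lowering_conjTranspose_mul_hadamardTwo_apply_pow_four (a b : Fin 2) :
    (loweringᴴ * hadamardTwo) a b ^ 4 = 1 := by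
  rw [lowering_conjTranspose_mul_hadamardTwo]
  fin_cases a <;> fin_cases b <;> simp [Even.neg_pow (show Even 4 by decide), Complex.I_pow_four]

variable {k : ℕ}

/-- The Jordan–Wigner string with `pauliY` before site `m`, `s` at site `m`, `1` after it. -/
def jordanWigner (s : Matrix (Fin 2) (Fin 2) ℂ) (m : Fin k) :
    Matrix (Fin k → Fin 2) (Fin k → Fin 2) ℂ :=
  piKronecker fun i => if i < m then pauliY else if i = m then s else 1

theorem jordanWigner_conjTranspose (s : Matrix (Fin 2) (Fin 2) ℂ) (m : Fin k) :
    (jordanWigner s m)ᴴ = jordanWigner sᴴ m := by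
  rw [jordanWigner, piKronecker_conjTranspose, jordanWigner]
  congr 1
  funext i
  split_ifs <;> simp [pauliY_conjTranspose]

theorem jordanWigner_anticomm_of_lt {s r : Matrix (Fin 2) (Fin 2) ℂ}
    (hs : s * pauliY = -(pauliY * s)) {m n : Fin k} (h : m < n) :
    jordanWigner s m * jordanWigner r n = -(jordanWigner r n * jordanWigner s m) := by
  rw [jordanWigner, jordanWigner, piKronecker_mul, piKronecker_mul]
  refine piKronecker_eq_neg m (by simp [h, hs]) fun i hi => ?_
  rcases lt_or_gt_of_ne hi with hlt | hgt
  · simp [hlt, hlt.trans h]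
  · simp [hgt.not_gt, hi]

theorem jordanWigner_anticomm {s r : Matrix (Fin 2) (Fin 2) ℂ}
    (hs : s * pauliY = -(pauliY * s)) (hr : r * pauliY = -(pauliY * r)) {m n : Fin k}
    (h : m ≠ n) :
    jordanWigner s m * jordanWigner r n = -(jordanWigner r n * jordanWigner s m) := by
  rcases lt_or_gt_of_ne h with hlt | hgt
  · exact jordanWigner_anticomm_of_lt hs hlt
  · rw [jordanWigner_anticomm_of_lt hr hgt, neg_neg]

theorem jordanWigner_lowering_mul_self (m : Fin k) :
    jordanWigner lowering m * jordanWigner lowering m = 0 := by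
  rw [jordanWigner, piKronecker_mul]
  exact piKronecker_eq_zero m (by simp [lowering_mul_self])

theorem jordanWigner_lowering_anticommutator (m : Fin k) :
    jordanWigner lowering m * (jordanWigner lowering m)ᴴ +
      (jordanWigner lowering m)ᴴ * jordanWigner lowering m = (2 : ℂ) • 1 := by
  have h : (2 : ℂ) • (1 : Matrix (Fin k → Fin 2) (Fin k → Fin 2) ℂ) =
      piKronecker fun i => if i = m then (2 : ℂ) • 1 else 1 := by
    rw [two_smul, ← piKronecker_one]
    refine piKronecker_add m ?_ ?_ ?_
    · simp [two_smul]
    all_goals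
      intro i hi
      simp [hi]
  rw [h, jordanWigner_conjTranspose, jordanWigner, jordanWigner, piKronecker_mul, piKronecker_mul]
  refine piKronecker_add m (by simp [lowering_anticommutator]) ?_ ?_
  all_goals
    intro i hi
    by_cases hlt : i < m <;> simp [hi, hlt, pauliY_mul_self]

/-- The Sylvester Hadamard matrix of order `2 ^ k`. -/
def sylvester (k : ℕ) : Matrix (Fin k → Fin 2) (Fin k → Fin 2) ℂ :=
  piKronecker fun _ => hadamardTwo

theorem sylvester_mul_conjTranspose : sylvester k * (sylvester k)ᴴ = (2 : ℂ) ^ k • 1 := by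
  rw [sylvester, piKronecker_conjTranspose, piKronecker_mul, hadamardTwo_mul_conjTranspose,
    piKronecker_smul_one]

theorem sylvester_apply_pow_four (x y : Fin k → Fin 2) : sylvester k x y ^ 4 = 1 :=
  piKronecker_apply_pow_four (fun _ => hadamardTwo_apply_pow_four) x y

theorem jordanWigner_mul_sylvester_apply_pow_four {s : Matrix (Fin 2) (Fin 2) ℂ}
    (hs : ∀ a b, (s * hadamardTwo) a b ^ 4 = 1) (m : Fin k) (x y : Fin k → Fin 2) :
    (jordanWigner s m * sylvester k) x y ^ 4 = 1 := by
  rw [jordanWigner, sylvester, piKronecker_mul]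
  refine piKronecker_apply_pow_four (fun i a b => ?_) x y
  split_ifs
  · exact pauliY_mul_hadamardTwo_apply_pow_four a b
  · exact hs a b
  · simpa using hadamardTwo_apply_pow_four a b

end AnnihilationMatrices

section SkewPart

variable {A : Type*} [Ring A]

theorem sub_anticomm {x x' y y' : A} (h₁ : x * y = -(y * x)) (h₂ : x * y' = -(y' * x))
    (h₃ : x' * y = -(y * x')) (h₄ : x' * y' = -(y' * x')) :
    (x - x') * (y - y') = -((y - y') * (x - x')) := by
  simp only [sub_mul, mul_sub, h₁, h₂, h₃, h₄]
  abel

theorem sub_mul_self_of_mul_self_eq_zero {x x' : A} (h : x * x = 0) (h' : x' * x' = 0) :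
    (x - x') * (x - x') = -(x * x' + x' * x) := by
  simp only [sub_mul, mul_sub, h, h']
  abel

end SkewPart

section Sequences

/-- Five sequences on `ℤ/31` with disjoint supports in `{1, …, 15}`: a Golay pair of length two,
a complex Golay pair of length five, and a sequence of length one. -/
def golaySeq : Fin 5 → ZMod 31 → GaussianInt := fun m p =>
  (![[0, 1, 1],
    [0, 0, 0, 1, -1],
    [0, 0, 0, 0, 0, 1, 1, 1, ⟨0, 1⟩, ⟨0, -1⟩],
    [0, 0, 0, 0, 0, 0, 0, 0, 0, 0, 1, ⟨0, 1⟩, ⟨0, -1⟩, -1, ⟨0, 1⟩],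
    [0, 0, 0, 0, 0, 0, 0, 0, 0, 0, 0, 0, 0, 0, 0, 1]] m).getD p.val 0

theorem golaySeq_eq_zero_or_pow_four (m : Fin 5) (p : ZMod 31) :
    golaySeq m p = 0 ∨ golaySeq m p ^ 4 = 1 := by
  revert m p
  decide +kernel

theorem golaySeq_zero (m : Fin 5) : golaySeq m 0 = 0 := by
  revert m
  decide +kernel

theorem golaySeq_mul_eq_zero {m n : Fin 5} (h : m ≠ n) (p : ZMod 31) :
    golaySeq m p * golaySeq n p = 0 := by
  revert m n p
  decide +kernel

theorem golaySeq_mul_neg_eq_zero (m n : Fin 5) (p : ZMod 31) :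
    golaySeq m p * golaySeq n (-p) = 0 := by
  revert m n p
  decide +kernel

/-- The periodic autocorrelation of `golaySeq m` at shift `d`. -/
def autocorr (m : Fin 5) (d : ZMod 31) : GaussianInt := ∑ p, golaySeq m (d + p) * star (golaySeq m p)

theorem autocorr_pair_two (d : ZMod 31) :
    autocorr 0 d + autocorr 1 d = if d = 0 then 4 else 0 := by
  revert d
  decide +kernel

theorem autocorr_pair_five (d : ZMod 31) :
    autocorr 2 d + autocorr 3 d + autocorr 4 d = if d = 0 then 11 else 0 := by
  revert d
  decide +kernel

/-- The circulant matrix of `golaySeq m`. -/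
noncomputable def golayCirculant (m : Fin 5) : Matrix (ZMod 31) (ZMod 31) ℂ :=
  circulant fun p => (golaySeq m p : ℂ)

theorem golayCirculant_mul_conjTranspose_apply (m : Fin 5) (i j : ZMod 31) :
    (golayCirculant m * (golayCirculant m)ᴴ) i j = (autocorr m (i - j) : ℂ) := by
  rw [autocorr, map_sum, mul_apply]
  refine Fintype.sum_equiv (Equiv.subLeft j) _ _ fun p => ?_
  simp [golayCirculant, conjTranspose_apply, toComplex_star]

theorem golayCirculant_pair_two :
    golayCirculant 0 * (golayCirculant 0)ᴴ + golayCirculant 1 * (golayCirculant 1)ᴴ =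
      (4 : ℂ) • 1 := by
  ext i j
  rw [Matrix.add_apply, golayCirculant_mul_conjTranspose_apply, golayCirculant_mul_conjTranspose_apply,
    ← map_add, autocorr_pair_two]
  by_cases h : i = j <;> simp [h, sub_eq_zero, map_ofNat toComplex 4]

theorem golayCirculant_pair_five :
    golayCirculant 2 * (golayCirculant 2)ᴴ + golayCirculant 3 * (golayCirculant 3)ᴴ +
      golayCirculant 4 * (golayCirculant 4)ᴴ = (11 : ℂ) • 1 := by
  ext i j
  rw [Matrix.add_apply, Matrix.add_apply, golayCirculant_mul_conjTranspose_apply,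
    golayCirculant_mul_conjTranspose_apply, golayCirculant_mul_conjTranspose_apply,
    ← map_add, ← map_add, autocorr_pair_five]
  by_cases h : i = j <;> simp [h, sub_eq_zero, map_ofNat toComplex 11]

theorem golayCirculant_comm (m n : Fin 5) :
    golayCirculant m * golayCirculant n = golayCirculant n * golayCirculant m :=
  circulant_mul_comm _ _

theorem golayCirculant_comm_conjTranspose (m n : Fin 5) :
    golayCirculant m * (golayCirculant n)ᴴ = (golayCirculant n)ᴴ * golayCirculant m := by
  simp only [golayCirculant, conjTranspose_circulant]
  exact circulant_mul_comm _ _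

end Sequences

section Modes

/-- The index type `ℤ/31 × {0, 1} ^ 11` of the rows and columns of the design. -/
abbrev Index : Type := ZMod 31 × (Fin 11 → Fin 2)

/-- The site of the Jordan–Wigner string used for the sequence `golaySeq m`. -/
def site : Fin 5 → Fin 11 := Fin.castLE (by norm_num)

theorem site_injective : Function.Injective site := Fin.castLE_injective _

/-- The annihilation matrix with circulant coefficient attached to `golaySeq m`. -/
noncomputable def annihilator (m : Fin 5) : Matrix Index Index ℂ :=
  golayCirculant m ⊗ₖ jordanWigner lowering (site m)

/-- The skew-Hermitian part of `annihilator m`. -/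
noncomputable def skewMode (m : Fin 5) : Matrix Index Index ℂ := annihilator m - (annihilator m)ᴴ

theorem skewMode_conjTranspose (m : Fin 5) : (skewMode m)ᴴ = -skewMode m := by
  simp [skewMode]

theorem annihilator_anticomm {m n : Fin 5} (h : m ≠ n) :
    annihilator m * annihilator n = -(annihilator n * annihilator m) := by
  rw [annihilator, annihilator, ← mul_kronecker_mul, ← mul_kronecker_mul, golayCirculant_comm n m,
    jordanWigner_anticomm lowering_mul_pauliY lowering_mul_pauliY
      (site_injective.ne h)]
  ext i j
  simp [kroneckerMap_apply]

theorem annihilator_anticomm_conjTranspose {m n : Fin 5} (h : m ≠ n) :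
    annihilator m * (annihilator n)ᴴ = -((annihilator n)ᴴ * annihilator m) := by
  rw [annihilator, annihilator, conjTranspose_kronecker, ← mul_kronecker_mul, ← mul_kronecker_mul,
    golayCirculant_comm_conjTranspose m n, jordanWigner_conjTranspose,
    jordanWigner_anticomm lowering_mul_pauliY lowering_conjTranspose_mul_pauliY
      (site_injective.ne h)]
  ext i j
  simp [kroneckerMap_apply]

theorem annihilator_mul_self (m : Fin 5) : annihilator m * annihilator m = 0 := by
  rw [annihilator, ← mul_kronecker_mul, jordanWigner_lowering_mul_self]
  exact kronecker_zero _

theorem skewMode_mul_self (m : Fin 5) :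
    skewMode m * skewMode m =
      -((2 : ℂ) • ((golayCirculant m * (golayCirculant m)ᴴ) ⊗ₖ 1)) := by
  have h : (annihilator m)ᴴ * (annihilator m)ᴴ = 0 := by
    rw [← conjTranspose_mul, annihilator_mul_self, conjTranspose_zero]
  rw [skewMode, sub_mul_self_of_mul_self_eq_zero (annihilator_mul_self m) h, annihilator,
    conjTranspose_kronecker, ← mul_kronecker_mul, ← mul_kronecker_mul,
    ← golayCirculant_comm_conjTranspose m m, ← kronecker_add,
    jordanWigner_lowering_anticommutator, kronecker_smul]

theorem skewMode_anticomm {m n : Fin 5} (h : m ≠ n) :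
    skewMode m * skewMode n = -(skewMode n * skewMode m) := by
  refine sub_anticomm (annihilator_anticomm h) (annihilator_anticomm_conjTranspose h) ?_ ?_
  · rw [annihilator_anticomm_conjTranspose h.symm, neg_neg]
  · rw [← conjTranspose_mul, ← conjTranspose_mul, annihilator_anticomm h.symm, conjTranspose_neg]

/-- The coefficient matrices before multiplication by a Hadamard matrix. -/
noncomputable def core : Fin 3 → Matrix Index Index ℂ :=
  ![1, skewMode 0 + skewMode 1, skewMode 2 + skewMode 3 + skewMode 4]

theorem core_mul_conjTranspose (i : Fin 3) :
    core i * (core i)ᴴ = ((![1, 8, 22] : Fin 3 → ℂ) i) • 1 := by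
  fin_cases i
  · simp [core]
  · have h : (2 : ℂ) • ((golayCirculant 0 * (golayCirculant 0)ᴴ + golayCirculant 1 *
        (golayCirculant 1)ᴴ) ⊗ₖ (1 : Matrix (Fin 11 → Fin 2) (Fin 11 → Fin 2) ℂ)) =
        (8 : ℂ) • 1 := by
      rw [golayCirculant_pair_two, smul_kronecker, one_kronecker_one, smul_smul]
      norm_num
    simp only [core, Fin.mk_one, cons_val_one, cons_val_zero, conjTranspose_add,
      skewMode_conjTranspose, ← h, add_kronecker, add_mul, mul_add, mul_neg, smul_add,
      skewMode_mul_self, skewMode_anticomm (show (1 : Fin 5) ≠ 0 by decide)]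
    abel
  · have h : (2 : ℂ) • ((golayCirculant 2 * (golayCirculant 2)ᴴ + golayCirculant 3 *
        (golayCirculant 3)ᴴ + golayCirculant 4 * (golayCirculant 4)ᴴ) ⊗ₖ
        (1 : Matrix (Fin 11 → Fin 2) (Fin 11 → Fin 2) ℂ)) = (22 : ℂ) • 1 := by
      rw [golayCirculant_pair_five, smul_kronecker, one_kronecker_one, smul_smul]
      norm_num
    simp only [core, Fin.reduceFinMk, cons_val, conjTranspose_add,
      skewMode_conjTranspose, ← h, add_kronecker, add_mul, mul_add, mul_neg, smul_add,
      skewMode_mul_self, skewMode_anticomm (show (3 : Fin 5) ≠ 2 by decide),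
      skewMode_anticomm (show (4 : Fin 5) ≠ 2 by decide),
      skewMode_anticomm (show (4 : Fin 5) ≠ 3 by decide)]
    abel

theorem core_anticomm_of_lt {i j : Fin 3} (h : i < j) :
    core i * (core j)ᴴ + core j * (core i)ᴴ = 0 := by
  have h₀₁ : core 0 * (core 1)ᴴ + core 1 * (core 0)ᴴ = 0 := by
    simp [core, skewMode_conjTranspose]
    abel
  have h₀₂ : core 0 * (core 2)ᴴ + core 2 * (core 0)ᴴ = 0 := by
    simp [core, skewMode_conjTranspose]
    abel
  have h₁₂ : core 1 * (core 2)ᴴ + core 2 * (core 1)ᴴ = 0 := by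
    simp only [core, cons_val, conjTranspose_add, skewMode_conjTranspose, add_mul, mul_add, mul_neg,
      skewMode_anticomm (show (2 : Fin 5) ≠ 0 by decide),
      skewMode_anticomm (show (3 : Fin 5) ≠ 0 by decide),
      skewMode_anticomm (show (4 : Fin 5) ≠ 0 by decide),
      skewMode_anticomm (show (2 : Fin 5) ≠ 1 by decide),
      skewMode_anticomm (show (3 : Fin 5) ≠ 1 by decide),
      skewMode_anticomm (show (4 : Fin 5) ≠ 1 by decide)]
    abel
  fin_cases i <;> fin_cases j <;> first | exact absurd h (by decide) | assumption

theorem core_anticomm {i j : Fin 3} (h : i ≠ j) :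
    core i * (core j)ᴴ + core j * (core i)ᴴ = 0 := by
  rcases lt_or_gt_of_ne h with hlt | hgt
  · exact core_anticomm_of_lt hlt
  · rw [add_comm]
    exact core_anticomm_of_lt hgt

end Modes

section Entries

/-- A complex number is zero or a fourth root of unity. -/
def ZeroOrRoot (z : ℂ) : Prop := z = 0 ∨ z ^ 4 = 1

theorem ZeroOrRoot.mul {z w : ℂ} (hz : ZeroOrRoot z) (hw : ZeroOrRoot w) :
    ZeroOrRoot (z * w) := by
  rcases hz with rfl | hz
  · simp [ZeroOrRoot]
  · rcases hw with rfl | hw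
    · simp [ZeroOrRoot]
    · exact Or.inr (by rw [mul_pow, hz, hw, one_mul])

theorem ZeroOrRoot.star {z : ℂ} (hz : ZeroOrRoot z) : ZeroOrRoot (star z) :=
  hz.imp (fun h => by simp [h]) fun h => by rw [← star_pow, h, star_one]

theorem ZeroOrRoot.neg {z : ℂ} (hz : ZeroOrRoot z) : ZeroOrRoot (-z) :=
  hz.imp (fun h => by simp [h]) fun h => by rw [neg_pow, h]; norm_num

theorem ZeroOrRoot.add {z w : ℂ} (hz : ZeroOrRoot z) (hw : ZeroOrRoot w) (h : z * w = 0) :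
    ZeroOrRoot (z + w) := by
  rcases mul_eq_zero.mp h with rfl | rfl
  · simpa using hw
  · simpa using hz

theorem ZeroOrRoot.cases {z : ℂ} (hz : ZeroOrRoot z) :
    z = 0 ∨ z = 1 ∨ z = -1 ∨ z = Complex.I ∨ z = -Complex.I := by
  refine hz.imp id fun h => ?_
  have h' : (z - 1) * ((z + 1) * ((z - Complex.I) * (z + Complex.I))) = 0 := by
    linear_combination h + (1 - z ^ 2) * Complex.I_sq
  simpa [sub_eq_zero, add_eq_zero_iff_eq_neg] using h'

/-- The Hadamard factor `1 ⊗ sylvester 11`. -/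
noncomputable def hadamardFactor : Matrix Index Index ℂ := 1 ⊗ₖ sylvester 11

theorem hadamardFactor_mul_conjTranspose :
    hadamardFactor * hadamardFactorᴴ = (2 : ℂ) ^ 11 • 1 := by
  rw [hadamardFactor, conjTranspose_kronecker, ← mul_kronecker_mul, conjTranspose_one, one_mul,
    sylvester_mul_conjTranspose, kronecker_smul, one_kronecker_one]

theorem skewMode_mul_hadamardFactor_apply (m : Fin 5) (x y : Index) :
    (skewMode m * hadamardFactor) x y =
      golaySeq m (x.1 - y.1) * (jordanWigner lowering (site m) * sylvester 11) x.2 y.2 -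
      star (golaySeq m (-(x.1 - y.1)) : ℂ) *
        (jordanWigner loweringᴴ (site m) * sylvester 11) x.2 y.2 := by
  rw [skewMode, annihilator, hadamardFactor, sub_mul, conjTranspose_kronecker,
    jordanWigner_conjTranspose, ← mul_kronecker_mul, ← mul_kronecker_mul, mul_one, mul_one]
  simp [kroneckerMap_apply, golayCirculant, conjTranspose_apply]

theorem zeroOrRoot_golaySeq (m : Fin 5) (p : ZMod 31) : ZeroOrRoot (golaySeq m p) :=
  (golaySeq_eq_zero_or_pow_four m p).imp (fun h => by simp [h])
    fun h => by rw [← map_pow, h, map_one]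

theorem zeroOrRoot_skewMode_mul_hadamardFactor (m : Fin 5) (x y : Index) :
    ZeroOrRoot ((skewMode m * hadamardFactor) x y) := by
  rw [skewMode_mul_hadamardFactor_apply, sub_eq_add_neg]
  refine ((zeroOrRoot_golaySeq m _).mul (Or.inr ?_)).add
    (((zeroOrRoot_golaySeq m _).star.mul (Or.inr ?_)).neg) ?_
  · exact jordanWigner_mul_sylvester_apply_pow_four lowering_mul_hadamardTwo_apply_pow_four _ _ _
  · exact jordanWigner_mul_sylvester_apply_pow_four
      lowering_conjTranspose_mul_hadamardTwo_apply_pow_four _ _ _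
  · rcases mul_eq_zero.mp (golaySeq_mul_neg_eq_zero m m (x.1 - y.1)) with h | h <;> simp [h, -neg_sub]

theorem skewMode_mul_hadamardFactor_disjoint {m n : Fin 5} (h : m ≠ n) (x y : Index) :
    (skewMode m * hadamardFactor) x y * (skewMode n * hadamardFactor) x y = 0 := by
  rw [skewMode_mul_hadamardFactor_apply, skewMode_mul_hadamardFactor_apply]
  generalize x.1 - y.1 = p
  rcases mul_eq_zero.mp (golaySeq_mul_eq_zero h p) with h₁ | h₁ <;>
  rcases mul_eq_zero.mp (golaySeq_mul_eq_zero h (-p)) with h₂ | h₂ <;>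
  rcases mul_eq_zero.mp (golaySeq_mul_neg_eq_zero m n p) with h₃ | h₃ <;>
  rcases mul_eq_zero.mp (golaySeq_mul_neg_eq_zero n m p) with h₄ | h₄ <;>
  simp [h₁, h₂, h₃, h₄]

theorem hadamardFactor_mul_skewMode_disjoint (m : Fin 5) (x y : Index) :
    hadamardFactor x y * (skewMode m * hadamardFactor) x y = 0 := by
  rw [skewMode_mul_hadamardFactor_apply]
  by_cases h : x.1 = y.1
  · simp [h, golaySeq_zero]
  · simp [hadamardFactor, kroneckerMap_apply, one_apply_ne h]

theorem zeroOrRoot_hadamardFactor (x y : Index) : ZeroOrRoot (hadamardFactor x y) := by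
  rw [hadamardFactor, kroneckerMap_apply]
  refine ZeroOrRoot.mul ?_ (Or.inr (sylvester_apply_pow_four _ _))
  by_cases h : x.1 = y.1
  · exact Or.inr (by rw [h, one_apply_eq, one_pow])
  · exact Or.inl (one_apply_ne h)

/-- The coefficient matrices of the design, on the index type `Index`. -/
noncomputable def design (i : Fin 3) : Matrix Index Index ℂ := core i * hadamardFactor

theorem zeroOrRoot_design (i : Fin 3) (x y : Index) : ZeroOrRoot (design i x y) := by
  have hz := fun m => zeroOrRoot_skewMode_mul_hadamardFactor m x y
  have hd := fun {m n : Fin 5} (h : m ≠ n) => skewMode_mul_hadamardFactor_disjoint h x y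
  fin_cases i
  · simpa [design, core] using zeroOrRoot_hadamardFactor x y
  · simpa [design, core, add_mul] using (hz 0).add (hz 1) (hd (by decide))
  · simpa [design, core, add_mul] using ((hz 2).add (hz 3) (hd (by decide))).add (hz 4)
      (by rw [add_mul, hd (by decide), hd (by decide), add_zero])

theorem design_disjoint_of_lt {i j : Fin 3} (h : i < j) (x y : Index) :
    design i x y * design j x y = 0 := by
  have hd := fun {m n : Fin 5} (h : m ≠ n) => skewMode_mul_hadamardFactor_disjoint h x y
  have h₀₁ : design 0 x y * design 1 x y = 0 := by
    simp [design, core, add_mul, mul_add, hadamardFactor_mul_skewMode_disjoint]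
  have h₀₂ : design 0 x y * design 2 x y = 0 := by
    simp [design, core, add_mul, mul_add, hadamardFactor_mul_skewMode_disjoint]
  have h₁₂ : design 1 x y * design 2 x y = 0 := by
    simp [design, core, add_mul, mul_add, hd]
  fin_cases i <;> fin_cases j <;> first | exact absurd h (by decide) | assumption

theorem design_disjoint {i j : Fin 3} (h : i ≠ j) (x y : Index) :
    design i x y * design j x y = 0 := by
  rcases lt_or_gt_of_ne h with hlt | hgt
  · exact design_disjoint_of_lt hlt x y
  · rw [mul_comm]
    exact design_disjoint_of_lt hgt x y

theorem design_mul_conjTranspose (i j : Fin 3) :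
    design i * (design j)ᴴ = (2 : ℂ) ^ 11 • (core i * (core j)ᴴ) := by
  rw [design, design, conjTranspose_mul, Matrix.mul_assoc, ← Matrix.mul_assoc hadamardFactor,
    hadamardFactor_mul_conjTranspose, smul_mul, Matrix.one_mul, Matrix.mul_smul]

theorem card_index : Fintype.card Index = 2 ^ 11 * 31 := by
  rw [Fintype.card_prod, ZMod.card, Fintype.card_fun, Fintype.card_fin, Fintype.card_fin, mul_comm]

end Entries

end CODConstruction

open CODConstruction

/-- There exists a `COD(2^11 · 31; 2^11, 2^11 · 8, 2^11 · 22)`. -/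
theorem exists_COD_2pow11_31 :
    ∃ C : Fin 3 → Matrix (Fin (2 ^ 11 * 31)) (Fin (2 ^ 11 * 31)) ℂ,
      IsCOD ![2 ^ 11, 2 ^ 11 * 8, 2 ^ 11 * 22] C := by
  have e : Fin (2 ^ 11 * 31) ≃ Index := (Fintype.equivFinOfCardEq card_index).symm
  refine ⟨fun i => (design i).submatrix e e, fun i a b => (zeroOrRoot_design i _ _).cases,
    fun i j h a b => design_disjoint h _ _, fun i => ?_, fun i j h => ?_⟩
  · rw [conjTranspose_submatrix, submatrix_mul_equiv, design_mul_conjTranspose,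
      core_mul_conjTranspose, smul_smul, submatrix_smul, Pi.smul_apply, Pi.smul_apply,
      submatrix_one_equiv]
    congr 1
    fin_cases i <;> norm_num
  · rw [conjTranspose_submatrix, conjTranspose_submatrix, submatrix_mul_equiv, submatrix_mul_equiv,
      design_mul_conjTranspose, design_mul_conjTranspose, submatrix_smul, submatrix_smul]
    simp only [Pi.smul_apply, ← smul_add]
    rw [← Pi.add_apply, ← Pi.add_apply, ← submatrix_add, core_anticomm h]
    simp
end

section
/- There exists an orthogonal design OD(2^12 · 31; 2^12, 2^12 · 8, 2^12 · 22), i.e., an OD of order 126976 and type (4096, 32768, 90112). -/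
open Matrix
open scoped Kronecker

/-! ### Orthogonal families in star rings -/

/-- The coefficients `X i` of a formal sum `∑ xᵢ X i` whose product with its adjoint is
`∑ u i xᵢ²`, for commuting self-adjoint variables `xᵢ`. -/
def IsOrthogonalFamily {R : Type*} [Ring R] [StarRing R] {k : ℕ} (u : Fin k → ℕ)
    (X : Fin k → R) : Prop :=
  (∀ i, X i * star (X i) = u i) ∧
  (∀ i j, i ≠ j → X i * star (X j) + X j * star (X i) = 0)

theorem IsOrthogonalFamily.map {R S : Type*} [Ring R] [StarRing R] [Ring S] [StarRing S] {k : ℕ}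
    {u : Fin k → ℕ} {X : Fin k → R} (h : IsOrthogonalFamily u X) (f : R →+* S)
    (hf : ∀ x, f (star x) = star (f x)) : IsOrthogonalFamily u (fun i => f (X i)) := by
  refine ⟨fun i => ?_, fun i j hij => ?_⟩
  · rw [← hf, ← map_mul, h.1, map_natCast]
  · rw [← hf, ← hf, ← map_mul, ← map_mul, ← map_add, h.2 i j hij, map_zero]

/-- Two commuting families of elements combine into an orthogonal family of `2 × 2` matrices. -/
theorem isOrthogonalFamily_doubling {M : Type*} [Ring M] [StarRing M] {k : ℕ} {u : Fin k → ℕ}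
    {F G : Fin k → M} (hc : ∀ i j, F i * G j = G j * F i)
    (hrow : ∀ i, F i * star (F i) + G i * star (G i) = u i)
    (hcol : ∀ i, star (G i) * G i + star (F i) * F i = u i)
    (hF : ∀ i j, i ≠ j → F i * star (F j) + F j * star (F i) = 0)
    (hG : ∀ i j, i ≠ j → G i * star (G j) + G j * star (G i) = 0)
    (hF' : ∀ i j, i ≠ j → star (F i) * F j + star (F j) * F i = 0)
    (hG' : ∀ i j, i ≠ j → star (G i) * G j + star (G j) * G i = 0) :
    IsOrthogonalFamily u (fun i => !![F i, G i; -star (G i), star (F i)]) := by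
  have hcs : ∀ i j, star (F i) * star (G j) = star (G j) * star (F i) := fun i j => by
    rw [← star_mul, ← star_mul, hc]
  refine ⟨fun i => ?_, fun i j hij => ?_⟩
  · ext a b
    fin_cases a <;> fin_cases b <;>
      simp [Matrix.mul_apply, Fin.sum_univ_two, Matrix.star_apply, hrow, hcol, hc, hcs,
        Matrix.natCast_apply]
  · have hstar : ∀ i, star !![F i, G i; -star (G i), star (F i)] =
        !![star (F i), -G i; star (G i), F i] := fun i => by
      ext a b
      fin_cases a <;> fin_cases b <;> simp [Matrix.star_apply]
    simp only [hstar, Matrix.mul_fin_two]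
    ext a b
    fin_cases a <;> fin_cases b <;> simp [hc, hcs]
    · rw [add_add_add_comm, hF i j hij, hG i j hij, add_zero]
    · rw [add_add_add_comm, hG' i j hij, hF' i j hij, add_zero]

/-! ### A three-variable design of order four -/

section Quaternionic

variable {T : Type*} [CommRing T] [StarRing T]

/-- A skew-adjoint matrix of order four. -/
def skewInner (a : T) : Matrix (Fin 4) (Fin 4) T :=
  !![0, a, 0, 0; -star a, 0, 0, 0; 0, 0, 0, -a; 0, 0, star a, 0]

/-- A skew-adjoint matrix of order four, anticommuting with every `skewInner a`. -/
def skewOuter (b : T) : Matrix (Fin 4) (Fin 4) T :=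
  !![0, 0, b, 0; 0, 0, 0, b; -star b, 0, 0, 0; 0, -star b, 0, 0]

theorem star_skewInner (a : T) : star (skewInner a) = -skewInner a := by
  ext p q
  fin_cases p <;> fin_cases q <;> simp [skewInner, Matrix.star_apply]

theorem star_skewOuter (b : T) : star (skewOuter b) = -skewOuter b := by
  ext p q
  fin_cases p <;> fin_cases q <;> simp [skewOuter, Matrix.star_apply]

theorem skewInner_mul_self (a : T) : skewInner a * skewInner a = -((a * star a) • 1) := by
  ext p q
  rw [skewInner, Matrix.mul_apply, Fin.sum_univ_four]
  fin_cases p <;> fin_cases q <;> simp [mul_comm]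

theorem skewOuter_mul_self (b : T) : skewOuter b * skewOuter b = -((b * star b) • 1) := by
  ext p q
  rw [skewOuter, Matrix.mul_apply, Fin.sum_univ_four]
  fin_cases p <;> fin_cases q <;> simp [mul_comm]

theorem skewOuter_mul_skewInner (a b : T) :
    skewOuter b * skewInner a = -(skewInner a * skewOuter b) := by
  ext p q
  rw [skewOuter, skewInner, Matrix.neg_apply, Matrix.mul_apply, Matrix.mul_apply,
    Fin.sum_univ_four, Fin.sum_univ_four]
  fin_cases p <;> fin_cases q <;> simp [mul_comm]

/-- The coefficients of an order-four design in a self-adjoint variable and two variables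
`a`, `b` that may occur together with their adjoints. -/
def quaternionicFamily (a b : T) : Fin 3 → Matrix (Fin 4) (Fin 4) T :=
  ![1, skewInner a, skewOuter b]

theorem star_quaternionicFamily (a b : T) (i : Fin 3) :
    star (quaternionicFamily a b i) = quaternionicFamily a b i ∨
      star (quaternionicFamily a b i) = -quaternionicFamily a b i := by
  fin_cases i
  · exact .inl (star_one _)
  · exact .inr (star_skewInner a)
  · exact .inr (star_skewOuter b)

theorem quaternionicFamily_mul_star_self (a b : T) (i : Fin 3) :
    quaternionicFamily a b i * star (quaternionicFamily a b i) =
      (![1, a * star a, b * star b] i) • 1 := by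
  fin_cases i <;>
    simp [quaternionicFamily, star_skewInner, star_skewOuter, skewInner_mul_self,
      skewOuter_mul_self]

theorem star_mul_self_quaternionicFamily (a b : T) (i : Fin 3) :
    star (quaternionicFamily a b i) * quaternionicFamily a b i =
      (![1, a * star a, b * star b] i) • 1 := by
  rw [← quaternionicFamily_mul_star_self]
  rcases star_quaternionicFamily a b i with h | h <;> simp [h]

theorem quaternionicFamily_mul_star_add (a b : T) (i j : Fin 3) (hij : i ≠ j) :
    quaternionicFamily a b i * star (quaternionicFamily a b j) +
      quaternionicFamily a b j * star (quaternionicFamily a b i) = 0 := by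
  fin_cases i <;> fin_cases j <;> simp at hij <;>
    simp [quaternionicFamily, star_skewInner, star_skewOuter, skewOuter_mul_skewInner]

theorem star_mul_quaternionicFamily_add (a b : T) (i j : Fin 3) (hij : i ≠ j) :
    star (quaternionicFamily a b i) * quaternionicFamily a b j +
      star (quaternionicFamily a b j) * quaternionicFamily a b i = 0 := by
  fin_cases i <;> fin_cases j <;> simp at hij <;>
    simp [quaternionicFamily, star_skewInner, star_skewOuter, skewOuter_mul_skewInner]

theorem star_kronecker {m n : Type*} (A : Matrix m m T) (B : Matrix n n T) :
    star (A ⊗ₖ B) = star A ⊗ₖ star B :=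
  Matrix.conjTranspose_kronecker A B

variable (m : Type*) [Fintype m] [DecidableEq m]

/-- The first of two commuting inflations of `quaternionicFamily`. -/
def leftFamily (a b : T) (i : Fin 3) :
    Matrix (Fin 4 × (m × Fin 4)) (Fin 4 × (m × Fin 4)) T :=
  quaternionicFamily a b i ⊗ₖ 1

/-- The second of two commuting inflations of `quaternionicFamily`. -/
def rightFamily (a b : T) (i : Fin 3) :
    Matrix (Fin 4 × (m × Fin 4)) (Fin 4 × (m × Fin 4)) T :=
  1 ⊗ₖ (1 ⊗ₖ quaternionicFamily a b i)

/-- The coefficients of a design of order `32 * card m`, as `2 × 2` block matrices. -/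
def blockFamily (a₁ b₁ a₂ b₂ : T) (i : Fin 3) :
    Matrix (Fin 2) (Fin 2) (Matrix (Fin 4 × (m × Fin 4)) (Fin 4 × (m × Fin 4)) T) :=
  !![leftFamily m a₁ a₂ i, rightFamily m b₁ b₂ i;
    -star (rightFamily m b₁ b₂ i), star (leftFamily m a₁ a₂ i)]

theorem isOrthogonalFamily_blockFamily {a₁ b₁ a₂ b₂ : T} {v w : ℕ}
    (h₁ : a₁ * star a₁ + b₁ * star b₁ = v) (h₂ : a₂ * star a₂ + b₂ * star b₂ = w) :
    IsOrthogonalFamily ![2, v, w] (blockFamily m a₁ b₁ a₂ b₂) := by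
  have hnorm : ∀ i : Fin 3, ![1, a₁ * star a₁, a₂ * star a₂] i +
      ![1, b₁ * star b₁, b₂ * star b₂] i = ((![2, v, w] i : ℕ) : T) := by
    intro i
    fin_cases i
    · norm_num
    · exact h₁
    · exact h₂
  have hcast : ∀ n : ℕ, (n : T) • (1 : Matrix (Fin 4 × (m × Fin 4)) (Fin 4 × (m × Fin 4)) T) =
      (n : Matrix (Fin 4 × (m × Fin 4)) (Fin 4 × (m × Fin 4)) T) := fun n => by
    rw [Nat.cast_smul_eq_nsmul, nsmul_one]
  apply isOrthogonalFamily_doubling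
  · intro i j
    simp only [leftFamily, rightFamily, ← Matrix.mul_kronecker_mul, mul_one, one_mul]
  · intro i
    simp only [leftFamily, rightFamily, star_kronecker, star_one, ← Matrix.mul_kronecker_mul,
      mul_one, quaternionicFamily_mul_star_self, Matrix.smul_kronecker, Matrix.kronecker_smul,
      Matrix.one_kronecker_one, ← add_smul, hnorm, hcast]
  · intro i
    rw [add_comm]
    simp only [leftFamily, rightFamily, star_kronecker, star_one, ← Matrix.mul_kronecker_mul,
      mul_one, star_mul_self_quaternionicFamily, Matrix.smul_kronecker, Matrix.kronecker_smul,
      Matrix.one_kronecker_one, ← add_smul, hnorm, hcast]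
  all_goals
    intro i j hij
    simp only [leftFamily, rightFamily, star_kronecker, star_one, ← Matrix.mul_kronecker_mul,
      mul_one, ← Matrix.add_kronecker, ← Matrix.kronecker_add, Matrix.zero_kronecker,
      Matrix.kronecker_zero, quaternionicFamily_mul_star_add _ _ i j hij,
      star_mul_quaternionicFamily_add _ _ i j hij]

end Quaternionic

/-! ### Circulant matrices over the Gaussian integers -/

/-- The commutative ring of circulant Gaussian integer matrices of order 31. -/
def circulants : StarSubalgebra GaussianInt (Matrix (Fin 31) (Fin 31) GaussianInt) where
  carrier := Set.range Matrix.circulant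
  mul_mem' := by
    rintro _ _ ⟨v, rfl⟩ ⟨w, rfl⟩
    exact ⟨_, (Matrix.circulant_mul v w).symm⟩
  add_mem' := by
    rintro _ _ ⟨v, rfl⟩ ⟨w, rfl⟩
    exact ⟨_, Matrix.circulant_add v w⟩
  algebraMap_mem' r := ⟨Pi.single 0 r, Matrix.circulant_single _ r⟩
  star_mem' := by
    rintro _ ⟨v, rfl⟩
    exact ⟨_, (Matrix.conjTranspose_circulant v).symm⟩

instance : CommRing circulants where
  mul_comm := by
    rintro ⟨_, v, rfl⟩ ⟨_, w, rfl⟩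
    exact Subtype.ext (Matrix.circulant_mul_comm v w)

/-- The circulant matrix with first column `v`, as an element of `circulants`. -/
def circulantOf (v : Fin 31 → GaussianInt) : circulants := ⟨Matrix.circulant v, v, rfl⟩

theorem circulantOf_mul_star_add {v w : Fin 31 → GaussianInt} {n : ℕ}
    (h : ∀ d, ∑ k, v (d - k) * star (v (-k)) + ∑ k, w (d - k) * star (w (-k)) =
      if d = 0 then (n : GaussianInt) else 0) :
    circulantOf v * star (circulantOf v) + circulantOf w * star (circulantOf w) = n := by
  apply Subtype.ext
  change Matrix.circulant v * (Matrix.circulant v).conjTranspose +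
      Matrix.circulant w * (Matrix.circulant w).conjTranspose =
    (n : Matrix (Fin 31) (Fin 31) GaussianInt)
  rw [Matrix.conjTranspose_circulant, Matrix.conjTranspose_circulant, Matrix.circulant_mul,
    Matrix.circulant_mul, ← Matrix.circulant_add]
  refine Matrix.ext fun i j => ?_
  simpa [Matrix.circulant_apply, Matrix.mulVec, dotProduct, Matrix.natCast_apply, sub_eq_zero]
    using h (i - j)

/-- The parallelogram law turns a complementary pair into a pair with overlapping supports. -/
theorem add_mul_star_add_sub_mul_star {T : Type*} [CommRing T] [StarRing T] {a b : T} {n : ℕ}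
    (h : a * star a + b * star b = n) :
    (a + b) * star (a + b) + (a - b) * star (a - b) = ((2 * n : ℕ) : T) := by
  rw [star_add, star_sub, Nat.cast_mul, ← h]
  push_cast
  ring

/-! ### Complementary sequences -/

/-- The first sequence of a Golay pair of length 4, in positions 1 to 4. -/
def shortLeft : Fin 31 → GaussianInt :=
  ![0, 1, 1, 1, -1, 0, 0, 0, 0, 0, 0, 0, 0, 0, 0, 0, 0, 0, 0, 0, 0, 0, 0, 0, 0, 0, 0, 0, 0, 0, 0]

/-- The second sequence of a Golay pair of length 4, in positions -4 to -1. -/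
def shortRight : Fin 31 → GaussianInt :=
  ![0, 0, 0, 0, 0, 0, 0, 0, 0, 0, 0, 0, 0, 0, 0, 0, 0, 0, 0, 0, 0, 0, 0, 0, 0, 0, 0, 1, 1, -1, 1]

/-- The first sequence of a complex Golay pair of length 11, in positions 5 to 15. -/
def longLeft : Fin 31 → GaussianInt :=
  ![0, 0, 0, 0, 0, 1, ⟨0, 1⟩, -1, 1, -1, ⟨0, 1⟩, ⟨0, -1⟩, -1, ⟨0, 1⟩, ⟨0, 1⟩, 1, 0, 0, 0, 0, 0,
    0, 0, 0, 0, 0, 0, 0, 0, 0, 0]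

/-- The second sequence of a complex Golay pair of length 11, in positions -15 to -5. -/
def longRight : Fin 31 → GaussianInt :=
  ![0, 0, 0, 0, 0, 0, 0, 0, 0, 0, 0, 0, 0, 0, 0, 0, 1, 1, ⟨0, -1⟩, ⟨0, -1⟩, ⟨0, -1⟩, 1, 1,
    ⟨0, 1⟩, -1, 1, -1, 0, 0, 0, 0]

/-- The three symmetric classes of positions: `0`, the positions within distance 4 of `0`, and
the remaining ones. -/
def positionClass (d : Fin 31) : Fin 3 :=
  if d = 0 then 0 else if d ≤ 4 ∨ 27 ≤ d then 1 else 2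

theorem positionClass_neg : ∀ d, positionClass (-d) = positionClass d := by decide

theorem shortPair_complementary :
    circulantOf shortLeft * star (circulantOf shortLeft) +
      circulantOf shortRight * star (circulantOf shortRight) = (8 : ℕ) :=
  circulantOf_mul_star_add (by decide +kernel)

theorem longPair_complementary :
    circulantOf longLeft * star (circulantOf longLeft) +
      circulantOf longRight * star (circulantOf longRight) = (22 : ℕ) :=
  circulantOf_mul_star_add (by decide +kernel)

/-! ### Supports -/

/-- A circulant with unit entries in the positions of class `i` and zeros elsewhere. -/
def FillsClass (i : Fin 3) (y : circulants) : Prop :=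
  ∀ g g', (positionClass (g - g') = i → (y.1 g g').norm = 1) ∧
    (positionClass (g - g') ≠ i → y.1 g g' = 0)

theorem FillsClass.neg {i : Fin 3} {y : circulants} (h : FillsClass i y) : FillsClass i (-y) := by
  refine fun g g' => ⟨fun hi => ?_, fun hi => ?_⟩
  · exact (Zsqrtd.norm_neg _).trans ((h g g').1 hi)
  · exact neg_eq_zero.2 ((h g g').2 hi)

theorem FillsClass.star {i : Fin 3} {y : circulants} (h : FillsClass i y) :
    FillsClass i (star y) := by
  intro g g'
  rw [← positionClass_neg, neg_sub]
  refine ⟨fun hi => ?_, fun hi => ?_⟩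
  · exact (Zsqrtd.norm_conj _).trans ((h g' g).1 hi)
  · exact star_eq_zero.2 ((h g' g).2 hi)

theorem fillsClass_one : FillsClass 0 1 := by
  change ∀ g g' : Fin 31,
    (positionClass (g - g') = 0 → ((1 : Matrix (Fin 31) (Fin 31) GaussianInt) g g').norm = 1) ∧
      (positionClass (g - g') ≠ 0 → (1 : Matrix (Fin 31) (Fin 31) GaussianInt) g g' = 0)
  have h : ∀ d, positionClass d = 0 ↔ d = 0 := by decide
  intro g g'
  rw [Ne, h, sub_eq_zero]
  exact ⟨fun hg => by rw [hg, Matrix.one_apply_eq, Zsqrtd.norm_one], fun hg => Matrix.one_apply_ne hg⟩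

theorem fillsClass_circulantOf_add {i : Fin 3} {v w : Fin 31 → GaussianInt}
    (h : ∀ d, (positionClass d = i → (v d + w d).norm = 1) ∧
      (positionClass d ≠ i → v d + w d = 0)) :
    FillsClass i (circulantOf v + circulantOf w) :=
  fun g g' => h (g - g')

theorem fillsClass_circulantOf_sub {i : Fin 3} {v w : Fin 31 → GaussianInt}
    (h : ∀ d, (positionClass d = i → (v d - w d).norm = 1) ∧
      (positionClass d ≠ i → v d - w d = 0)) :
    FillsClass i (circulantOf v - circulantOf w) :=
  fun g g' => h (g - g')

/-- Every row has a single nonzero entry, which fills the positions of class `i`. -/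
def IsMonomial {m : Type*} (i : Fin 3) (X : Matrix m m circulants) : Prop :=
  ∀ a, ∃ c, FillsClass i (X a c) ∧ ∀ c', c' ≠ c → X a c' = 0

theorem IsMonomial.neg {m : Type*} {i : Fin 3} {X : Matrix m m circulants}
    (h : IsMonomial i X) : IsMonomial i (-X) := fun a => by
  obtain ⟨c, hc, h0⟩ := h a
  exact ⟨c, hc.neg, fun c' hc' => neg_eq_zero.2 (h0 c' hc')⟩

theorem IsMonomial.kronecker_one {m n : Type*} [DecidableEq n] {i : Fin 3}
    {X : Matrix m m circulants} (h : IsMonomial i X) :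
    IsMonomial i (X ⊗ₖ (1 : Matrix n n circulants)) := by
  rintro ⟨a, b⟩
  obtain ⟨c, hc, h0⟩ := h a
  refine ⟨(c, b), by simpa using hc, ?_⟩
  rintro ⟨c', b'⟩ hne
  rw [Matrix.kronecker_apply]
  by_cases hb : b = b'
  · rw [h0 c' (fun hc' => hne (by rw [hc', hb])), zero_mul]
  · rw [Matrix.one_apply_ne hb, mul_zero]

theorem IsMonomial.one_kronecker {m n : Type*} [DecidableEq n] {i : Fin 3}
    {X : Matrix m m circulants} (h : IsMonomial i X) :
    IsMonomial i ((1 : Matrix n n circulants) ⊗ₖ X) := by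
  rintro ⟨b, a⟩
  obtain ⟨c, hc, h0⟩ := h a
  refine ⟨(b, c), by simpa using hc, ?_⟩
  rintro ⟨b', c'⟩ hne
  rw [Matrix.kronecker_apply]
  by_cases hb : b = b'
  · rw [h0 c' (fun hc' => hne (by rw [hc', hb])), mul_zero]
  · rw [Matrix.one_apply_ne hb, zero_mul]

theorem isMonomial_quaternionicFamily {a b : circulants} (ha : FillsClass 1 a)
    (hb : FillsClass 2 b) (i : Fin 3) : IsMonomial i (quaternionicFamily a b i) := by
  have ha' := ha.star
  have hb' := hb.star
  fin_cases i
  · exact fun p => ⟨p, by simpa [quaternionicFamily] using fillsClass_one,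
      fun c hc => Matrix.one_apply_ne hc.symm⟩
  · refine fun p => ⟨![1, 0, 3, 2] p, ?_, fun c => ?_⟩
    · fin_cases p
      exacts [ha, ha'.neg, ha.neg, ha']
    · fin_cases p <;> fin_cases c <;> simp [quaternionicFamily, skewInner]
  · refine fun p => ⟨![2, 3, 0, 1] p, ?_, fun c => ?_⟩
    · fin_cases p
      exacts [hb, hb, hb'.neg, hb'.neg]
    · fin_cases p <;> fin_cases c <;> simp [quaternionicFamily, skewOuter]

theorem isMonomial_star_quaternionicFamily {a b : circulants} (ha : FillsClass 1 a)
    (hb : FillsClass 2 b) (i : Fin 3) : IsMonomial i (star (quaternionicFamily a b i)) := by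
  have h := isMonomial_quaternionicFamily ha hb i
  rcases star_quaternionicFamily a b i with hs | hs <;> rw [hs]
  exacts [h, h.neg]

theorem isMonomial_blockFamily (m : Type*) [Fintype m] [DecidableEq m] {a₁ b₁ a₂ b₂ : circulants}
    (ha₁ : FillsClass 1 a₁) (hb₁ : FillsClass 1 b₁) (ha₂ : FillsClass 2 a₂)
    (hb₂ : FillsClass 2 b₂) (i : Fin 3) (p q : Fin 2) :
    IsMonomial i (blockFamily m a₁ b₁ a₂ b₂ i p q) := by
  fin_cases p <;> fin_cases q
  · exact (isMonomial_quaternionicFamily ha₁ ha₂ i).kronecker_one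
  · exact (isMonomial_quaternionicFamily hb₁ hb₂ i).one_kronecker.one_kronecker
  · change IsMonomial i (-star (rightFamily m b₁ b₂ i))
    rw [rightFamily, star_kronecker, star_kronecker, star_one, star_one]
    exact (isMonomial_star_quaternionicFamily hb₁ hb₂ i).one_kronecker.one_kronecker.neg
  · change IsMonomial i (star (leftFamily m a₁ a₂ i))
    rw [leftFamily, star_kronecker, star_one]
    exact (isMonomial_star_quaternionicFamily ha₁ ha₂ i).kronecker_one

/-! ### Realification -/

/-- The regular representation of the Gaussian integers by real `2 × 2` matrices. -/
def gaussianToReal : GaussianInt →+* Matrix (Fin 2) (Fin 2) ℝ where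
  toFun z := !![(z.re : ℝ), -(z.im : ℝ); (z.im : ℝ), (z.re : ℝ)]
  map_one' := by simp [Matrix.one_fin_two]
  map_mul' z w := by
    rw [Matrix.mul_fin_two]
    ext p q
    fin_cases p <;> fin_cases q <;> simp <;> ring
  map_zero' := by
    ext p q
    fin_cases p <;> fin_cases q <;> simp
  map_add' z w := by
    ext p q
    fin_cases p <;> fin_cases q <;> simp [add_comm]

theorem gaussianToReal_star (z : GaussianInt) :
    gaussianToReal (star z) = star (gaussianToReal z) := by
  ext p q
  fin_cases p <;> fin_cases q <;> simp [gaussianToReal, Matrix.star_apply]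

theorem gaussianToReal_row {z : GaussianInt} (hz : z.norm = 1) (p : Fin 2) :
    ∃ (q₀ : Fin 2) (ε : ℝ), (ε = 1 ∨ ε = -1) ∧
      ∀ q, gaussianToReal z p q = if q = q₀ then ε else 0 := by
  obtain ⟨x, y⟩ := z
  have hxy : x * x + y * y = 1 := by simpa [Zsqrtd.norm_def] using hz
  have hcases : (x = 0 ∧ (y = 1 ∨ y = -1)) ∨ (y = 0 ∧ (x = 1 ∨ x = -1)) := by
    have hx : x ≤ 1 := by nlinarith
    have hx' : -1 ≤ x := by nlinarith
    have hy : y ≤ 1 := by nlinarith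
    have hy' : -1 ≤ y := by nlinarith
    interval_cases x <;> interval_cases y <;> simp_all
  rcases hcases with ⟨rfl, hy⟩ | ⟨rfl, hx⟩
  · fin_cases p
    · refine ⟨1, -(y : ℝ), ?_, fun q => ?_⟩
      · rcases hy with rfl | rfl <;> simp
      · fin_cases q <;> simp [gaussianToReal]
    · refine ⟨0, (y : ℝ), ?_, fun q => ?_⟩
      · rcases hy with rfl | rfl <;> simp
      · fin_cases q <;> simp [gaussianToReal]
  · refine ⟨p, (x : ℝ), ?_, fun q => ?_⟩
    · rcases hx with rfl | rfl <;> simp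
    · fin_cases p <;> fin_cases q <;> simp [gaussianToReal]

/-- Flattening of block matrices of circulants to real matrices. -/
def realify (m : Type*) [Fintype m] [DecidableEq m] :
    Matrix (Fin 2) (Fin 2) (Matrix m m circulants) →+*
      Matrix ((Fin 2 × m) × (Fin 31 × Fin 2)) ((Fin 2 × m) × (Fin 31 × Fin 2)) ℝ :=
  (Matrix.compRingEquiv (Fin 2 × m) (Fin 31 × Fin 2) ℝ).toRingHom.comp <|
    ((Matrix.compRingEquiv (Fin 31) (Fin 2) ℝ).toRingHom.comp <|
      gaussianToReal.mapMatrix.comp circulants.subtype.toRingHom).mapMatrix.comp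
        (Matrix.compRingEquiv (Fin 2) m circulants).toRingHom

theorem realify_apply (m : Type*) [Fintype m] [DecidableEq m]
    (X : Matrix (Fin 2) (Fin 2) (Matrix m m circulants)) (p p' : Fin 2) (a a' : m)
    (g g' : Fin 31) (e e' : Fin 2) :
    realify m X ((p, a), (g, e)) ((p', a'), (g', e')) =
      gaussianToReal ((X p p' a a').1 g g') e e' :=
  rfl

theorem realify_star (m : Type*) [Fintype m] [DecidableEq m]
    (X : Matrix (Fin 2) (Fin 2) (Matrix m m circulants)) :
    realify m (star X) = star (realify m X) := by
  ext ⟨⟨p, a⟩, g, e⟩ ⟨⟨p', a'⟩, g', e'⟩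
  rw [Matrix.star_apply, realify_apply, realify_apply]
  exact congrFun (congrFun (gaussianToReal_star ((X p' p a' a).1 g' g)) e) e'

theorem realify_row {m : Type*} [Fintype m] [DecidableEq m]
    {X : Fin 3 → Matrix (Fin 2) (Fin 2) (Matrix m m circulants)}
    (hX : ∀ i p q, IsMonomial i (X i p q)) (r : (Fin 2 × m) × (Fin 31 × Fin 2))
    (b : Fin 2 × Fin 31) :
    ∃ (i₀ : Fin 3) (d₀ : m × Fin 2) (ε : ℝ), (ε = 1 ∨ ε = -1) ∧
      ∀ i d, realify m (X i) r ((b.1, d.1), (b.2, d.2)) =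
        if i = i₀ ∧ d = d₀ then ε else 0 := by
  obtain ⟨⟨p, a⟩, g, e⟩ := r
  obtain ⟨p', g'⟩ := b
  obtain ⟨c, hc, hc0⟩ := hX (positionClass (g - g')) p p' a
  obtain ⟨e₀, ε, hε, hrow⟩ := gaussianToReal_row ((hc g g').1 rfl) e
  refine ⟨positionClass (g - g'), (c, e₀), ε, hε, ?_⟩
  rintro i ⟨c', e'⟩
  rw [realify_apply]
  by_cases hi : i = positionClass (g - g')
  · subst hi
    by_cases hc' : c' = c
    · subst hc'
      simp [hrow]
    · rw [hc0 c' hc']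
      simp [hc']
  · have hz : (X i p p' a c').1 g g' = 0 := by
      obtain ⟨k, hk, hk0⟩ := hX i p p' a
      by_cases hck : c' = k
      · exact hck ▸ (hk g g').2 (Ne.symm hi)
      · rw [hk0 c' hck]
        rfl
    simp [hz, hi]

/-! ### Hadamard matrices and the final design -/

theorem isHadamard_two : (!![1, 1; 1, -1] : Matrix (Fin 2) (Fin 2) ℝ).IsHadamard := by
  refine ⟨fun a b => ?_, ?_, ?_⟩
  · fin_cases a <;> fin_cases b <;> simp [Unitary.mem_iff]
  all_goals
    ext a b
    fin_cases a <;> fin_cases b <;> norm_num [Matrix.mul_apply, Fin.sum_univ_two]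

theorem exists_isHadamard_two_pow (k : ℕ) :
    ∃ H : Matrix (Fin (2 ^ k)) (Fin (2 ^ k)) ℝ, H.IsHadamard := by
  induction k with
  | zero =>
    refine ⟨1, fun a b => ?_, by simp, by simp⟩
    fin_cases a
    fin_cases b
    simp
  | succ k ih =>
    obtain ⟨H, hH⟩ := ih
    have e := finProdFinEquiv.trans (finCongr (pow_succ 2 k).symm)
    exact ⟨_, (hH.kronecker isHadamard_two).reindex e e⟩

theorem exists_isHadamard {D : Type*} [Fintype D] [DecidableEq D] {k : ℕ}
    (hD : Fintype.card D = 2 ^ k) : ∃ H : Matrix D D ℝ, H.IsHadamard := by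
  obtain ⟨H, hH⟩ := exists_isHadamard_two_pow k
  have e := (Fintype.equivFinOfCardEq hD).symm
  exact ⟨_, hH.reindex e e⟩

theorem Matrix.IsHadamard.apply_eq_one_or_neg_one {D : Type*} [Fintype D] [DecidableEq D]
    {H : Matrix D D ℝ} (hH : H.IsHadamard) (a b : D) : H a b = 1 ∨ H a b = -1 := by
  have h := (Unitary.mem_iff.1 (hH.apply_mem a b)).1
  rwa [star_trivial, mul_self_eq_one_iff] at h

/-- A sparse orthogonal family, each of whose rows meets every block of columns exactly once,
becomes an orthogonal design after multiplication by Hadamard matrices on the blocks. -/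
theorem exists_isOD_of_isOrthogonalFamily {ι β D : Type*} [Fintype ι] [DecidableEq ι] [Fintype β]
    [DecidableEq β] [Fintype D] [DecidableEq D] {k n : ℕ} {u : Fin k → ℕ}
    {Z : Fin k → Matrix ι ι ℝ} (hZ : IsOrthogonalFamily u Z) (e : β × D ≃ ι)
    (hrow : ∀ r b, ∃ (i₀ : Fin k) (d₀ : D) (ε : ℝ), (ε = 1 ∨ ε = -1) ∧
      ∀ i d, Z i r (e (b, d)) = if i = i₀ ∧ d = d₀ then ε else 0)
    (hn : Fintype.card ι = n) {H : Matrix D D ℝ} (hH : H.IsHadamard) :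
    ∃ A : Fin k → Matrix (Fin n) (Fin n) ℝ, IsOD (fun i => Fintype.card D * u i) A := by
  set f : Fin n ≃ ι := (Fintype.equivFinOfCardEq hn).symm
  set Y : Fin k → Matrix ι (β × D) ℝ :=
    fun i => (Z i).submatrix (Equiv.refl ι) e * ((1 : Matrix β β ℝ) ⊗ₖ H) with hY
  have hmul : ∀ i j, Y i * (Y j)ᵀ = (Fintype.card D : ℝ) • (Z i * star (Z j)) := by
    intro i j
    have hK : ((1 : Matrix β β ℝ) ⊗ₖ H) * ((1 : Matrix β β ℝ) ⊗ₖ H)ᵀ =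
        (Fintype.card D : ℝ) • 1 := by
      rw [← Matrix.kroneckerMap_transpose, ← Matrix.mul_kronecker_mul, Matrix.transpose_one, mul_one,
        ← Matrix.conjTranspose_eq_transpose_of_trivial, hH.mul_conjTranspose,
        Matrix.kronecker_smul, Matrix.one_kronecker_one]
    rw [hY, Matrix.transpose_mul, Matrix.mul_assoc, ← Matrix.mul_assoc _ _ (_)ᵀ, hK,
      Matrix.smul_mul, Matrix.one_mul, Matrix.mul_smul, Matrix.transpose_submatrix,
      Matrix.submatrix_mul_equiv, Matrix.star_eq_conjTranspose,
      Matrix.conjTranspose_eq_transpose_of_trivial]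
    rfl
  have hentry : ∀ r b d, ∃ (i₀ : Fin k) (ε : ℝ), (ε = 1 ∨ ε = -1) ∧
      ∀ i, Y i r (b, d) = if i = i₀ then ε else 0 := by
    intro r b d
    obtain ⟨i₀, d₀, ε, hε, h⟩ := hrow r b
    refine ⟨i₀, ε * H d₀ d, ?_, fun i => ?_⟩
    · rcases hε with rfl | rfl <;> rcases hH.apply_eq_one_or_neg_one d₀ d with h' | h' <;> simp [h']
    · simp only [hY]
      rw [Matrix.mul_apply, Fintype.sum_prod_type, Finset.sum_eq_single b]
      · by_cases hi : i = i₀ <;> simp [h, hi]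
      · intro b' _ hb'
        simp [Matrix.one_apply_ne hb']
      · simp
  have hsub : ∀ i j, (Y i).submatrix f (f.trans e.symm) * ((Y j).submatrix f (f.trans e.symm))ᵀ =
      (Fintype.card D : ℝ) • (Z i * star (Z j)).submatrix f f := by
    intro i j
    rw [Matrix.transpose_submatrix, Matrix.submatrix_mul_equiv, hmul, Matrix.submatrix_smul]
    rfl
  refine ⟨fun i => (Y i).submatrix f (f.trans e.symm), fun i a b => ?_, fun i j hij a b => ?_,
    fun i => ?_, fun i j hij => ?_⟩
  · obtain ⟨i₀, ε, hε, h⟩ := hentry (f a) (e.symm (f b)).1 (e.symm (f b)).2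
    change Y i (f a) (e.symm (f b)) = 0 ∨ Y i (f a) (e.symm (f b)) = 1 ∨
      Y i (f a) (e.symm (f b)) = -1
    rw [h i]
    split_ifs
    exacts [.inr hε, .inl rfl]
  · obtain ⟨i₀, ε, hε, h⟩ := hentry (f a) (e.symm (f b)).1 (e.symm (f b)).2
    change Y i (f a) (e.symm (f b)) * Y j (f a) (e.symm (f b)) = 0
    rw [h i, h j]
    by_cases hi : i = i₀
    · rw [if_neg (c := j = i₀) (fun hj => hij (hi.trans hj.symm)), mul_zero]
    · rw [if_neg hi, zero_mul]
  · rw [hsub, hZ.1]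
    ext a b
    simp [Matrix.natCast_apply, Matrix.one_apply]
  · rw [hsub, hsub, ← smul_add]
    change (Fintype.card D : ℝ) • (Z i * star (Z j) + Z j * star (Z i)).submatrix f f = 0
    rw [hZ.2 i j hij, Matrix.submatrix_zero]
    exact smul_zero _

/-- There exists an `OD(2^12 · 31; 2^12, 2^12 · 8, 2^12 · 22)`. -/
theorem exists_OD_2pow12_31 :
    ∃ A : Fin 3 → Matrix (Fin (2 ^ 12 * 31)) (Fin (2 ^ 12 * 31)) ℝ,
      IsOD ![2 ^ 12, 2 ^ 12 * 8, 2 ^ 12 * 22] A := by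
  have hX := isOrthogonalFamily_blockFamily (Fin 64)
    (add_mul_star_add_sub_mul_star shortPair_complementary)
    (add_mul_star_add_sub_mul_star longPair_complementary)
  have hmono := isMonomial_blockFamily (Fin 64)
    (fillsClass_circulantOf_add (i := 1) (v := shortLeft) (w := shortRight) (by decide +kernel))
    (fillsClass_circulantOf_sub (i := 1) (v := shortLeft) (w := shortRight) (by decide +kernel))
    (fillsClass_circulantOf_add (i := 2) (v := longLeft) (w := longRight) (by decide +kernel))
    (fillsClass_circulantOf_sub (i := 2) (v := longLeft) (w := longRight) (by decide +kernel))
  obtain ⟨H, hH⟩ := exists_isHadamard (D := (Fin 4 × (Fin 64 × Fin 4)) × Fin 2) (k := 11)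
    (by simp)
  obtain ⟨A, hA⟩ := exists_isOD_of_isOrthogonalFamily (n := 2 ^ 12 * 31)
    (hX.map (realify _) (realify_star _)) (Equiv.prodProdProdComm _ _ _ _)
    (realify_row hmono) (by simp) hH
  refine ⟨A, ?_⟩
  convert hA using 1
  funext i
  fin_cases i <;> simp
end

section
/- There exist a signed group (G, ε), a full signed group orthogonal design SOD(2^5; 1, 1, 1, 1, 1, 1, 1, 1, 8, 8, 8) over (G, ε), and a remrep of (G, ε) of degree 2^7. -/
open Matrix

/-- Elements of the real Pauli group on `n` qubits: `⟨s, a, b⟩` stands for the monomial operator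
sending the basis vector `v` to `(-1) ^ (s + b ⬝ᵥ v)` times the basis vector `v + a`. -/
@[ext]
structure Pauli (n : ℕ) where
  /-- the sign exponent -/
  sgn : ZMod 2
  /-- the translation part -/
  shift : Fin n → ZMod 2
  /-- the diagonal part -/
  phase : Fin n → ZMod 2

namespace Pauli

variable {n : ℕ}

instance : Mul (Pauli n) where
  mul g h := ⟨g.sgn + h.sgn + g.phase ⬝ᵥ h.shift, g.shift + h.shift, g.phase + h.phase⟩

instance : One (Pauli n) where
  one := ⟨0, 0, 0⟩

instance : Inv (Pauli n) where
  inv g := ⟨-g.sgn + g.phase ⬝ᵥ g.shift, -g.shift, -g.phase⟩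

lemma mul_def (g h : Pauli n) :
    g * h = ⟨g.sgn + h.sgn + g.phase ⬝ᵥ h.shift, g.shift + h.shift, g.phase + h.phase⟩ := rfl

lemma one_def : (1 : Pauli n) = ⟨0, 0, 0⟩ := rfl

lemma inv_def (g : Pauli n) :
    g⁻¹ = ⟨-g.sgn + g.phase ⬝ᵥ g.shift, -g.shift, -g.phase⟩ := rfl

instance : Group (Pauli n) :=
  Group.ofLeftAxioms
    (fun g h k => by
      simp only [mul_def, add_dotProduct, dotProduct_add, Pauli.mk.injEq]
      exact ⟨by ring, add_assoc _ _ _, add_assoc _ _ _⟩)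
    (fun g => by simp [mul_def, one_def])
    (fun g => by
      simp only [mul_def, one_def, inv_def, neg_dotProduct, neg_add_cancel, Pauli.mk.injEq,
        and_true]
      ring)

/-- The signed group structure on the Pauli group. -/
def signedGroup (n : ℕ) : SignedGroup where
  G := Pauli n
  grp := inferInstance
  ε := ⟨1, 0, 0⟩
  central g := by simp [mul_def, add_comm]
  sq := by simp only [mul_def, one_def, dotProduct_zero, add_zero, CharTwo.add_self_eq_zero]
  ne_one := by simp [one_def]

/-- The sign `(-1) ^ z`. -/
def realSign (z : ZMod 2) : ℝ := if z = 0 then 1 else -1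

lemma realSign_add (y z : ZMod 2) : realSign (y + z) = realSign y * realSign z := by
  have h : ∀ z : ZMod 2, z = 0 ∨ z = 1 := by decide
  have h2 : (1 + 1 : ZMod 2) = 0 := rfl
  rcases h y with rfl | rfl <;> rcases h z with rfl | rfl <;> simp [realSign, h2]

lemma realSign_eq_or (z : ZMod 2) : realSign z = 1 ∨ realSign z = -1 := by
  unfold realSign; split_ifs <;> simp

lemma realSign_ne_zero (z : ZMod 2) : realSign z ≠ 0 := by
  rcases realSign_eq_or z with h | h <;> simp [h]

/-- The matrix of a Pauli operator in the standard basis. -/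
def toMatrix (g : Pauli n) : Matrix (Fin n → ZMod 2) (Fin n → ZMod 2) ℝ :=
  fun v w => if v = w + g.shift then realSign (g.sgn + g.phase ⬝ᵥ w) else 0

lemma toMatrix_ne_zero_iff (g : Pauli n) (v w : Fin n → ZMod 2) :
    g.toMatrix v w ≠ 0 ↔ v = w + g.shift := by
  simp [toMatrix, realSign_ne_zero]

lemma toMatrix_one : (1 : Pauli n).toMatrix = 1 := by
  ext v w
  simp [toMatrix, one_def, realSign, Matrix.one_apply]

lemma toMatrix_mul (g h : Pauli n) : (g * h).toMatrix = g.toMatrix * h.toMatrix := by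
  ext v w
  rw [Matrix.mul_apply, Finset.sum_eq_single (w + h.shift)]
  · simp only [toMatrix, mul_def, if_true]
    have hiff : v = w + (g.shift + h.shift) ↔ v = w + h.shift + g.shift := by
      rw [add_assoc, add_comm g.shift]
    simp only [hiff, ite_mul, zero_mul, ← realSign_add, add_dotProduct, dotProduct_add]
    congr 2
    ring
  · intro x _ hx
    simp [toMatrix, hx]
  · simp

lemma isSignedPermMatrix_reindex {m : ℕ} (e : (Fin n → ZMod 2) ≃ Fin m) (g : Pauli n) :
    IsSignedPermMatrix (Matrix.reindex e e g.toMatrix) := by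
  refine ⟨fun a => ?_, fun b => ?_, fun a b => ?_⟩
  · refine ⟨e (e.symm a - g.shift), ?_, fun c hc => ?_⟩
    · simp [toMatrix, realSign_ne_zero]
    · simp only [Matrix.reindex_apply, Matrix.submatrix_apply, toMatrix_ne_zero_iff] at hc
      rw [hc, add_sub_cancel_right, e.apply_symm_apply]
  · refine ⟨e (e.symm b + g.shift), ?_, fun c hc => ?_⟩
    · simp [toMatrix, realSign_ne_zero]
    · simp only [Matrix.reindex_apply, Matrix.submatrix_apply, toMatrix_ne_zero_iff] at hc
      rw [← hc, e.apply_symm_apply]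
  · simp only [Matrix.reindex_apply, Matrix.submatrix_apply, toMatrix]
    split_ifs
    · exact Or.inr (realSign_eq_or _)
    · exact Or.inl rfl

/-- The Pauli matrices form a real monomial representation. -/
lemma isRemrep_reindex {m : ℕ} (e : (Fin n → ZMod 2) ≃ Fin m) :
    IsRemrep (signedGroup n) m (fun g => Matrix.reindex e e (toMatrix g)) := by
  refine ⟨?_, fun g h => ?_, ?_, isSignedPermMatrix_reindex e⟩
  · change Matrix.reindex e e (toMatrix (1 : Pauli n)) = 1
    simp [toMatrix_one]
  · exact (congrArg (Matrix.reindex e e) (toMatrix_mul (n := n) g h)).trans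
      (Matrix.submatrix_mul_equiv _ _ _ e.symm _).symm
  · ext i j
    by_cases hij : i = j <;>
      simp [signedGroup, toMatrix, realSign, hij]

end Pauli

namespace SignedGroup

/-- A matrix whose columns can, for every pair of distinct rows, be permuted so that the
contribution of each column is negated, has orthogonal rows. -/
lemma pairCount_add_eq_of_perm (S : SignedGroup) {n k : ℕ} (c : Fin n → Fin n → S.G)
    (x : Fin n → Fin n → Fin k) (a b : Fin n) (τ : Equiv.Perm (Fin n))
    (hc : ∀ j, c a (τ j) * (c b (τ j))⁻¹ = S.ε * (c a j * (c b j)⁻¹))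
    (hx : ∀ j, (x a (τ j) = x a j ∧ x b (τ j) = x b j) ∨
      (x a (τ j) = x b j ∧ x b (τ j) = x a j))
    (i i' : Fin k) (g : S.G) :
    S.pairCount (fun a j => some (c a j, x a j)) a b i i' g +
        S.pairCount (fun a j => some (c a j, x a j)) a b i' i g =
      S.pairCount (fun a j => some (c a j, x a j)) a b i i' (S.ε * g) +
        S.pairCount (fun a j => some (c a j, x a j)) a b i' i (S.ε * g) := by
  classical
  have key : ∀ (i i' : Fin k) (g : S.G),
      S.pairCount (fun a j => some (c a j, x a j)) a b i i' g =
        ∑ j, if x a j = i ∧ x b j = i' ∧ c a j * (c b j)⁻¹ = g then 1 else 0 := by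
    intro i i' g
    rw [← Finset.card_filter, ← Fintype.card_subtype, ← Nat.card_eq_fintype_card]
    refine Nat.card_congr (Equiv.subtypeEquivRight fun j => ?_)
    simp only [Option.some.injEq, Prod.mk.injEq]
    constructor
    · rintro ⟨s, s', ⟨rfl, rfl⟩, ⟨rfl, rfl⟩, h⟩
      exact ⟨rfl, rfl, h⟩
    · rintro ⟨rfl, rfl, h⟩
      exact ⟨_, _, ⟨rfl, rfl⟩, ⟨rfl, rfl⟩, h⟩
  simp only [key, ← Finset.sum_add_distrib]
  conv_rhs => rw [← Equiv.sum_comp τ]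
  refine Finset.sum_congr rfl fun j _ => ?_
  simp only [hc, mul_right_inj]
  rcases hx j with ⟨h₁, h₂⟩ | ⟨h₁, h₂⟩
  · simp only [h₁, h₂]
  · simp only [h₁, h₂]
    rw [add_comm]
    congr 2 <;> exact propext (by tauto)

end SignedGroup

namespace Design

/-- The shifts of fourteen pairwise anticommuting Pauli operators on seven qubits with
square `-1`. -/
def genShift : Fin 14 → Fin 7 → ZMod 2 :=
  ![![0, 0, 0, 0, 0, 0, 1], ![1, 0, 1, 1, 0, 0, 1], ![0, 0, 0, 0, 0, 1, 0],
    ![0, 1, 0, 0, 0, 0, 1], ![1, 0, 0, 1, 1, 0, 0], ![1, 0, 0, 0, 1, 1, 0],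
    ![0, 1, 1, 0, 1, 0, 0], ![1, 1, 1, 1, 0, 0, 0], ![1, 1, 1, 1, 1, 1, 0],
    ![1, 1, 1, 1, 0, 0, 1], ![0, 0, 0, 0, 1, 1, 0], ![0, 1, 0, 1, 1, 1, 0],
    ![1, 1, 1, 1, 0, 1, 0], ![1, 0, 1, 0, 1, 1, 0]]

/-- The phases of fourteen pairwise anticommuting Pauli operators on seven qubits with
square `-1`. -/
def genPhase : Fin 14 → Fin 7 → ZMod 2 :=
  ![![0, 0, 0, 0, 0, 0, 1], ![1, 1, 0, 0, 0, 1, 0], ![0, 0, 0, 1, 0, 1, 1],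
    ![0, 1, 0, 0, 1, 0, 0], ![0, 1, 0, 1, 0, 0, 1], ![1, 1, 1, 0, 0, 0, 1],
    ![1, 0, 0, 0, 1, 1, 1], ![1, 1, 0, 1, 1, 0, 1], ![0, 0, 1, 0, 1, 1, 1],
    ![1, 0, 0, 0, 1, 1, 0], ![0, 1, 1, 0, 1, 0, 1], ![1, 0, 1, 0, 0, 1, 1],
    ![1, 1, 0, 0, 0, 1, 1], ![0, 1, 0, 0, 1, 0, 1]]

/-- The generator with index `p`, with sign `(-1) ^ s`. -/
def gen (s : ZMod 2) (p : Fin 14) : (Pauli.signedGroup 7).G :=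
  (⟨s, genShift p, genPhase p⟩ : Pauli 7)

lemma genPhase_dotProduct_self : ∀ p, genPhase p ⬝ᵥ genShift p = 1 := by decide

lemma genPhase_dotProduct_add : ∀ p q, p ≠ q →
    genPhase p ⬝ᵥ genShift q + genPhase q ⬝ᵥ genShift p = 1 := by decide

lemma gen_mul_inv_swap (s t : ZMod 2) {p q : Fin 14} (h : p ≠ q) :
    gen t q * (gen s p)⁻¹ = (Pauli.signedGroup 7).ε * (gen s p * (gen t q)⁻¹) := by
  change (⟨t, genShift q, genPhase q⟩ : Pauli 7) * (⟨s, genShift p, genPhase p⟩ : Pauli 7)⁻¹ =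
    (⟨1, 0, 0⟩ : Pauli 7) *
      ((⟨s, genShift p, genPhase p⟩ : Pauli 7) * (⟨t, genShift q, genPhase q⟩ : Pauli 7)⁻¹)
  simp only [Pauli.mul_def, Pauli.inv_def, zero_dotProduct, zero_add, add_zero,
    CharTwo.neg_eq, genPhase_dotProduct_self, Pauli.mk.injEq]
  refine ⟨?_, add_comm _ _, add_comm _ _⟩
  have h₁ := genPhase_dotProduct_add p q h
  generalize genPhase p ⬝ᵥ genShift q = y at *
  generalize genPhase q ⬝ᵥ genShift p = z at *
  revert s t y z
  decide

lemma gen_mul_inv_self (s t : ZMod 2) (p : Fin 14) :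
    gen s p * (gen t p)⁻¹ = (⟨s + t, 0, 0⟩ : Pauli 7) := by
  change (⟨s, genShift p, genPhase p⟩ : Pauli 7) * (⟨t, genShift p, genPhase p⟩ : Pauli 7)⁻¹ = _
  simp only [Pauli.mul_def, Pauli.inv_def, genPhase_dotProduct_self, Pauli.mk.injEq,
    CharTwo.neg_eq]
  refine ⟨?_, ZModModule.add_self _, ZModModule.add_self _⟩
  revert s t
  decide

/-- The index group of rows and columns. -/
abbrev Idx : Type := ZMod 2 × ZMod 2 × ZMod 2 × ZMod 2 × ZMod 2

/-- The variable in the first row of the design. -/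
def varIdx : Idx → Fin 11
  | (c, d, x, y, z) =>
    if c = 0 ∧ d = 0 then Fin.ofNat 11 (4 * x.val + 2 * y.val + z.val)
    else Fin.ofNat 11 (7 + 2 * c.val + d.val)

/-- The index of the generator in the first row of the design. -/
def genIdx : Idx → Fin 14
  | (c, d, x, y, z) =>
    if c = 0 ∧ d = 0 then Fin.ofNat 14 (4 * x.val + 2 * y.val + z.val)
    else Fin.ofNat 14 (6 + 2 * (2 * c.val + d.val) + z.val)

/-- The sign in the first row of the design: a bent function of two of the coordinates. -/
def sgnIdx : Idx → ZMod 2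
  | (c, d, x, y, _) => if c = 0 ∧ d = 0 then 0 else x * y

/-- The pairing of columns with cancelling contributions to the inner product of two rows that
differ by `u`. -/
def pairing (u s : Idx) : Idx :=
  if genIdx s = genIdx (s + u) then s + (0, 0, u.2.2.2.1, u.2.2.1 + u.2.2.2.1, 0) else s + u

lemma pairing_involutive : ∀ u : Idx, Function.Involutive (pairing u) := by
  unfold Function.Involutive; decide +kernel

lemma pairing_spec : ∀ u : Idx, u ≠ 0 → ∀ s : Idx,
    (genIdx s ≠ genIdx (s + u) ∧ pairing u s = s + u) ∨
    (genIdx s = genIdx (s + u) ∧ genIdx (pairing u s) = genIdx (pairing u s + u) ∧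
      sgnIdx (pairing u s) + sgnIdx (pairing u s + u) = 1 + (sgnIdx s + sgnIdx (s + u)) ∧
      varIdx (pairing u s) = varIdx s ∧ varIdx (pairing u s + u) = varIdx (s + u)) := by
  decide +kernel

lemma card_varIdx_eq : ∀ i, Fintype.card {s : Idx // varIdx s = i} =
    (![1, 1, 1, 1, 1, 1, 1, 1, 8, 8, 8] : Fin 11 → ℕ) i := by
  decide +kernel

/-- The coefficient in the first row of the design. -/
def coeff (s : Idx) : (Pauli.signedGroup 7).G := gen (sgnIdx s) (genIdx s)

lemma coeff_pairing {u : Idx} (hu : u ≠ 0) (s : Idx) :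
    coeff (pairing u s) * (coeff (pairing u s + u))⁻¹ =
      (Pauli.signedGroup 7).ε * (coeff s * (coeff (s + u))⁻¹) := by
  rcases pairing_spec u hu s with ⟨h, hp⟩ | ⟨h, hp, hs, -, -⟩
  · rw [hp, add_assoc, ZModModule.add_self, add_zero]
    exact gen_mul_inv_swap _ _ h
  · simp only [coeff, ← h, ← hp, gen_mul_inv_self, hs]
    change _ = (⟨1, 0, 0⟩ : Pauli 7) * (⟨_, 0, 0⟩ : Pauli 7)
    simp [Pauli.mul_def]

lemma varIdx_pairing {u : Idx} (hu : u ≠ 0) (s : Idx) :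
    (varIdx (pairing u s) = varIdx s ∧ varIdx (pairing u s + u) = varIdx (s + u)) ∨
      (varIdx (pairing u s) = varIdx (s + u) ∧ varIdx (pairing u s + u) = varIdx s) := by
  rcases pairing_spec u hu s with ⟨-, hp⟩ | ⟨-, -, -, h⟩
  · right
    rw [hp, add_assoc, ZModModule.add_self, add_zero]
    exact ⟨rfl, rfl⟩
  · exact Or.inl h

/-- The design developed from its first row over the group `Idx`. -/
lemma isSOD_develop {n : ℕ} (e : Fin n ≃ Idx) :
    (Pauli.signedGroup 7).IsSOD ![1, 1, 1, 1, 1, 1, 1, 1, 8, 8, 8]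
      (fun a j : Fin n => some (coeff (e j + e a), varIdx (e j + e a))) := by
  refine ⟨fun a i => ?_, fun a b hab => ?_⟩
  · rw [← card_varIdx_eq, ← Nat.card_eq_fintype_card]
    refine Nat.card_congr ((e.trans (Equiv.addRight (e a))).subtypeEquiv fun j => ?_)
    simp
  · have hu : e a + e b ≠ 0 := fun h => hab (e.injective (by
      rw [← sub_eq_zero, ZModModule.sub_eq_add, h]))
    have hb : ∀ j, e j + e b = e j + e a + (e a + e b) := fun j => by
      rw [add_assoc, ← add_assoc (e a), ZModModule.add_self, zero_add]
    let f : Fin n ≃ Idx := e.trans (Equiv.addRight (e a))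
    let τ : Equiv.Perm (Fin n) :=
      f.trans ((pairing_involutive (e a + e b)).toPerm.trans f.symm)
    have hτ : ∀ j, e (τ j) + e a = pairing (e a + e b) (e j + e a) := fun j =>
      f.apply_symm_apply _
    refine SignedGroup.pairCount_add_eq_of_perm (Pauli.signedGroup 7)
      (fun a j => coeff (e j + e a)) (fun a j => varIdx (e j + e a)) a b τ (fun j => ?_)
      (fun j => ?_)
    · rw [hb (τ j), hb j, hτ]
      exact coeff_pairing hu _
    · rw [hb (τ j), hb j, hτ]
      exact varIdx_pairing hu _

end Design

/-- There exist a signed group `S`, a full `SOD(2^5; 1,1,1,1,1,1,1,1,8,8,8)`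
over `S`, and a remrep of `S` of degree `2^7`. -/
theorem exists_full_SOD_32_ones_eights :
    ∃ (S : SignedGroup)
      (X : Fin (2 ^ 5) → Fin (2 ^ 5) → Option (S.G × Fin 11))
      (φ : S.G → Matrix (Fin (2 ^ 7)) (Fin (2 ^ 7)) ℝ),
      S.IsSOD ![1, 1, 1, 1, 1, 1, 1, 1, 8, 8, 8] X ∧ S.IsFull X ∧ IsRemrep S (2 ^ 7) φ := by
  have hn : Fintype.card Design.Idx = 2 ^ 5 := by simp [ZMod.card]
  have hm : Fintype.card (Fin 7 → ZMod 2) = 2 ^ 7 := by simp [ZMod.card]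
  exact ⟨Pauli.signedGroup 7, _, _,
    Design.isSOD_develop (Fintype.equivFinOfCardEq hn).symm,
    fun _ _ => Option.some_ne_none _,
    Pauli.isRemrep_reindex (Fintype.equivFinOfCardEq hm)⟩
end
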